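/- Jump relations for the exterior Szegő-type function: Define g′(z) = ((A+B+2)/2)·R(z)/(z²−1) − (A/2)/(z−1) − (B/2)/(z+1) for z in the unbounded component Ω_∞ of ℂ∖Γ, and g′(z) = −((A+B+2)/2)·R(z)/(z²−1) − (A/2)/(z−1) − (B/2)/(z+1) for z in the bounded components Ω_{−1} ∪ Ω_1, and let G(z) = exp( ∫_{ζ₋}^z g′(t) dt ) with path of integration in ℂ∖Γ except for the initial point. Then: (i) G is single-valued and analytic in each component of ℂ∖Γ, with G(ζ₋) = 1; (ii) the limit κ = lim_{z→∞} G(z)/z exists and is nonzero; (iii) for z ∈ Γ∖{ζ₊,ζ₋}, G₊(z)·G₋(z) = w(ζ₋;A,B)/w(z;A,B); and (iv) for z ∈ Γ∖{ζ₊,ζ₋}, G₊(z)/G₋(z) = exp(−2φ₊(z)). -/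

import Mathlib

open Complex Set Filter Topology Bornology

noncomputable section

/-- The branch point `ζ₊`. -/
def zetaP (A B : ℝ) : ℂ :=
  (((B : ℂ) ^ 2 - (A : ℂ) ^ 2) +
      4 * Complex.I * ((Real.sqrt ((A + 1) * (B + 1) * (-A - B - 1)) : ℝ) : ℂ)) /
    ((A : ℂ) + (B : ℂ) + 2) ^ 2

/-- The branch point `ζ₋`. -/
def zetaM (A B : ℝ) : ℂ :=
  (((B : ℂ) ^ 2 - (A : ℂ) ^ 2) -
      4 * Complex.I * ((Real.sqrt ((A + 1) * (B + 1) * (-A - B - 1)) : ℝ) : ℂ)) /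
    ((A : ℂ) + (B : ℂ) + 2) ^ 2

/-- The set `Γ = { z : Re ∫_{ζ₋}^z ((t−ζ₊)(t−ζ₋))^{1/2}/(t²−1) dt = 0 }`. -/
def GammaSet (A B : ℝ) : Set ℂ :=
  {z | ∃ γ g : ℝ → ℂ, ContDiff ℝ 1 γ ∧ γ 0 = zetaM A B ∧ γ 1 = z ∧
    (∀ t ∈ Set.Icc (0 : ℝ) 1, γ t ≠ 1 ∧ γ t ≠ -1) ∧
    ContinuousOn g (Set.Icc 0 1) ∧
    (∀ t ∈ Set.Icc (0 : ℝ) 1, g t ^ 2 = (γ t - zetaP A B) * (γ t - zetaM A B)) ∧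
    (∫ t in (0:ℝ)..1, g t / ((γ t) ^ 2 - 1) * deriv γ t).re = 0}

/-- `γL, γC, γR` are injective regular C¹ parametrizations of the three arcs of `Γ`,
with the orientation of the paper: `Γ_L`, `Γ_C` run from `ζ₊` to `ζ₋`, and `Γ_R` from
`ζ₋` to `ζ₊`; `Γ_L`, `Γ_C`, `Γ_R` cross the real line in `(−∞,−1)`, `(−1,1)`, `(1,∞)`
respectively, and their union is `Γ`. -/
structure ArcParam (A B : ℝ) (γL γC γR : ℝ → ℂ) : Prop where
  smoothL : ContDiff ℝ 1 γL
  smoothC : ContDiff ℝ 1 γC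
  smoothR : ContDiff ℝ 1 γR
  injL : Set.InjOn γL (Set.Icc 0 1)
  injC : Set.InjOn γC (Set.Icc 0 1)
  injR : Set.InjOn γR (Set.Icc 0 1)
  regL : ∀ t ∈ Set.Icc (0:ℝ) 1, deriv γL t ≠ 0
  regC : ∀ t ∈ Set.Icc (0:ℝ) 1, deriv γC t ≠ 0
  regR : ∀ t ∈ Set.Icc (0:ℝ) 1, deriv γR t ≠ 0
  endL0 : γL 0 = zetaP A B
  endL1 : γL 1 = zetaM A B
  endC0 : γC 0 = zetaP A B
  endC1 : γC 1 = zetaM A B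
  endR0 : γR 0 = zetaM A B
  endR1 : γR 1 = zetaP A B
  union : γL '' Set.Icc 0 1 ∪ γC '' Set.Icc 0 1 ∪ γR '' Set.Icc 0 1 = GammaSet A B
  crossL : ∀ t ∈ Set.Icc (0:ℝ) 1, (γL t).im = 0 → (γL t).re < -1
  crossC : ∀ t ∈ Set.Icc (0:ℝ) 1, (γC t).im = 0 → -1 < (γC t).re ∧ (γC t).re < 1
  crossR : ∀ t ∈ Set.Icc (0:ℝ) 1, (γR t).im = 0 → 1 < (γR t).re

/-- `R` is the single-valued analytic branch of `((z−ζ₊)(z−ζ₋))^{1/2}` on `ℂ ∖ Γ_C`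
with `R(z)/z → 1` as `z → ∞`, where `Γ_C` is the image of `γC`. -/
def IsSqrtBranch (A B : ℝ) (γC : ℝ → ℂ) (R : ℂ → ℂ) : Prop :=
  DifferentiableOn ℂ R (γC '' Set.Icc 0 1)ᶜ ∧
  (∀ z ∉ γC '' Set.Icc 0 1, R z ^ 2 = (z - zetaP A B) * (z - zetaM A B)) ∧
  Filter.Tendsto (fun z => R z / z) (Bornology.cobounded ℂ) (nhds 1)

/-- `Rp` is the boundary value `R₊` of `R` on the cut `Γ_C`, taken from the `+` side
(the left-hand side with respect to the orientation of `γC`). -/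
def IsPlusBoundary (A B : ℝ) (γC : ℝ → ℂ) (R : ℂ → ℂ) (Rp : ℝ → ℂ) : Prop :=
  ContinuousOn Rp (Set.Icc 0 1) ∧
  (∀ t ∈ Set.Icc (0:ℝ) 1, Rp t ^ 2 = (γC t - zetaP A B) * (γC t - zetaM A B)) ∧
  ∀ t ∈ Set.Ioo (0:ℝ) 1,
    Filter.Tendsto (fun ε : ℝ => R (γC t + (ε : ℂ) * (Complex.I * deriv γC t)))
      (nhdsWithin 0 (Set.Ioi 0)) (nhds (Rp t))

/-- The critical orthogonal trajectories in the (open) lower half-plane: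
`{ z ∈ ℂ⁻ : Im ∫_{ζ₋}^z R(t)/(t²−1) dt = 0 }`, the path lying in `ℂ⁻ ∖ Γ_C`. -/
def orthoLower (A B : ℝ) (ΓC : Set ℂ) (R : ℂ → ℂ) : Set ℂ :=
  {z | z.im < 0 ∧ ∃ γ : ℝ → ℂ, ContDiff ℝ 1 γ ∧ γ 0 = zetaM A B ∧ γ 1 = z ∧
    (∀ t ∈ Set.Ioc (0:ℝ) 1, (γ t).im < 0 ∧ γ t ∉ ΓC) ∧
    (∫ t in (0:ℝ)..1, R (γ t) / ((γ t) ^ 2 - 1) * deriv γ t).im = 0}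

/-- The critical orthogonal trajectories `γ_1⁺ ∪ γ_{−1}⁺ ∪ γ_∞⁺` in the upper
half-plane: the mirror images in `ℝ` of those in the lower half-plane. -/
def orthoUpper (A B : ℝ) (ΓC : Set ℂ) (R : ℂ → ℂ) : Set ℂ :=
  {z | (starRingEnd ℂ) z ∈ orthoLower A B ΓC R}

open scoped Classical in
/-- The function `g′`: `g′(z) = ±((A+B+2)/2)·R(z)/(z²−1) − (A/2)/(z−1) − (B/2)/(z+1)`,
with sign `+` on the unbounded component `Ω_∞` of `ℂ∖Γ` and sign `−` on the bounded
components `Ω_{−1} ∪ Ω_1`. -/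
def gD (A B : ℝ) (R : ℂ → ℂ) (z : ℂ) : ℂ :=
  (if Bornology.IsBounded (connectedComponentIn (GammaSet A B)ᶜ z) then
      -((((A : ℂ) + B + 2) / 2) * (R z / (z ^ 2 - 1)))
    else (((A : ℂ) + B + 2) / 2) * (R z / (z ^ 2 - 1)))
    - ((A : ℂ) / 2) / (z - 1) - ((B : ℂ) / 2) / (z + 1)


/-- abstract parameters of the curve -/
structure SzPar where
  c : ℝ
  s : ℝ
  a : ℝ
  b : ℝ
  hs : 0 < s
  ha : 0 < a
  hb : 0 < b
  h1 : (1 - c) ^ 2 + s ^ 2 = (2 * a) ^ 2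
  h2 : (1 + c) ^ 2 + s ^ 2 = (2 * b) ^ 2

namespace SzPar

variable (P : SzPar)

def v1 : ℝ := ((1 - P.c) + 2 * P.a) / P.s
def v2 : ℝ := ((-1 - P.c) + 2 * P.b) / P.s
def zp : ℂ := (P.c : ℂ) + P.s * I
def zm : ℂ := (P.c : ℂ) - P.s * I
def p (z : ℂ) : ℂ := (z - P.zp) * (z - P.zm)

def Hv (v : ℂ) : ℝ :=
  Real.log ‖v‖ + P.a * (Real.log ‖v - P.v1‖ - Real.log ‖(P.v1 : ℂ) * v + 1‖)
    - P.b * (Real.log ‖v - P.v2‖ - Real.log ‖(P.v2 : ℂ) * v + 1‖)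

def fv (v : ℂ) : ℂ :=
  1 / v + P.a * (1 / (v - P.v1) - P.v1 / ((P.v1 : ℂ) * v + 1))
    - P.b * (1 / (v - P.v2) - P.v2 / ((P.v2 : ℂ) * v + 1))

def V (z y : ℂ) : ℂ := (z - P.c + y) / P.s

def H (z y : ℂ) : ℝ := P.Hv (P.V z y)

lemma p_eq (z : ℂ) : P.p z = (z - P.c) ^ 2 + (P.s : ℂ) ^ 2 := by
  unfold p zp zm; linear_combination (-(P.s:ℂ)^2) * I_sq

lemma s_ne : (P.s : ℂ) ≠ 0 := by exact_mod_cast P.hs.ne'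

lemma v1_pos : 0 < P.v1 := by
  have := P.h1; have := P.hs; have := P.ha
  unfold v1; apply div_pos _ P.hs
  have : |1 - P.c| < 2 * P.a := by apply abs_lt_of_sq_lt_sq (by nlinarith) (by linarith)
  linarith [(abs_lt.1 this).1]

lemma v2_pos : 0 < P.v2 := by
  have := P.h2; have := P.hs; have := P.hb
  unfold v2; apply div_pos _ P.hs
  have : |1 + P.c| < 2 * P.b := by apply abs_lt_of_sq_lt_sq (by nlinarith) (by linarith)
  linarith [(abs_lt.1 this).2]

lemma v1_eq : (P.v1 : ℂ) * P.s = 1 - P.c + 2 * P.a := by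
  have := P.s_ne; unfold v1; push_cast; field_simp

lemma v2_eq : (P.v2 : ℂ) * P.s = -1 - P.c + 2 * P.b := by
  have := P.s_ne; unfold v2; push_cast; field_simp

lemma h1c : (1 - (P.c:ℂ)) ^ 2 + P.s ^ 2 = (2 * P.a) ^ 2 := by exact_mod_cast P.h1
lemma h2c : (1 + (P.c:ℂ)) ^ 2 + P.s ^ 2 = (2 * P.b) ^ 2 := by exact_mod_cast P.h2

lemma V_mul {z y : ℂ} : P.V z y * P.s = z - P.c + y := by
  have := P.s_ne; unfold V; field_simp

lemma V_mul_neg {z y : ℂ} (h : y ^ 2 = P.p z) : P.V z y * P.V z (-y) = -1 := by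
  have := P.s_ne; unfold V; field_simp; rw [p_eq] at h; linear_combination -h

lemma V_ne {z y : ℂ} (h : y ^ 2 = P.p z) : P.V z y ≠ 0 := by
  intro h0; have := P.V_mul_neg h; rw [h0] at this; norm_num at this

lemma V1_mul {z y : ℂ} (h : y ^ 2 = P.p z) :
    (P.V z y - P.v1) * (P.v1 * P.V z y + 1) * P.s = 2 * P.v1 * P.V z y * (z - 1) := by
  have hs := P.s_ne
  have e1 := P.v1_eq
  have e2 := P.V_mul (z := z) (y := y)
  have e3 := P.h1c
  rw [p_eq] at h
  have : ((P.V z y - P.v1) * (P.v1 * P.V z y + 1) * P.s - 2 * P.v1 * P.V z y * (z - 1)) * P.s ^ 2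
    = 0 := by
    generalize P.V z y = v at *
    generalize (P.v1 : ℂ) = w at *
    have hz : z = v * P.s + P.c - y := by linear_combination -e2
    have h' : v ^ 2 * P.s ^2 - 2 * v * P.s * y + P.s ^ 2 = 0 := by
      rw [hz] at h; linear_combination -h
    have h'' : w ^ 2 * P.s ^2 - 2 * w * P.s * (1 - P.c) - P.s ^ 2 = 0 := by
      have ha : (P.a : ℂ) = (w * P.s - (1 - P.c)) / 2 := by linear_combination (-1/2) * e1
      rw [ha] at e3; linear_combination -e3
    rw [hz]
    linear_combination (-v * P.s) * h'' - (w * P.s) * h'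
  exact sub_eq_zero.1 ((mul_eq_zero.1 this).resolve_right (pow_ne_zero _ hs))

lemma V2_mul {z y : ℂ} (h : y ^ 2 = P.p z) :
    (P.V z y - P.v2) * (P.v2 * P.V z y + 1) * P.s = 2 * P.v2 * P.V z y * (z + 1) := by
  have hs := P.s_ne
  have e1 := P.v2_eq
  have e2 := P.V_mul (z := z) (y := y)
  have e3 := P.h2c
  rw [p_eq] at h
  have : ((P.V z y - P.v2) * (P.v2 * P.V z y + 1) * P.s - 2 * P.v2 * P.V z y * (z + 1)) * P.s ^ 2
    = 0 := by
    generalize P.V z y = v at *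
    generalize (P.v2 : ℂ) = w at *
    have hz : z = v * P.s + P.c - y := by linear_combination -e2
    have h' : v ^ 2 * P.s ^2 - 2 * v * P.s * y + P.s ^ 2 = 0 := by
      rw [hz] at h; linear_combination -h
    have h'' : w ^ 2 * P.s ^2 - 2 * w * P.s * (-1 - P.c) - P.s ^ 2 = 0 := by
      have ha : (P.b : ℂ) = (w * P.s - (-1 - P.c)) / 2 := by linear_combination (-1/2) * e1
      rw [ha] at e3; linear_combination -e3
    rw [hz]
    linear_combination (-v * P.s) * h'' - (w * P.s) * h'
  exact sub_eq_zero.1 ((mul_eq_zero.1 this).resolve_right (pow_ne_zero _ hs))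

lemma v1c_ne : (P.v1 : ℂ) ≠ 0 := by exact_mod_cast P.v1_pos.ne'
lemma v2c_ne : (P.v2 : ℂ) ≠ 0 := by
  have h := P.v2_pos.ne'
  exact_mod_cast h

/-- the good points of the `v`-plane -/
def Vgood (v : ℂ) : Prop :=
  v ≠ 0 ∧ v - P.v1 ≠ 0 ∧ (P.v1 : ℂ) * v + 1 ≠ 0 ∧ v - P.v2 ≠ 0 ∧ (P.v2 : ℂ) * v + 1 ≠ 0

lemma V_good {z y : ℂ} (h : y ^ 2 = P.p z) (h1 : z ≠ 1) (h2 : z ≠ -1) : P.Vgood (P.V z y) := by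
  have hv := P.V_ne h
  have e1 := P.V1_mul h
  have e2 := P.V2_mul h
  have n1 : 2 * (P.v1:ℂ) * P.V z y * (z - 1) ≠ 0 :=
    mul_ne_zero (mul_ne_zero (mul_ne_zero two_ne_zero P.v1c_ne) hv) (sub_ne_zero.2 h1)
  have n2 : 2 * (P.v2:ℂ) * P.V z y * (z + 1) ≠ 0 :=
    mul_ne_zero (mul_ne_zero (mul_ne_zero two_ne_zero P.v2c_ne) hv)
      (fun h => h2 (by linear_combination h))
  rw [← e1] at n1
  rw [← e2] at n2
  exact ⟨hv, left_ne_zero_of_mul (left_ne_zero_of_mul n1),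
    right_ne_zero_of_mul (left_ne_zero_of_mul n1), left_ne_zero_of_mul (left_ne_zero_of_mul n2),
    right_ne_zero_of_mul (left_ne_zero_of_mul n2)⟩

lemma fv_eq {z y : ℂ} (h : y ^ 2 = P.p z) (h1 : z ≠ 1) (h2 : z ≠ -1) :
    P.fv (P.V z y) * (P.V z y * (z ^ 2 - 1)) = y ^ 2 := by
  have hg := P.V_good h h1 h2
  have e1 := P.V1_mul h
  have e2 := P.V2_mul h
  have ew := P.v1_eq
  have ew2 := P.v2_eq
  have hs := P.s_ne
  obtain ⟨g0, g1, g2, g3, g4⟩ := hg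
  have z1 : z - 1 ≠ 0 := sub_ne_zero.2 h1
  have z2 : z + 1 ≠ 0 := fun h => h2 (by linear_combination h)
  have k1 : 1 / (P.V z y - P.v1) - P.v1 / ((P.v1 : ℂ) * P.V z y + 1)
      = 2 * P.a / (P.V z y * (z - 1)) := by
    have : 1 / (P.V z y - P.v1) - P.v1 / ((P.v1 : ℂ) * P.V z y + 1)
      = (1 + P.v1 ^ 2) * P.s / ((P.V z y - P.v1) * (P.v1 * P.V z y + 1) * P.s) := by
      rw [div_sub_div _ _ g1 g2, div_eq_div_iff (mul_ne_zero g1 g2) (mul_ne_zero (mul_ne_zero g1 g2) hs)]; ring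
    have hv1 := P.v1c_ne
    rw [this, e1, div_eq_div_iff (mul_ne_zero (mul_ne_zero (mul_ne_zero two_ne_zero hv1) g0) z1)
      (mul_ne_zero g0 z1)]
    have h'' : (1 + (P.v1:ℂ) ^ 2) * P.s = 4 * P.a * P.v1 := by
      apply mul_right_cancel₀ hs
      have e3 := P.h1c
      have ha : (P.a : ℂ) = (P.v1 * P.s - (1 - P.c)) / 2 := by linear_combination (-1/2) * ew
      rw [ha] at e3 ⊢; linear_combination e3
    rw [h'']; ring
  have k2 : 1 / (P.V z y - P.v2) - P.v2 / ((P.v2 : ℂ) * P.V z y + 1)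
      = 2 * P.b / (P.V z y * (z + 1)) := by
    have : 1 / (P.V z y - P.v2) - P.v2 / ((P.v2 : ℂ) * P.V z y + 1)
      = (1 + P.v2 ^ 2) * P.s / ((P.V z y - P.v2) * (P.v2 * P.V z y + 1) * P.s) := by
      rw [div_sub_div _ _ g3 g4, div_eq_div_iff (mul_ne_zero g3 g4) (mul_ne_zero (mul_ne_zero g3 g4) hs)]; ring
    have hv1 := P.v2c_ne
    rw [this, e2, div_eq_div_iff (mul_ne_zero (mul_ne_zero (mul_ne_zero two_ne_zero hv1) g0) z2)
      (mul_ne_zero g0 z2)]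
    have h'' : (1 + (P.v2:ℂ) ^ 2) * P.s = 4 * P.b * P.v2 := by
      apply mul_right_cancel₀ hs
      have e3 := P.h2c
      have ha : (P.b : ℂ) = (P.v2 * P.s - (-1 - P.c)) / 2 := by linear_combination (-1/2) * ew2
      rw [ha] at e3 ⊢; linear_combination e3
    rw [h'']; ring
  unfold fv
  rw [k1, k2, h, p_eq]
  field_simp
  linear_combination (z ^ 2 - 1) * ((-1/2) * (z + 1) * P.h1c + (1/2) * (z - 1) * P.h2c)

lemma Hv_neg_inv {v : ℂ} (hv : P.Vgood v) : P.Hv (-1 / v) = - P.Hv v := by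
  obtain ⟨g0, g1, g2, g3, g4⟩ := hv
  unfold Hv
  have e1 : -1 / v - P.v1 = -(P.v1 * v + 1) / v := by field_simp; ring
  have e2 : P.v1 * (-1 / v) + 1 = (v - P.v1) / v := by field_simp; ring
  have e3 : -1 / v - P.v2 = -(P.v2 * v + 1) / v := by field_simp; ring
  have e4 : P.v2 * (-1 / v) + 1 = (v - P.v2) / v := by field_simp; ring
  have n0 : ‖v‖ ≠ 0 := norm_ne_zero_iff.2 g0
  rw [e1, e2, e3, e4]
  simp only [norm_div, norm_neg, norm_one]
  rw [Real.log_div one_ne_zero n0, Real.log_div (norm_ne_zero_iff.2 g1) n0,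
    Real.log_div (norm_ne_zero_iff.2 g2) n0, Real.log_div (norm_ne_zero_iff.2 g3) n0,
    Real.log_div (norm_ne_zero_iff.2 g4) n0, Real.log_one]
  ring

lemma H_neg {z y : ℂ} (h : y ^ 2 = P.p z) (h1 : z ≠ 1) (h2 : z ≠ -1) :
    P.H z (-y) = - P.H z y := by
  have e : P.V z (-y) = -1 / P.V z y := by
    rw [eq_div_iff (P.V_ne h), mul_comm, P.V_mul_neg h]
  unfold H; rw [e, P.Hv_neg_inv (P.V_good h h1 h2)]

lemma Hv_conj (v : ℂ) : P.Hv ((starRingEnd ℂ) v) = P.Hv v := by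
  have e : ∀ w : ℂ, ‖(starRingEnd ℂ) w‖ = ‖w‖ := fun w => by simp
  unfold Hv
  rw [← e (v - P.v1), ← e (P.v1 * v + 1), ← e (v - P.v2), ← e (P.v2 * v + 1), e v]
  simp

lemma H_conj (z y : ℂ) : P.H ((starRingEnd ℂ) z) ((starRingEnd ℂ) y) = P.H z y := by
  unfold H; rw [← P.Hv_conj (P.V z y)]; unfold V; simp

lemma p_conj (z : ℂ) : P.p ((starRingEnd ℂ) z) = (starRingEnd ℂ) (P.p z) := by
  rw [p_eq, p_eq]; simp

lemma hasDerivAt_log_norm {x : ℝ → ℂ} {x' : ℂ} {t : ℝ} (h : HasDerivAt x x' t) (h0 : x t ≠ 0) :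
    HasDerivAt (fun t => Real.log ‖x t‖) (x' / x t).re t := by
  have hre : HasDerivAt (fun t => (x t).re) x'.re t := by
    exact (Complex.reCLM.hasFDerivAt.comp_hasDerivAt t h)
  have him : HasDerivAt (fun t => (x t).im) x'.im t := by
    exact (Complex.imCLM.hasFDerivAt.comp_hasDerivAt t h)
  have hn : (x t).re * (x t).re + (x t).im * (x t).im ≠ 0 := by
    have := (normSq_pos.2 h0).ne'; rwa [normSq_apply] at this
  have h3 := (((hre.mul hre).add (him.mul him)).log hn).const_mul (1/2)
  have e : (fun t => Real.log ‖x t‖) =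
      fun t => 1/2 * Real.log ((x t).re * (x t).re + (x t).im * (x t).im) := by
    funext t
    rw [← normSq_apply, normSq_eq_norm_sq, Real.log_pow]; push_cast; ring
  rw [e]
  refine h3.congr_deriv ?_
  rw [Complex.div_re, normSq_apply]
  simp only [Pi.add_apply, Pi.mul_apply]
  field_simp
  ring

lemma Hv_hasDerivAt {x : ℝ → ℂ} {x' : ℂ} {t : ℝ} (h : HasDerivAt x x' t) (h0 : P.Vgood (x t)) :
    HasDerivAt (fun t => P.Hv (x t)) (P.fv (x t) * x').re t := by
  obtain ⟨g0, g1, g2, g3, g4⟩ := h0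
  have d0 := hasDerivAt_log_norm h g0
  have d1 := hasDerivAt_log_norm (h.sub_const (P.v1:ℂ)) g1
  have d2 := hasDerivAt_log_norm ((h.const_mul (P.v1:ℂ)).add_const (1:ℂ)) g2
  have d3 := hasDerivAt_log_norm (h.sub_const (P.v2:ℂ)) g3
  have d4 := hasDerivAt_log_norm ((h.const_mul (P.v2:ℂ)).add_const (1:ℂ)) g4
  have d := (d0.add ((d1.sub d2).const_mul P.a)).sub ((d3.sub d4).const_mul P.b)
  refine d.congr_deriv ?_
  have e : P.fv (x t) * x' = x' / x t + P.a * (x' / (x t - P.v1) - P.v1 * x' / (P.v1 * x t + 1))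
      - P.b * (x' / (x t - P.v2) - P.v2 * x' / (P.v2 * x t + 1)) := by
    unfold fv; ring
  rw [e]
  simp only [Complex.sub_re, Complex.add_re, Complex.re_ofReal_mul]

lemma Hv_continuousAt {v : ℂ} (hv : P.Vgood v) : ContinuousAt P.Hv v := by
  obtain ⟨g0, g1, g2, g3, g4⟩ := hv
  unfold Hv
  have l : ∀ f : ℂ → ℂ, Continuous f → f v ≠ 0 → ContinuousAt (fun v => Real.log ‖f v‖) v :=
    fun f hf h0 => (hf.norm.continuousAt).log (norm_ne_zero_iff.2 h0)
  exact ((l _ (by fun_prop) g0).add (continuousAt_const.mul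
    ((l _ (by fun_prop) g1).sub (l _ (by fun_prop) g2)))).sub (continuousAt_const.mul
    ((l _ (by fun_prop) g3).sub (l _ (by fun_prop) g4)))

lemma H_continuousAt {z y : ℂ} (h : y ^ 2 = P.p z) (h1 : z ≠ 1) (h2 : z ≠ -1) :
    ContinuousAt (fun q : ℂ × ℂ => P.H q.1 q.2) (z, y) := by
  unfold H
  have hc : ContinuousAt (fun q : ℂ × ℂ => P.V q.1 q.2) (z, y) := by unfold V; fun_prop
  have := P.Hv_continuousAt (P.V_good h h1 h2)
  exact ContinuousAt.comp (f := fun q : ℂ × ℂ => P.V q.1 q.2) (x := (z, y)) this hc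

end SzPar

namespace SzPar
variable (P : SzPar)

lemma Vgood_of_im {v : ℂ} (h : v.im ≠ 0) : P.Vgood v := by
  have key : ∀ w : ℂ, w.im ≠ 0 → w ≠ 0 := fun w hw h0 => hw (by simp [h0])
  have := P.v1_pos.ne'
  have := P.v2_pos.ne'
  refine ⟨key _ h, key _ ?_, key _ ?_, key _ ?_, key _ ?_⟩ <;> simp [*]

lemma Vgood_isOpen : IsOpen {v | P.Vgood v} := by
  unfold Vgood
  refine IsOpen.inter (isOpen_ne_fun (by fun_prop) (by fun_prop)) ?_
  refine IsOpen.inter (isOpen_ne_fun (by fun_prop) (by fun_prop)) ?_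
  refine IsOpen.inter (isOpen_ne_fun (by fun_prop) (by fun_prop)) ?_
  exact IsOpen.inter (isOpen_ne_fun (by fun_prop) (by fun_prop))
    (isOpen_ne_fun (by fun_prop) (by fun_prop))

/-- inverse of `V` -/
def zv (v : ℂ) : ℂ := P.c + P.s / 2 * (v - 1 / v)
def yv (v : ℂ) : ℂ := P.s / 2 * (v + 1 / v)

lemma yv_sq {v : ℂ} (hv : v ≠ 0) : P.yv v ^ 2 = P.p (P.zv v) := by
  rw [p_eq]; unfold yv zv; field_simp; ring

lemma V_zv {v : ℂ} (hv : v ≠ 0) : P.V (P.zv v) (P.yv v) = v := by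
  have := P.s_ne
  unfold V zv yv; field_simp; ring

lemma zv_V {z y : ℂ} (h : y ^ 2 = P.p z) : P.zv (P.V z y) = z := by
  have hv := P.V_ne h
  have e := P.V_mul_neg h
  have e1 := P.V_mul (z := z) (y := y)
  have e2 := P.V_mul (z := z) (y := -y)
  unfold zv
  have : 1 / P.V z y = - P.V z (-y) := by
    rw [div_eq_iff hv]; linear_combination e
  rw [this]; linear_combination (1/2) * e1 + (1/2) * e2

lemma yv_V {z y : ℂ} (h : y ^ 2 = P.p z) : P.yv (P.V z y) = y := by
  have hv := P.V_ne h
  have e := P.V_mul_neg h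
  have e1 := P.V_mul (z := z) (y := y)
  have e2 := P.V_mul (z := z) (y := -y)
  unfold yv
  have : 1 / P.V z y = - P.V z (-y) := by
    rw [div_eq_iff hv]; linear_combination e
  rw [this]; linear_combination (1/2) * e1 - (1/2) * e2

lemma zv_ne {v : ℂ} (hg : P.Vgood v) : P.zv v ≠ 1 ∧ P.zv v ≠ -1 := by
  have e1 := P.V1_mul (P.yv_sq hg.1)
  have e2 := P.V2_mul (P.yv_sq hg.1)
  rw [P.V_zv hg.1] at e1 e2
  obtain ⟨g0, g1, g2, g3, g4⟩ := hg
  constructor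
  · intro h; rw [h, sub_self, mul_zero] at e1
    exact mul_ne_zero (mul_ne_zero g1 g2) P.s_ne e1
  · intro h; rw [h, neg_add_cancel, mul_zero] at e2
    exact mul_ne_zero (mul_ne_zero g3 g4) P.s_ne e2

lemma Hv_zero {v0 : ℂ} (h0 : v0 ^ 2 = -1) : P.Hv v0 = 0 := by
  have hi : v0.im ≠ 0 := by
    intro h
    have : v0 = (v0.re : ℂ) := by apply Complex.ext <;> simp [h]
    rw [this] at h0
    have h' : v0.re ^ 2 = -1 := by exact_mod_cast h0
    nlinarith [sq_nonneg v0.re]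
  have hg := P.Vgood_of_im hi
  have := P.Hv_neg_inv hg
  have e : -1 / v0 = v0 := by rw [div_eq_iff hg.1, ← h0]; ring
  rw [e] at this; linarith

lemma im_ne_of_sq {v0 : ℂ} (h0 : v0 ^ 2 = -1) : v0.im ≠ 0 := by
  intro h
  have : v0 = (v0.re : ℂ) := by apply Complex.ext <;> simp [h]
  rw [this] at h0
  have h' : v0.re ^ 2 = -1 := by exact_mod_cast h0
  nlinarith [sq_nonneg v0.re]

lemma fv_bound {v0 : ℂ} (h0 : v0 ^ 2 = -1) : ∃ C > 0, ∃ δ > 0, ∀ v ∈ Metric.ball v0 δ,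
    P.Vgood v ∧ ‖P.fv v‖ ≤ C * ‖v - v0‖ ^ 2 := by
  have hg := P.Vgood_of_im (im_ne_of_sq h0)
  obtain ⟨z1, z2⟩ := P.zv_ne hg
  have hz0 : P.zv v0 ^ 2 - 1 ≠ 0 := by
    intro h
    have : (P.zv v0 - 1) * (P.zv v0 + 1) = 0 := by linear_combination h
    rcases mul_eq_zero.1 this with h | h
    · exact z1 (by linear_combination h)
    · exact z2 (by linear_combination h)
  let K : ℂ → ℂ := fun v => (P.s / 2) ^ 2 * (v + v0) ^ 2 / (v ^ 3 * (P.zv v ^ 2 - 1))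
  have hK : ContinuousAt K v0 := by
    have hv := hg.1
    have hzc : ContinuousAt P.zv v0 := by
      unfold zv
      exact continuousAt_const.add (continuousAt_const.mul
        (continuousAt_id.sub (continuousAt_const.div continuousAt_id hv)))
    refine ContinuousAt.div (by fun_prop) (by fun_prop) (mul_ne_zero (pow_ne_zero _ hv) hz0)
  have e1 : ∀ᶠ v in 𝓝 v0, ‖K v‖ < ‖K v0‖ + 1 := by
    exact hK.norm.eventually (gt_mem_nhds (by simp))
  have e2 : ∀ᶠ v in 𝓝 v0, P.Vgood v := P.Vgood_isOpen.mem_nhds hg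
  obtain ⟨δ, hδ, hb⟩ := Metric.eventually_nhds_iff_ball.1 (e1.and e2)
  refine ⟨‖K v0‖ + 1, by positivity, δ, hδ, fun v hv => ⟨(hb v hv).2, ?_⟩⟩
  have hgv := (hb v hv).2
  have z := P.zv_ne hgv
  have hf := P.fv_eq (P.yv_sq hgv.1) z.1 z.2
  rw [P.V_zv hgv.1] at hf
  have hzv : P.zv v ^ 2 - 1 ≠ 0 := by
    intro h
    have : (P.zv v - 1) * (P.zv v + 1) = 0 := by linear_combination h
    rcases mul_eq_zero.1 this with h | h
    · exact z.1 (by linear_combination h)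
    · exact z.2 (by linear_combination h)
  have : P.fv v = K v * (v - v0) ^ 2 := by
    have hne := hgv.1
    have : P.fv v = P.yv v ^ 2 / (v * (P.zv v ^ 2 - 1)) := by
      rw [eq_div_iff (mul_ne_zero hne hzv), hf]
    rw [this]
    have hy : P.yv v = P.s / 2 * ((v + v0) * (v - v0)) / v := by
      unfold yv; field_simp; linear_combination (P.s:ℂ) * h0
    rw [hy]
    simp only [K]
    field_simp
  rw [this, norm_mul, norm_pow]
  exact mul_le_mul_of_nonneg_right (hb v hv).1.le (by positivity)

lemma Hv_bound {v0 : ℂ} (h0 : v0 ^ 2 = -1) : ∃ C > 0, ∃ δ > 0, ∀ v ∈ Metric.ball v0 δ,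
    |P.Hv v| ≤ C * ‖v - v0‖ ^ 3 := by
  obtain ⟨C, hC, δ, hδ, hb⟩ := P.fv_bound h0
  refine ⟨C, hC, δ, hδ, fun v hv => ?_⟩
  have hmem : ∀ t ∈ Icc (0:ℝ) 1, v0 + t * (v - v0) ∈ Metric.ball v0 δ := by
    intro t ht
    rw [Metric.mem_ball, dist_eq_norm] at hv ⊢
    rw [add_sub_cancel_left, norm_mul, Complex.norm_real, Real.norm_of_nonneg ht.1]
    nlinarith [ht.2, norm_nonneg (v - v0)]
  have hd : ∀ t ∈ Icc (0:ℝ) 1, HasDerivWithinAt (fun t : ℝ => P.Hv (v0 + t * (v - v0)))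
      (P.fv (v0 + t * (v - v0)) * (v - v0)).re (Icc 0 1) t := by
    intro t ht
    have h1 : HasDerivAt (fun t : ℝ => v0 + t * (v - v0)) (v - v0) t := by
      simpa using ((ofRealCLM.hasDerivAt (x := t)).mul_const (v - v0)).const_add v0
    exact (P.Hv_hasDerivAt h1 (hb _ (hmem t ht)).1).hasDerivWithinAt
  have := norm_image_sub_le_of_norm_deriv_le_segment_01' (C := C * ‖v - v0‖ ^ 3) hd (by
    intro t ht
    have ht' : t ∈ Icc (0:ℝ) 1 := ⟨ht.1, ht.2.le⟩
    have h2 := (hb _ (hmem t ht')).2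
    rw [add_sub_cancel_left, norm_mul, Complex.norm_real, Real.norm_of_nonneg ht.1] at h2
    calc ‖(P.fv (v0 + t * (v - v0)) * (v - v0)).re‖ ≤ ‖P.fv (v0 + t * (v - v0)) * (v - v0)‖ :=
          Complex.abs_re_le_norm _
      _ = ‖P.fv (v0 + t * (v - v0))‖ * ‖v - v0‖ := norm_mul _ _
      _ ≤ (C * ‖v - v0‖ ^ 2) * ‖v - v0‖ := by
          refine mul_le_mul_of_nonneg_right (h2.trans ?_) (norm_nonneg _)
          refine mul_le_mul_of_nonneg_left ?_ hC.le
          exact pow_le_pow_left₀ (mul_nonneg ht.1 (norm_nonneg _))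
            (mul_le_of_le_one_left (norm_nonneg _) ht.2.le) 2
      _ = _ := by ring)
  simpa [P.Hv_zero h0] using this

lemma sqrt_hasDerivAt {g q : ℝ → ℂ} {q' : ℂ} {t : ℝ} (hq : HasDerivAt q q' t)
    (hg : ContinuousAt g t) (h : ∀ᶠ x in 𝓝 t, g x ^ 2 = q x) (h0 : g t ≠ 0) :
    HasDerivAt g (q' / (2 * g t)) t := by
  rw [hasDerivAt_iff_tendsto_slope] at hq ⊢
  have hs : Tendsto (fun x => g x + g t) (𝓝[≠] t) (𝓝 (2 * g t)) := by
    have h3 : ContinuousAt (fun x => g x + g t) t := by fun_prop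
    have := h3.tendsto.mono_left (nhdsWithin_le_nhds (s := {t}ᶜ))
    rwa [← two_mul] at this
  have h2 : 2 * g t ≠ 0 := mul_ne_zero two_ne_zero h0
  refine (hq.div hs h2).congr' ?_
  have ne : ∀ᶠ x in 𝓝[≠] t, g x + g t ≠ 0 := hs.eventually_ne h2
  filter_upwards [ne, nhdsWithin_le_nhds h] with x hx hx2
  have ht := h.self_of_nhds
  show slope q t x / (g x + g t) = slope g t x
  rw [div_eq_iff hx, slope_def_module, slope_def_module, Complex.real_smul, Complex.real_smul,
    ← hx2, ← ht]
  ring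

lemma H_hasDerivAt {γ g : ℝ → ℂ} {γ' : ℂ} {t : ℝ} (hγ : HasDerivAt γ γ' t)
    (hg : ContinuousAt g t) (h : ∀ᶠ x in 𝓝 t, g x ^ 2 = P.p (γ x))
    (h1 : γ t ≠ 1) (h2 : γ t ≠ -1) :
    HasDerivAt (fun t => P.H (γ t) (g t)) (g t / (γ t ^ 2 - 1) * γ').re t := by
  have ht := h.self_of_nhds
  have hq : HasDerivAt (fun x => P.p (γ x)) (2 * (γ t - P.c) * γ') t := by
    simp only [p_eq]
    refine (((hγ.sub_const (P.c:ℂ)).pow 2).add_const ((P.s:ℂ)^2)).congr_deriv ?_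
    simp
  have hz : γ t ^ 2 - 1 ≠ 0 := by
    intro h
    have : (γ t - 1) * (γ t + 1) = 0 := by linear_combination h
    rcases mul_eq_zero.1 this with h | h
    · exact h1 (by linear_combination h)
    · exact h2 (by linear_combination h)
  by_cases h0 : g t = 0
  · -- branch point
    have hp : P.p (γ t) = 0 := by rw [← ht, h0]; ring
    set v0 := P.V (γ t) (g t) with hv0
    have hv : v0 ^ 2 = -1 := by
      have := P.s_ne
      rw [p_eq] at hp
      rw [hv0, h0]; unfold V; field_simp; linear_combination hp
    obtain ⟨C, hC, δ, hδ, hb⟩ := P.Hv_bound hv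
    rw [h0]
    simp only [zero_div, zero_mul, Complex.zero_re]
    have hx : Tendsto (fun x => P.V (γ x) (g x) - v0) (𝓝 t) (𝓝 0) := by
      have : ContinuousAt (fun x => P.V (γ x) (g x) - v0) t := by
        have := hγ.continuousAt
        unfold V; fun_prop
      have h3 := this.tendsto
      simpa [hv0] using h3
    have o1 : (fun x => P.H (γ x) (g x)) =O[𝓝 t] fun x => (P.V (γ x) (g x) - v0) ^ 3 := by
      apply Asymptotics.IsBigO.of_bound C
      have : ∀ᶠ x in 𝓝 t, P.V (γ x) (g x) ∈ Metric.ball v0 δ := by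
        have := hx.eventually (Metric.ball_mem_nhds 0 hδ)
        filter_upwards [this] with x hx
        simpa [dist_eq_norm] using hx
      filter_upwards [this] with x hx
      simpa [H] using hb _ hx
    have o2 : (fun x => (P.V (γ x) (g x) - v0) ^ 2) =O[𝓝 t] fun x => x - t := by
      have a1 : (fun x => γ x - γ t) =O[𝓝 t] fun x => x - t := hγ.isBigO_sub
      have a2 : (fun x => g x ^ 2) =O[𝓝 t] fun x => x - t := by
        refine (hq.isBigO_sub).congr' ?_ EventuallyEq.rfl
        filter_upwards [h] with x hx
        simp only [hp, hx]; ring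
      have a0 : (fun x => γ x - γ t) =O[𝓝 t] fun x => (1:ℝ) := by
        have h3 : Tendsto (fun x => γ x - γ t) (𝓝 t) (𝓝 (γ t - γ t)) :=
          (hγ.continuousAt.sub continuousAt_const).tendsto
        exact h3.isBigO_one ℝ
      have a00 : (fun x => g x) =O[𝓝 t] fun x => (1:ℝ) := by
        exact hg.tendsto.isBigO_one ℝ
      have a3 : (fun x => (γ x - γ t) * ((γ x - γ t) + 2 * g x)) =O[𝓝 t] fun x => (x - t) * 1 :=
        a1.mul (a0.add (a00.const_mul_left 2))
      have a4 := ((a3.congr_right (fun x => mul_one _)).add a2).const_mul_left ((1 / P.s ^ 2 : ℂ))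
      refine a4.congr_left fun x => ?_
      have := P.s_ne
      rw [hv0]; unfold V; rw [h0]; field_simp; ring
    have o3 : (fun x => P.V (γ x) (g x) - v0) =o[𝓝 t] fun x => (1:ℝ) :=
      (Asymptotics.isLittleO_one_iff ℝ).2 hx
    have o4 := o1.trans_isLittleO (((o2.mul_isLittleO o3).congr_left
      (fun x => by ring)).congr_right (fun x => mul_one _))
    rw [hasDerivAt_iff_isLittleO]
    refine o4.congr_left fun x => ?_
    have : P.H (γ t) (g t) = 0 := P.Hv_zero hv
    simp [this]
  · have dg := sqrt_hasDerivAt hq hg h h0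
    have dV : HasDerivAt (fun x => P.V (γ x) (g x)) (P.V (γ t) (g t) * γ' / g t) t := by
      unfold V
      refine (((hγ.sub_const (P.c:ℂ)).add dg).div_const (P.s:ℂ)).congr_deriv ?_
      have := P.s_ne
      field_simp
      ring
    refine (P.Hv_hasDerivAt dV (P.V_good ht h1 h2)).congr_deriv ?_
    congr 1
    have := P.fv_eq ht h1 h2
    field_simp
    linear_combination γ' * this

lemma path_H {γ g : ℝ → ℂ} (hγ : ContDiff ℝ 1 γ)
    (hne : ∀ t ∈ Set.Icc (0 : ℝ) 1, γ t ≠ 1 ∧ γ t ≠ -1)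
    (hg : ContinuousOn g (Set.Icc 0 1))
    (hsq : ∀ t ∈ Set.Icc (0 : ℝ) 1, g t ^ 2 = P.p (γ t)) :
    (∫ t in (0:ℝ)..1, g t / ((γ t) ^ 2 - 1) * deriv γ t).re =
      P.H (γ 1) (g 1) - P.H (γ 0) (g 0) := by
  have hcd : Continuous (deriv γ) := hγ.continuous_deriv le_rfl
  have hz : ∀ t ∈ Set.Icc (0 : ℝ) 1, γ t ^ 2 - 1 ≠ 0 := by
    intro t ht h
    have : (γ t - 1) * (γ t + 1) = 0 := by linear_combination h
    rcases mul_eq_zero.1 this with h | h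
    · exact (hne t ht).1 (by linear_combination h)
    · exact (hne t ht).2 (by linear_combination h)
  have hci : ContinuousOn (fun t => g t / ((γ t) ^ 2 - 1) * deriv γ t) (Icc 0 1) :=
    (hg.div (((hγ.continuous.pow 2).sub continuous_const).continuousOn) hz).mul hcd.continuousOn
  have hI : IntervalIntegrable (fun t => g t / ((γ t) ^ 2 - 1) * deriv γ t)
      MeasureTheory.volume 0 1 := by
    apply ContinuousOn.intervalIntegrable; rwa [uIcc_of_le zero_le_one]
  have e : (∫ t in (0:ℝ)..1, g t / ((γ t) ^ 2 - 1) * deriv γ t).re =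
      ∫ t in (0:ℝ)..1, (g t / ((γ t) ^ 2 - 1) * deriv γ t).re :=
    (Complex.reCLM.intervalIntegral_comp_comm hI).symm
  rw [e]
  refine intervalIntegral.integral_eq_sub_of_hasDerivAt_of_le zero_le_one
    (f := fun t => P.H (γ t) (g t)) ?_ ?_ ?_
  · intro t ht
    have := P.H_continuousAt (hsq t ht) (hne t ht).1 (hne t ht).2
    exact ContinuousAt.comp_continuousWithinAt (f := fun t => (γ t, g t)) this
      (hγ.continuous.continuousWithinAt.prodMk (hg t ht))
  · intro t ht
    have ht' := Ioo_subset_Icc_self ht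
    have hn : Icc (0:ℝ) 1 ∈ 𝓝 t := Icc_mem_nhds ht.1 ht.2
    exact P.H_hasDerivAt (hγ.differentiable one_ne_zero t).hasDerivAt
      ((hg t ht').continuousAt hn) (by filter_upwards [hn] with x hx using hsq x hx)
      (hne t ht').1 (hne t ht').2
  · apply ContinuousOn.intervalIntegrable; rw [uIcc_of_le zero_le_one]
    exact Complex.continuous_re.comp_continuousOn hci

end SzPar

namespace SzPar
variable (P : SzPar)

def Gam : Set ℂ :=
  {z | ∃ γ g : ℝ → ℂ, ContDiff ℝ 1 γ ∧ γ 0 = P.zm ∧ γ 1 = z ∧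
    (∀ t ∈ Set.Icc (0 : ℝ) 1, γ t ≠ 1 ∧ γ t ≠ -1) ∧
    ContinuousOn g (Set.Icc 0 1) ∧
    (∀ t ∈ Set.Icc (0 : ℝ) 1, g t ^ 2 = (γ t - P.zp) * (γ t - P.zm)) ∧
    (∫ t in (0:ℝ)..1, g t / ((γ t) ^ 2 - 1) * deriv γ t).re = 0}

lemma p_zm : P.p P.zm = 0 := by simp [p]
lemma p_zp : P.p P.zp = 0 := by simp [p]

lemma V_zm_sq : P.V P.zm 0 = -I := by
  have := P.s_ne
  unfold V zm; field_simp; ring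

lemma H_of_sq_zero {z : ℂ} (h : P.p z = 0) : P.H z 0 = 0 := by
  refine P.Hv_zero ?_
  have := P.s_ne
  rw [p_eq] at h
  unfold V; field_simp; linear_combination h

lemma exists_sqrt (w : ℂ) : ∃ y : ℂ, y ^ 2 = w := IsAlgClosed.exists_pow_nat_eq w two_pos

lemma zv_I : P.zv (-I) = P.zm := by
  have h : P.V P.zm 0 = -I := P.V_zm_sq
  rw [← h]; exact P.zv_V (by simp [p_zm])

lemma real_good {x : ℝ} (h1 : P.v1 < x) (h2 : P.v2 < x) : P.Vgood (x : ℂ) := by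
  have a1 := P.v1_pos
  have a2 := P.v2_pos
  have hx : 0 < x := by linarith
  have p1 := mul_pos a1 hx
  have p2 := mul_pos a2 hx
  refine ⟨?_, ?_, ?_, ?_, ?_⟩ <;> norm_cast <;> nlinarith

lemma exists_vpath {v : ℂ} (hv : P.Vgood v) : ∃ q : ℝ → ℂ, ContDiff ℝ 1 q ∧ q 0 = -I ∧ q 1 = v ∧
    ∀ t ∈ Icc (0:ℝ) 1, P.Vgood (q t) := by
  by_cases him : v.im ≤ 0
  · refine ⟨fun t => -I + t * (v + I), ?_, by simp, by simp, ?_⟩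
    · exact contDiff_const.add ((Complex.ofRealCLM.contDiff).mul contDiff_const)
    · intro t ht
      rcases eq_or_lt_of_le ht.2 with h | h
      · subst h; simpa using hv
      · apply P.Vgood_of_im
        simp
        nlinarith [ht.1]
  · push Not at him
    set τ : ℝ := 1 / (v.im + 1) with hτ
    have hτ0 : 0 < τ := by positivity
    have hτ1 : τ < 1 := by rw [hτ, div_lt_one (by linarith)]; linarith
    set x : ℝ := P.v1 + P.v2 + 1 with hx
    have a1 := P.v1_pos
    have a2 := P.v2_pos
    set lam : ℝ := (x - τ * v.re) / (τ * (1 - τ)) with hlam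
    have e0 : τ * (1 - τ) ≠ 0 := (mul_pos hτ0 (by linarith)).ne'
    refine ⟨fun t => -I + t * (v + I) + lam * (t * (1 - t)), ?_, by simp, by simp, ?_⟩
    · have : ContDiff ℝ 1 (fun t : ℝ => (t:ℂ)) := Complex.ofRealCLM.contDiff
      fun_prop
    · intro t ht
      by_cases h : t = τ
      · have : (-I + t * (v + I) + lam * (t * (1 - t)) : ℂ) = (x : ℂ) := by
          apply Complex.ext
          · simp [h, hlam, -Complex.ofReal_div]
            norm_cast
            have e1 : 1 - τ ≠ 0 := by linarith
            field_simp
            ring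
          · simp [h]
            norm_cast
            simp
            rw [hτ]; field_simp; ring
        simp only
        rw [this]; exact P.real_good (by linarith) (by linarith)
      · apply P.Vgood_of_im
        intro h0
        apply h
        have : -1 + t * (v.im + 1) = 0 := by
          have e : (lam * (t * (1 - t)) : ℂ) = ((lam * (t * (1 - t)) : ℝ) : ℂ) := by push_cast; ring
          simp only [e] at h0
          simpa using h0
        rw [hτ, eq_div_iff (by linarith)]; linarith

lemma mem_Gam_of {z y : ℂ} (hy : y ^ 2 = P.p z) (h1 : z ≠ 1) (h2 : z ≠ -1) (h : P.H z y = 0) :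
    z ∈ P.Gam := by
  obtain ⟨q, hq, q0, q1, hgd⟩ := P.exists_vpath (P.V_good hy h1 h2)
  have hT : ∀ t : ℝ, P.Vgood (q (Real.smoothTransition t)) := fun t =>
    hgd _ ⟨Real.smoothTransition.nonneg t, Real.smoothTransition.le_one t⟩
  have hqT : ContDiff ℝ 1 (fun t => q (Real.smoothTransition t)) :=
    hq.comp Real.smoothTransition.contDiff
  have hne : ∀ t : ℝ, q (Real.smoothTransition t) ≠ 0 := fun t => (hT t).1
  have hγ : ContDiff ℝ 1 (fun t => P.zv (q (Real.smoothTransition t))) := by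
    unfold zv
    simp only [one_div]
    exact contDiff_const.add (contDiff_const.mul (hqT.sub (hqT.inv hne)))
  have hg : Continuous (fun t => P.yv (q (Real.smoothTransition t))) := by
    unfold yv
    exact continuous_const.mul (hqT.continuous.add (continuous_const.div hqT.continuous hne))
  refine ⟨_, fun t => P.yv (q (Real.smoothTransition t)), hγ, ?_, ?_, ?_, hg.continuousOn, ?_, ?_⟩
  · simp [q0, zv_I]
  · simp [q1, P.zv_V hy]
  · intro t _; exact P.zv_ne (hT t)
  · intro t _; exact P.yv_sq (hne t)
  · rw [P.path_H hγ (fun t _ => P.zv_ne (hT t)) hg.continuousOn (fun t _ => P.yv_sq (hne t))]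
    simp only [Real.smoothTransition.one, Real.smoothTransition.zero, q1, q0, P.zv_V hy, P.yv_V hy, h]
    have : P.yv (-I) = 0 := by unfold yv; simp
    rw [this, zv_I, P.H_of_sq_zero P.p_zm]; simp

lemma Gam_H {z : ℂ} (hz : z ∈ P.Gam) : z ≠ 1 ∧ z ≠ -1 ∧ ∀ y, y ^ 2 = P.p z → P.H z y = 0 := by
  obtain ⟨γ, g, hγ, h0, h1, hne, hg, hsq, hI⟩ := hz
  have n1 := hne 1 (by simp)
  rw [h1] at n1
  rw [P.path_H hγ hne hg hsq] at hI
  have g0 : g 0 = 0 := by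
    have := hsq 0 (by simp)
    rw [h0] at this; simpa using this
  have s1 : g 1 ^ 2 = P.p z := by have := hsq 1 (by simp); rwa [h1] at this
  rw [h0, h1, g0, P.H_of_sq_zero P.p_zm, sub_zero] at hI
  refine ⟨n1.1, n1.2, fun y hy => ?_⟩
  rw [← s1] at hy
  rcases sq_eq_sq_iff_eq_or_eq_neg.1 hy with h | h
  · rw [h, hI]
  · rw [h, P.H_neg s1 n1.1 n1.2, hI, neg_zero]

lemma mem_Gam_iff {z y : ℂ} (hy : y ^ 2 = P.p z) (h1 : z ≠ 1) (h2 : z ≠ -1) :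
    z ∈ P.Gam ↔ P.H z y = 0 :=
  ⟨fun h => (P.Gam_H h).2.2 y hy, P.mem_Gam_of hy h1 h2⟩

lemma Gam_conj {z : ℂ} (hz : z ∈ P.Gam) : (starRingEnd ℂ) z ∈ P.Gam := by
  obtain ⟨y, hy⟩ := exists_sqrt (P.p z)
  obtain ⟨h1, h2, h3⟩ := P.Gam_H hz
  refine P.mem_Gam_of (y := (starRingEnd ℂ) y) ?_ ?_ ?_ ?_
  · rw [← map_pow, hy, p_conj]
  · intro h; apply h1; have := congrArg (starRingEnd ℂ) h; simpa using this
  · intro h; apply h2; have := congrArg (starRingEnd ℂ) h; simpa using this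
  · rw [H_conj]; exact h3 y hy

end SzPar

namespace SzPar
variable (P : SzPar)

structure IsArc (γ : ℝ → ℂ) : Prop where
  smooth : ContDiff ℝ 1 γ
  inj : Set.InjOn γ (Set.Icc 0 1)
  reg : ∀ t ∈ Set.Icc (0:ℝ) 1, deriv γ t ≠ 0
  e0 : γ 0 = P.zp
  e1 : γ 1 = P.zm
  sub : ∀ t ∈ Set.Icc (0:ℝ) 1, γ t ∈ P.Gam

/-- absolute value of `H`, independent of the sheet -/
def csq (w : ℂ) : ℂ := Classical.choose (exists_sqrt w)
lemma csq_sq (w : ℂ) : csq w ^ 2 = w := Classical.choose_spec (exists_sqrt w)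
def F (z : ℂ) : ℝ := |P.H z (csq (P.p z))|

lemma F_eq {z y : ℂ} (hy : y ^ 2 = P.p z) (h1 : z ≠ 1) (h2 : z ≠ -1) : P.F z = |P.H z y| := by
  have h' := (csq_sq (P.p z)).trans hy.symm
  unfold F
  rcases sq_eq_sq_iff_eq_or_eq_neg.1 h' with e | e
  · rw [e]
  · rw [e, P.H_neg hy h1 h2, abs_neg]

lemma p_continuous : Continuous P.p := by unfold p; fun_prop

lemma F_continuousAt {z0 : ℂ} (h1 : z0 ≠ 1) (h2 : z0 ≠ -1) : ContinuousAt P.F z0 := by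
  obtain ⟨y0, hy0⟩ := exists_sqrt (P.p z0)
  have hex : ∀ z, ∃ y, y ^ 2 = P.p z ∧ ‖y - y0‖ ^ 2 ≤ ‖P.p z - P.p z0‖ := by
    intro z
    obtain ⟨y, hy⟩ := exists_sqrt (P.p z)
    have e : ‖P.p z - P.p z0‖ = ‖y - y0‖ * ‖y + y0‖ := by
      rw [← norm_mul, ← hy, ← hy0]; ring_nf
    rcases le_total ‖y - y0‖ ‖y + y0‖ with h | h
    · exact ⟨y, hy, by rw [e, sq]; gcongr⟩
    · refine ⟨-y, by rw [neg_sq, hy], ?_⟩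
      have : ‖-y - y0‖ = ‖y + y0‖ := by rw [← norm_neg]; ring_nf
      rw [e, this, sq]; gcongr
  choose y hy hb using hex
  have hyt : Tendsto y (𝓝 z0) (𝓝 y0) := by
    rw [tendsto_iff_norm_sub_tendsto_zero]
    have h3 : Tendsto (fun z => ‖P.p z - P.p z0‖) (𝓝 z0) (𝓝 0) :=
      tendsto_iff_norm_sub_tendsto_zero.1 P.p_continuous.continuousAt
    have h4 := squeeze_zero (fun z => by positivity) hb h3
    have h5 := h4.sqrt
    simpa using h5
  have hH := P.H_continuousAt hy0 h1 h2
  have h3 : Tendsto (fun z => (z, y z)) (𝓝 z0) (𝓝 (z0, y0)) := tendsto_id.prodMk_nhds hyt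
  have h4 : Tendsto (fun z => |P.H z (y z)|) (𝓝 z0) (𝓝 |P.H z0 y0|) := (hH.tendsto.comp h3).abs
  rw [ContinuousAt, P.F_eq hy0 h1 h2]
  refine h4.congr' ?_
  filter_upwards [isOpen_ne.mem_nhds h1, isOpen_ne.mem_nhds h2] with z a b
  exact (P.F_eq (hy z) a b).symm

lemma mem_Gam_iff_F {z : ℂ} (h1 : z ≠ 1) (h2 : z ≠ -1) : z ∈ P.Gam ↔ P.F z = 0 := by
  obtain ⟨y, hy⟩ := exists_sqrt (P.p z)
  rw [P.mem_Gam_iff hy h1 h2, P.F_eq hy h1 h2, abs_eq_zero]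

lemma v1_ne_v2 : (P.v1 : ℂ) - P.v2 ≠ 0 := by
  have hy : (2 * P.a : ℂ) ^ 2 = P.p 1 := by rw [P.p_eq]; exact P.h1c.symm
  have e := P.V2_mul hy
  have hv := P.V_ne hy
  have hV : P.V 1 (2 * P.a) = P.v1 := by
    have := P.s_ne
    unfold V; rw [div_eq_iff this, P.v1_eq]
  rw [hV] at e hv
  intro h
  rw [h] at e
  have : (2:ℂ) * P.v2 * P.v1 * (1 + 1) ≠ 0 := by
    have := P.v2c_ne
    norm_num
    exact ⟨by exact_mod_cast this, by exact_mod_cast hv⟩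
  apply this
  rw [← e]; ring

lemma v12_ne : (P.v2 : ℂ) * P.v1 + 1 ≠ 0 := by
  have := mul_pos P.v2_pos P.v1_pos
  norm_cast; linarith

lemma log_cont {f : ℂ → ℂ} {v0 : ℂ} (hf : ContinuousAt f v0) (h0 : f v0 ≠ 0) :
    Tendsto (fun v => Real.log ‖f v‖) (𝓝[≠] v0) (𝓝 (Real.log ‖f v0‖)) :=
  ((hf.norm).log (norm_ne_zero_iff.2 h0)).tendsto.mono_left nhdsWithin_le_nhds

lemma log_atBot {f : ℂ → ℂ} {v0 : ℂ} (hf : ContinuousAt f v0) (h0 : f v0 = 0)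
    (hne : ∀ v, v ≠ v0 → f v ≠ 0) :
    Tendsto (fun v => Real.log ‖f v‖) (𝓝[≠] v0) atBot := by
  refine Real.tendsto_log_nhdsGT_zero.comp (tendsto_nhdsWithin_iff.2 ⟨?_, ?_⟩)
  · have := hf.norm.tendsto.mono_left (nhdsWithin_le_nhds (s := {v0}ᶜ))
    simpa [h0] using this
  · filter_upwards [self_mem_nhdsWithin] with v hv
    exact norm_pos_iff.2 (hne v hv)

lemma Hv_tendsto_v1 : Tendsto P.Hv (𝓝[≠] (P.v1:ℂ)) atBot := by
  have t1 := log_cont (f := fun v => v) (v0 := P.v1) (by fun_prop) P.v1c_ne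
  have t2 := log_atBot (f := fun v => v - P.v1) (v0 := P.v1) (by fun_prop) (by simp)
    (fun v hv => sub_ne_zero.2 hv)
  have t3 := log_cont (f := fun v => P.v1 * v + 1) (v0 := P.v1) (by fun_prop)
    (by have := mul_pos P.v1_pos P.v1_pos; norm_cast; linarith)
  have t4 := log_cont (f := fun v => v - P.v2) (v0 := P.v1) (by fun_prop) P.v1_ne_v2
  have t5 := log_cont (f := fun v => P.v2 * v + 1) (v0 := P.v1) (by fun_prop) P.v12_ne
  have := (t2.const_mul_atBot P.ha).atBot_add
    ((t1.sub (t3.const_mul P.a)).sub ((t4.sub t5).const_mul P.b))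
  refine this.congr fun v => ?_
  unfold Hv; ring

lemma Hv_tendsto_v2 : Tendsto P.Hv (𝓝[≠] (-1 / P.v2:ℂ)) atBot := by
  have h2 := P.v2c_ne
  have e0 : (-1 / P.v2 : ℂ) = ((-1 / P.v2 : ℝ) : ℂ) := by push_cast; ring
  have hneg : (-1 / P.v2 : ℝ) < 0 := div_neg_of_neg_of_pos (by norm_num) P.v2_pos
  have n1 : ((-1 / P.v2 : ℝ) : ℂ) - P.v1 ≠ 0 := by
    have := P.v1_pos
    rw [← Complex.ofReal_sub, Complex.ofReal_ne_zero]; linarith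
  have n2 : ((-1 / P.v2 : ℝ) : ℂ) - P.v2 ≠ 0 := by
    have := P.v2_pos
    rw [← Complex.ofReal_sub, Complex.ofReal_ne_zero]; linarith
  rw [← e0] at n1 n2
  have t1 := log_cont (f := fun v => v) (v0 := -1 / P.v2) (by fun_prop)
    (by rw [e0, Complex.ofReal_ne_zero]; exact hneg.ne)
  have t2 := log_cont (f := fun v => v - P.v1) (v0 := -1 / P.v2) (by fun_prop) n1
  have t3 := log_cont (f := fun v => P.v1 * v + 1) (v0 := -1 / P.v2) (by fun_prop)
    (by
      intro h
      apply P.v1_ne_v2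
      field_simp at h
      linear_combination -h)
  have t4 := log_cont (f := fun v => v - P.v2) (v0 := -1 / P.v2) (by fun_prop) n2
  have t5 := log_atBot (f := fun v => P.v2 * v + 1) (v0 := -1 / P.v2) (by fun_prop)
    (by field_simp; ring)
    (by
      intro v hv h
      apply hv
      rw [eq_div_iff h2]; linear_combination h)
  have := (t5.const_mul_atBot P.hb).atBot_add
    ((t1.add ((t2.sub t3).const_mul P.a)).sub (t4.const_mul P.b))
  refine this.congr fun v => ?_
  unfold Hv; ring

lemma log_ratio (α β : ℂ) (hα : α ≠ 0) (x : ℂ) :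
    ∃ L : ℝ, Tendsto (fun v : ℂ => Real.log ‖v - x‖ - Real.log ‖α * v + β‖) (cobounded ℂ) (𝓝 L) := by
  refine ⟨Real.log ‖(1 - x * 0) / (α + β * 0)‖, ?_⟩
  have hi : Tendsto (fun v : ℂ => v⁻¹) (cobounded ℂ) (𝓝 0) := tendsto_inv₀_cobounded
  have h1 : Tendsto (fun v : ℂ => (1 - x * v⁻¹) / (α + β * v⁻¹)) (cobounded ℂ)
      (𝓝 ((1 - x * 0) / (α + β * 0))) :=
    (tendsto_const_nhds.sub (hi.const_mul x)).div (tendsto_const_nhds.add (hi.const_mul β))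
      (by simpa using hα)
  have h2 := h1.norm.log (by simpa using hα)
  refine h2.congr' ?_
  have ev : ∀ᶠ v : ℂ in cobounded ℂ, v ≠ 0 := by
    filter_upwards [tendsto_norm_cobounded_atTop.eventually_gt_atTop 0] with v hv
    exact norm_pos_iff.1 hv
  have ev2 : ∀ᶠ v : ℂ in cobounded ℂ, v - x ≠ 0 := by
    filter_upwards [tendsto_norm_cobounded_atTop.eventually_gt_atTop ‖x‖] with v hv h
    rw [sub_eq_zero] at h; rw [h] at hv; exact lt_irrefl _ hv
  have ev3 : ∀ᶠ v : ℂ in cobounded ℂ, α * v + β ≠ 0 := by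
    filter_upwards [tendsto_norm_cobounded_atTop.eventually_gt_atTop ‖-β / α‖] with v hv h
    have : v = -β / α := by rw [eq_div_iff hα]; linear_combination h
    rw [this] at hv; exact lt_irrefl _ hv
  filter_upwards [ev, ev2, ev3] with v h0 hx hab
  have e : (1 - x * v⁻¹) / (α + β * v⁻¹) = (v - x) / (α * v + β) := by
    rw [div_eq_div_iff _ hab]
    · field_simp
    · intro h; apply hab
      have : α * v + β = (α + β * v⁻¹) * v := by field_simp
      rw [this, h, zero_mul]
  rw [e, norm_div, Real.log_div (norm_ne_zero_iff.2 hx) (norm_ne_zero_iff.2 hab)]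

lemma Hv_tendsto_inf : Tendsto P.Hv (cobounded ℂ) atTop := by
  obtain ⟨L1, h1⟩ := log_ratio P.v1 1 P.v1c_ne P.v1
  obtain ⟨L2, h2⟩ := log_ratio P.v2 1 P.v2c_ne P.v2
  have h0 : Tendsto (fun v : ℂ => Real.log ‖v‖) (cobounded ℂ) atTop :=
    Real.tendsto_log_atTop.comp tendsto_norm_cobounded_atTop
  have := h0.atTop_add ((h1.const_mul P.a).sub (h2.const_mul P.b))
  refine this.congr fun v => ?_
  unfold Hv; ring

end SzPar

/-- arcs together with the branch of the square root -/
structure SzDat extends SzPar where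
  gL : ℝ → ℂ
  gC : ℝ → ℂ
  gR : ℝ → ℂ
  aL : toSzPar.IsArc gL
  aC : toSzPar.IsArc gC
  aR : toSzPar.IsArc gR
  union : gL '' Icc 0 1 ∪ gC '' Icc 0 1 ∪ gR '' Icc 0 1 = toSzPar.Gam
  crossL : ∀ t ∈ Set.Icc (0:ℝ) 1, (gL t).im = 0 → (gL t).re < -1
  crossC : ∀ t ∈ Set.Icc (0:ℝ) 1, (gC t).im = 0 → -1 < (gC t).re ∧ (gC t).re < 1
  crossR : ∀ t ∈ Set.Icc (0:ℝ) 1, (gR t).im = 0 → 1 < (gR t).re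
  R : ℂ → ℂ
  Rd : DifferentiableOn ℂ R (gC '' Set.Icc 0 1)ᶜ
  Rsq : ∀ z ∉ gC '' Set.Icc 0 1, R z ^ 2 = toSzPar.p z
  Rinf : Filter.Tendsto (fun z => R z / z) (Bornology.cobounded ℂ) (nhds 1)

namespace SzDat
variable (Q : SzDat)

def GC : Set ℂ := Q.gC '' Icc 0 1

lemma GC_sub : Q.GC ⊆ Q.Gam := by
  rintro _ ⟨t, ht, rfl⟩; exact Q.aC.sub t ht

lemma GC_closed : IsClosed Q.GC :=
  (isCompact_Icc.image Q.aC.smooth.continuous).isClosed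

lemma Gam_compact : IsCompact Q.Gam := by
  rw [← Q.union]
  exact ((isCompact_Icc.image Q.aL.smooth.continuous).union
    (isCompact_Icc.image Q.aC.smooth.continuous)).union
    (isCompact_Icc.image Q.aR.smooth.continuous)

lemma Gam_closed : IsClosed Q.Gam := Q.Gam_compact.isClosed

lemma Rdz {z : ℂ} (hz : z ∉ Q.GC) : DifferentiableAt ℂ Q.R z :=
  Q.Rd.differentiableAt (Q.GC_closed.isOpen_compl.mem_nhds hz)

lemma one_notMem : (1:ℂ) ∉ Q.Gam := fun h => (Q.Gam_H h).1 rfl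
lemma neg_one_notMem : (-1:ℂ) ∉ Q.Gam := fun h => (Q.Gam_H h).2.1 rfl

lemma p_eq_zero {z : ℂ} (h : Q.p z = 0) : z = Q.zp ∨ z = Q.zm := by
  unfold SzPar.p at h
  rcases mul_eq_zero.1 h with h | h
  · exact Or.inl (sub_eq_zero.1 h)
  · exact Or.inr (sub_eq_zero.1 h)

lemma zp_mem : Q.zp ∈ Q.GC := ⟨0, by simp, Q.aC.e0⟩
lemma zm_mem : Q.zm ∈ Q.GC := ⟨1, by simp, Q.aC.e1⟩

lemma R_ne {z : ℂ} (hz : z ∉ Q.GC) : Q.R z ≠ 0 := by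
  intro h
  have := Q.Rsq z hz
  rw [h] at this
  rcases Q.p_eq_zero (z := z) (by rw [← this]; ring) with e | e
  · exact hz (e ▸ Q.zp_mem)
  · exact hz (e ▸ Q.zm_mem)

def h (z : ℂ) : ℝ := Q.H z (Q.R z)

lemma h_continuousAt {z : ℂ} (hz : z ∉ Q.GC) (h1 : z ≠ 1) (h2 : z ≠ -1) : ContinuousAt Q.h z := by
  have := Q.H_continuousAt (Q.Rsq z hz) h1 h2
  exact ContinuousAt.comp (f := fun z => (z, Q.R z)) this
    (continuousAt_id.prodMk (Q.Rdz hz).continuousAt)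

lemma h_ne {z : ℂ} (hz : z ∉ Q.Gam) (h1 : z ≠ 1) (h2 : z ≠ -1) : Q.h z ≠ 0 := by
  intro h
  exact hz (Q.mem_Gam_of (Q.Rsq z (fun h => hz (Q.GC_sub h))) h1 h2 h)

lemma R_real {x : ℝ} (hx : (x:ℂ) ∉ Q.GC) : (Q.R x).im = 0 ∧ (Q.R x).re ≠ 0 ∧
    (Q.R x).re ^ 2 = (x - Q.c) ^ 2 + Q.s ^ 2 := by
  have h := Q.Rsq x hx
  rw [Q.p_eq] at h
  have e1 := congrArg Complex.re h
  have e2 := congrArg Complex.im h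
  have hs := Q.hs
  have e3 : ((x:ℂ) - Q.c) ^ 2 + (Q.s:ℂ) ^ 2 = (((x - Q.c) ^ 2 + Q.s ^ 2 : ℝ) : ℂ) := by push_cast; ring
  rw [e3] at e1 e2
  simp only [sq, Complex.mul_re, Complex.mul_im, Complex.ofReal_re, Complex.ofReal_im] at e1 e2
  have hpos : 0 < Q.s * Q.s := mul_pos hs hs
  have i0 : (Q.R x).im = 0 := by
    by_contra hne
    have : (Q.R x).re = 0 := by
      have : (Q.R x).re * (Q.R x).im = 0 := by linarith
      rcases mul_eq_zero.1 this with h | h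
      · exact h
      · exact absurd h hne
    rw [this] at e1
    nlinarith [mul_self_nonneg (Q.R x).im, mul_self_nonneg (x - Q.c)]
  refine ⟨i0, ?_, ?_⟩
  · intro h0; rw [i0, h0] at e1
    nlinarith [mul_self_nonneg (x - Q.c)]
  · rw [i0] at e1; nlinarith

/-- sign of `R` is constant on real intervals -/
lemma R_sign {S : Set ℝ} (hS : IsPreconnected S) (hav : ∀ x ∈ S, (x:ℂ) ∉ Q.GC) {x y : ℝ}
    (hx : x ∈ S) (hy : y ∈ S) (h : 0 < (Q.R x).re) : 0 < (Q.R y).re := by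
  by_contra hn
  push Not at hn
  have hc : ContinuousOn (fun x : ℝ => (Q.R x).re) S := by
    intro u hu
    have h1 : ContinuousAt Q.R (u:ℂ) := (Q.Rdz (hav u hu)).continuousAt
    have h2 : ContinuousAt (fun x : ℝ => Q.R x) u :=
      ContinuousAt.comp (f := fun x : ℝ => (x:ℂ)) h1 Complex.continuous_ofReal.continuousAt
    exact (Complex.continuous_re.continuousAt.comp h2).continuousWithinAt
  obtain ⟨u, hu, h0⟩ := hS.intermediate_value hy hx hc ⟨hn, h.le⟩
  exact (Q.R_real (hav u hu)).2.1 h0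

lemma GC_real {x : ℝ} (hx : (x:ℂ) ∈ Q.GC) : -1 < x ∧ x < 1 := by
  obtain ⟨t, ht, e⟩ := hx
  have := Q.crossC t ht (by rw [e]; simp)
  rwa [e] at this

lemma R_inf_bound : ∃ M > 1, ∀ z : ℂ, M ≤ ‖z‖ → ‖Q.R z / z - 1‖ < 1 / 2 := by
  have h : ∀ᶠ z in cobounded ℂ, ‖Q.R z / z - 1‖ < 1 / 2 := by
    have := Q.Rinf.eventually (Metric.ball_mem_nhds 1 (show (0:ℝ) < 1/2 by norm_num))
    filter_upwards [this] with z hz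
    simpa [dist_eq_norm] using hz
  obtain ⟨M, hM⟩ := ((atTop_basis (α := ℝ)).cobounded_of_norm.eventually_iff).1 h
  refine ⟨max M 2, by simp, fun z hz => hM.2 ?_⟩
  simpa using (le_max_left M 2).trans hz

lemma R_pos {x : ℝ} (hx : 1 ≤ x) : 0 < (Q.R x).re := by
  obtain ⟨M, hM, hb⟩ := Q.R_inf_bound
  have hM0 : 0 < M := by linarith
  have h1 := hb M (by simp [abs_of_pos hM0])
  have hMC : (M:ℂ) ∉ Q.GC := fun h => by have := (Q.GC_real h).2; linarith
  have h2 := (Complex.abs_re_le_norm _).trans_lt h1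
  have e : (Q.R M / M - 1).re = (Q.R M).re / M - 1 := by
    rw [Complex.sub_re, Complex.div_ofReal_re]; simp
  rw [e, abs_lt] at h2
  have h3 : 0 < (Q.R M).re / M := by linarith [h2.1]
  have h4 : 0 < (Q.R M).re := by
    have := mul_pos h3 hM0
    rwa [div_mul_cancel₀ _ hM0.ne'] at this
  exact Q.R_sign (S := Ici 1) isPreconnected_Ici
    (fun x hx h => by have := (Q.GC_real h).2; exact absurd hx (not_le.2 this)) (mem_Ici.2 hM.le) hx h4

lemma R_neg {x : ℝ} (hx : x ≤ -1) : (Q.R x).re < 0 := by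
  obtain ⟨M, hM, hb⟩ := Q.R_inf_bound
  have hM0 : 0 < M := by linarith
  have h1 := hb ((-M : ℝ) : ℂ) (by simp [abs_of_pos hM0])
  have h2 := (Complex.abs_re_le_norm _).trans_lt h1
  have e : (Q.R ((-M : ℝ) : ℂ) / ((-M : ℝ) : ℂ) - 1).re = (Q.R ((-M : ℝ) : ℂ)).re / (-M) - 1 := by
    rw [Complex.sub_re, Complex.div_ofReal_re]; simp
  rw [e, abs_lt] at h2
  have h3 : 0 < (Q.R ((-M : ℝ) : ℂ)).re / (-M) := by linarith [h2.1]
  have h4 : (Q.R ((-M : ℝ) : ℂ)).re < 0 := by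
    have := mul_pos h3 hM0
    have e : (Q.R ((-M : ℝ) : ℂ)).re / (-M) * M = - (Q.R ((-M : ℝ) : ℂ)).re := by field_simp
    linarith
  have hav : ∀ x ∈ Iic (-1:ℝ), (x:ℂ) ∉ Q.GC :=
    fun x hx h => by have := (Q.GC_real h).1; exact absurd hx (not_le.2 this)
  by_contra hn
  push Not at hn
  have hn' := lt_of_le_of_ne hn (Q.R_real (hav x hx)).2.1.symm
  have := Q.R_sign (S := Iic (-1)) isPreconnected_Iic hav hx (y := -M)
    (by simp only [mem_Iic]; linarith) hn'
  linarith

lemma R_one : Q.R 1 = 2 * Q.a := by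
  have h0 := Q.R_pos le_rfl
  have hC : ((1:ℝ):ℂ) ∉ Q.GC := fun h => by have := (Q.GC_real h).2; linarith
  obtain ⟨h1, h2, h3⟩ := Q.R_real hC
  rw [Q.h1] at h3
  have ha := Q.ha
  have : (Q.R ((1:ℝ):ℂ)).re = 2 * Q.a :=
    (sq_eq_sq₀ h0.le (by positivity)).1 h3
  rw [Complex.ofReal_one] at *
  apply Complex.ext <;> simp [this, h1]

lemma R_neg_one : Q.R (-1) = -(2 * Q.b) := by
  have h0 := Q.R_neg (x := -1) le_rfl
  have hC : ((-1:ℝ):ℂ) ∉ Q.GC := fun h => by have := (Q.GC_real h).1; linarith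
  obtain ⟨h1, h2, h3⟩ := Q.R_real hC
  have e : (-1 - Q.c) ^ 2 + Q.s ^ 2 = (2 * Q.b) ^ 2 := by rw [← Q.h2]; ring
  rw [e] at h3
  have hb := Q.hb
  have : -(Q.R ((-1:ℝ):ℂ)).re = 2 * Q.b :=
    (sq_eq_sq₀ (by linarith) (by positivity)).1 (by rw [neg_sq, h3])
  have e1 : ((-1:ℝ):ℂ) = -1 := by simp
  rw [e1] at this h1
  have : (Q.R (-1)).re = -(2 * Q.b) := by linarith
  apply Complex.ext <;> simp [this, h1]

end SzDat

namespace SzDat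
variable (Q : SzDat)

lemma one_notGC : (1:ℂ) ∉ Q.GC := fun h => Q.one_notMem (Q.GC_sub h)
lemma neg_one_notGC : (-1:ℂ) ∉ Q.GC := fun h => Q.neg_one_notMem (Q.GC_sub h)
lemma notGC {z : ℂ} (hz : z ∉ Q.Gam) : z ∉ Q.GC := fun h => hz (Q.GC_sub h)

lemma V_contAt {z : ℂ} (hz : z ∉ Q.GC) : ContinuousAt (fun z => Q.V z (Q.R z)) z := by
  have := (Q.Rdz hz).continuousAt
  unfold SzPar.V; fun_prop

lemma ne_pm : ∀ᶠ z in 𝓝[≠] (1:ℂ), z ∉ Q.Gam ∧ z ≠ 1 ∧ z ≠ -1 := by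
  have h1 : ∀ᶠ z in 𝓝 (1:ℂ), z ∉ Q.Gam := Q.Gam_closed.isOpen_compl.mem_nhds Q.one_notMem
  have h2 : ∀ᶠ z in 𝓝 (1:ℂ), z ≠ -1 := isOpen_ne.mem_nhds (by norm_num)
  filter_upwards [nhdsWithin_le_nhds h1, nhdsWithin_le_nhds h2, self_mem_nhdsWithin] with z a b c
  exact ⟨a, c, b⟩

lemma ne_pm' : ∀ᶠ z in 𝓝[≠] (-1:ℂ), z ∉ Q.Gam ∧ z ≠ 1 ∧ z ≠ -1 := by
  have h1 : ∀ᶠ z in 𝓝 (-1:ℂ), z ∉ Q.Gam := Q.Gam_closed.isOpen_compl.mem_nhds Q.neg_one_notMem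
  have h2 : ∀ᶠ z in 𝓝 (-1:ℂ), z ≠ 1 := isOpen_ne.mem_nhds (by norm_num)
  filter_upwards [nhdsWithin_le_nhds h1, nhdsWithin_le_nhds h2, self_mem_nhdsWithin] with z a b c
  exact ⟨a, b, c⟩

lemma h_near_one : ∀ᶠ z in 𝓝[≠] (1:ℂ), Q.h z < 0 := by
  have hV : Q.V 1 (Q.R 1) = Q.v1 := by
    have := Q.s_ne
    rw [Q.R_one]; unfold SzPar.V; rw [div_eq_iff this, Q.v1_eq]
  have t : Tendsto (fun z => Q.V z (Q.R z)) (𝓝[≠] 1) (𝓝[≠] (Q.v1:ℂ)) := by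
    refine tendsto_nhdsWithin_iff.2 ⟨?_, ?_⟩
    · have := (Q.V_contAt Q.one_notGC).tendsto.mono_left (nhdsWithin_le_nhds (s := {1}ᶜ))
      simpa [hV] using this
    · filter_upwards [Q.ne_pm] with z hz
      have := (Q.V_good (Q.Rsq z (Q.notGC hz.1)) hz.2.1 hz.2.2).2.1
      exact sub_ne_zero.1 this
  exact (Q.Hv_tendsto_v1.comp t).eventually_lt_atBot 0

lemma h_near_neg_one : ∀ᶠ z in 𝓝[≠] (-1:ℂ), Q.h z < 0 := by
  have hs := Q.s_ne
  have h2 := Q.v2c_ne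
  have hV : Q.V (-1) (Q.R (-1)) = -1 / Q.v2 := by
    have e := Q.v2_eq
    have e2 := Q.h2c
    rw [Q.R_neg_one]; unfold SzPar.V; rw [div_eq_div_iff hs h2]
    have : (-1 - (Q.c:ℂ) + -(2 * Q.b)) * (Q.v2 * Q.s) = -1 * Q.s * Q.s := by
      rw [e]; linear_combination e2
    exact mul_right_cancel₀ hs (by linear_combination this)
  have t : Tendsto (fun z => Q.V z (Q.R z)) (𝓝[≠] (-1)) (𝓝[≠] (-1 / Q.v2:ℂ)) := by
    refine tendsto_nhdsWithin_iff.2 ⟨?_, ?_⟩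
    · have := (Q.V_contAt Q.neg_one_notGC).tendsto.mono_left (nhdsWithin_le_nhds (s := {-1}ᶜ))
      simpa [hV] using this
    · filter_upwards [Q.ne_pm'] with z hz
      have := (Q.V_good (Q.Rsq z (Q.notGC hz.1)) hz.2.1 hz.2.2).2.2.2.2
      intro h
      apply this
      rw [mem_singleton_iff] at h
      rw [h]; field_simp; ring
  exact (Q.Hv_tendsto_v2.comp t).eventually_lt_atBot 0

lemma h_near_inf : ∃ M > 1, (∀ z ∈ Q.Gam, ‖z‖ < M) ∧ ∀ z : ℂ, M ≤ ‖z‖ → 0 < Q.h z := by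
  have t : Tendsto (fun z => Q.V z (Q.R z)) (cobounded ℂ) (cobounded ℂ) := by
    rw [← tendsto_norm_atTop_iff_cobounded]
    have hi : Tendsto (fun v : ℂ => v⁻¹) (cobounded ℂ) (𝓝 0) := tendsto_inv₀_cobounded
    have h1 : Tendsto (fun z => (1 - Q.c * z⁻¹ + Q.R z / z) / Q.s) (cobounded ℂ)
        (𝓝 ((1 - Q.c * 0 + 1) / Q.s)) :=
      ((tendsto_const_nhds.sub (hi.const_mul _)).add Q.Rinf).div_const _
    have hpos : 0 < ‖((1 - Q.c * 0 + 1) / Q.s : ℂ)‖ := by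
      have := Q.s_ne
      rw [norm_pos_iff]; apply div_ne_zero _ this; norm_num
    have := (tendsto_norm_cobounded_atTop (E := ℂ)).atTop_mul_pos hpos h1.norm
    refine this.congr' ?_
    filter_upwards [tendsto_norm_cobounded_atTop.eventually_gt_atTop 0] with z hz
    have hz0 := norm_pos_iff.1 hz
    rw [← norm_mul]; congr 1
    unfold SzPar.V; field_simp
  have h := (Q.Hv_tendsto_inf.comp t).eventually_gt_atTop 0
  obtain ⟨M, hM⟩ := ((atTop_basis (α := ℝ)).cobounded_of_norm.eventually_iff).1 h
  obtain ⟨M', hM'⟩ := Q.Gam_compact.isBounded.exists_norm_le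
  refine ⟨max M (max (M' + 1) 2), by simp, fun z hz => ?_, fun z hz => hM.2 ?_⟩
  · have := hM' z hz
    have h3 : M' + 1 ≤ max M (max (M' + 1) 2) := (le_max_left _ _).trans (le_max_right _ _)
    linarith
  · simpa using (le_max_left M _).trans hz

def Up : Set ℂ := {z | z ∉ Q.Gam ∧ z ≠ 1 ∧ z ≠ -1 ∧ 0 < Q.h z}
def Un : Set ℂ := {z | z ∉ Q.Gam ∧ (z = 1 ∨ z = -1 ∨ Q.h z < 0)}

lemma nhds_ok {z : ℂ} (hz : z ∉ Q.Gam) (h1 : z ≠ 1) (h2 : z ≠ -1) :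
    ∀ᶠ w in 𝓝 z, w ∉ Q.Gam ∧ w ≠ 1 ∧ w ≠ -1 := by
  filter_upwards [Q.Gam_closed.isOpen_compl.mem_nhds hz, isOpen_ne.mem_nhds h1,
    isOpen_ne.mem_nhds h2] with w a b c using ⟨a, b, c⟩

lemma Up_open : IsOpen Q.Up := by
  rw [isOpen_iff_mem_nhds]
  rintro z ⟨hz, h1, h2, h3⟩
  filter_upwards [Q.nhds_ok hz h1 h2,
    (Q.h_continuousAt (Q.notGC hz) h1 h2).eventually (lt_mem_nhds h3)] with w a b
  exact ⟨a.1, a.2.1, a.2.2, b⟩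

lemma Un_open : IsOpen Q.Un := by
  rw [isOpen_iff_mem_nhds]
  rintro z ⟨hz, h⟩
  by_cases h1 : z = 1
  · subst h1
    have e1 := eventually_nhdsWithin_iff.1 Q.h_near_one
    filter_upwards [e1, Q.Gam_closed.isOpen_compl.mem_nhds hz] with w a b
    refine ⟨b, ?_⟩
    by_cases hw : w = 1
    · exact Or.inl hw
    · exact Or.inr (Or.inr (a hw))
  by_cases h2 : z = -1
  · subst h2
    have e1 := eventually_nhdsWithin_iff.1 Q.h_near_neg_one
    filter_upwards [e1, Q.Gam_closed.isOpen_compl.mem_nhds hz] with w a b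
    refine ⟨b, ?_⟩
    by_cases hw : w = -1
    · exact Or.inr (Or.inl hw)
    · exact Or.inr (Or.inr (a hw))
  have h3 : Q.h z < 0 := by tauto
  filter_upwards [Q.nhds_ok hz h1 h2,
    (Q.h_continuousAt (Q.notGC hz) h1 h2).eventually (gt_mem_nhds h3)] with w a b
  exact ⟨a.1, Or.inr (Or.inr b)⟩

lemma Up_Un_disj : Disjoint Q.Up Q.Un := by
  rw [Set.disjoint_left]
  rintro z ⟨_, h1, h2, h3⟩ ⟨_, h⟩
  rcases h with h | h | h
  · exact h1 h
  · exact h2 h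
  · linarith

lemma Up_Un_cover : Q.Gamᶜ ⊆ Q.Up ∪ Q.Un := by
  intro z hz
  by_cases h1 : z = 1
  · exact Or.inr ⟨hz, Or.inl h1⟩
  by_cases h2 : z = -1
  · exact Or.inr ⟨hz, Or.inr (Or.inl h2)⟩
  rcases lt_or_gt_of_ne (Q.h_ne hz h1 h2) with h | h
  · exact Or.inr ⟨hz, Or.inr (Or.inr h)⟩
  · exact Or.inl ⟨hz, h1, h2, h⟩

lemma sub_of_mem_Un {S : Set ℂ} (hS : IsPreconnected S) (hsub : S ⊆ Q.Gamᶜ) {z : ℂ} (hz : z ∈ S)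
    (hn : z ∈ Q.Un) : S ⊆ Q.Un := by
  refine (hS.subset_or_subset Q.Up_open Q.Un_open Q.Up_Un_disj (hsub.trans Q.Up_Un_cover)).resolve_left ?_
  intro h; exact Set.disjoint_left.1 Q.Up_Un_disj (h hz) hn

lemma sub_of_mem_Up {S : Set ℂ} (hS : IsPreconnected S) (hsub : S ⊆ Q.Gamᶜ) {z : ℂ} (hz : z ∈ S)
    (hn : z ∈ Q.Up) : S ⊆ Q.Up := by
  refine (hS.subset_or_subset Q.Up_open Q.Un_open Q.Up_Un_disj (hsub.trans Q.Up_Un_cover)).resolve_right ?_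
  intro h; exact Set.disjoint_left.1 Q.Up_Un_disj hn (h hz)

lemma bounded_of_Un {z : ℂ} (hz : z ∈ Q.Un) : IsBounded (connectedComponentIn Q.Gamᶜ z) := by
  have h := Q.sub_of_mem_Un isPreconnected_connectedComponentIn (connectedComponentIn_subset _ _)
    (mem_connectedComponentIn hz.1) hz
  obtain ⟨M, hM, h0, hb⟩ := Q.h_near_inf
  rw [isBounded_iff_forall_norm_le]
  refine ⟨M, fun w hw => ?_⟩
  by_contra hn
  push Not at hn
  have h1 := hb w hn.le
  rcases (h hw).2 with e | e | e
  · rw [e] at hn; simp at hn; linarith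
  · rw [e] at hn; simp at hn; linarith
  · linarith

lemma not_bounded_of_Up {z : ℂ} (hz : z ∈ Q.Up) : ¬ IsBounded (connectedComponentIn Q.Gamᶜ z) := by
  intro hb
  set U := connectedComponentIn Q.Gamᶜ z with hU
  have hsub : U ⊆ Q.Up := Q.sub_of_mem_Up isPreconnected_connectedComponentIn
    (connectedComponentIn_subset _ _) (mem_connectedComponentIn hz.1) hz
  have hcl : ∀ w ∈ closure U, w ∉ Q.Un := by
    intro w hw hn
    obtain ⟨x, h1, h2⟩ := mem_closure_iff.1 hw _ Q.Un_open hn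
    exact Set.disjoint_left.1 Q.Up_Un_disj (hsub h2) h1
  have hne : ∀ w ∈ closure U, w ≠ 1 ∧ w ≠ -1 := by
    intro w hw
    refine ⟨?_, ?_⟩ <;> rintro rfl
    · exact hcl _ hw ⟨Q.one_notMem, Or.inl rfl⟩
    · exact hcl _ hw ⟨Q.neg_one_notMem, Or.inr (Or.inl rfl)⟩
  have hUo : IsOpen U := Q.Gam_closed.isOpen_compl.connectedComponentIn
  have hin : ∀ w ∈ closure U, w ∉ Q.Gam → w ∈ U := by
    intro w hw hG
    have ho : IsOpen (connectedComponentIn Q.Gamᶜ w) := Q.Gam_closed.isOpen_compl.connectedComponentIn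
    obtain ⟨x, h1, h2⟩ := mem_closure_iff.1 hw _ ho (mem_connectedComponentIn hG)
    rw [hU, connectedComponentIn_eq h2, ← connectedComponentIn_eq h1]
    exact mem_connectedComponentIn hG
  have hc : ContinuousOn Q.F (closure U) := fun w hw =>
    (Q.F_continuousAt (hne w hw).1 (hne w hw).2).continuousWithinAt
  have hzU : z ∈ U := mem_connectedComponentIn hz.1
  obtain ⟨w, hw, hmax⟩ := hb.isCompact_closure.exists_isMaxOn ⟨z, subset_closure hzU⟩ hc
  have hFh : ∀ x ∈ U, Q.F x = Q.h x := by
    intro x hx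
    obtain ⟨a, b, c, d⟩ := hsub hx
    rw [Q.F_eq (Q.Rsq x (Q.notGC a)) b c]
    exact abs_of_pos d
  have hwG : w ∉ Q.Gam := by
    intro h
    rw [Q.mem_Gam_iff_F (hne w hw).1 (hne w hw).2] at h
    have h1 : Q.F z ≤ Q.F w := hmax (subset_closure hzU)
    rw [hFh z hzU] at h1
    have := hz.2.2.2
    linarith
  have hwU := hin w hw hwG
  obtain ⟨n1, n2⟩ := hne w hw
  have hRn := Q.R_ne (Q.notGC hwG)
  have hz2 : w ^ 2 - 1 ≠ 0 := by
    intro h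
    have : (w - 1) * (w + 1) = 0 := by linear_combination h
    rcases mul_eq_zero.1 this with h | h
    · exact n1 (by linear_combination h)
    · exact n2 (by linear_combination h)
  set q := Q.R w / (w ^ 2 - 1) with hq
  have hq0 : q ≠ 0 := div_ne_zero hRn hz2
  set d := (starRingEnd ℂ) q with hd
  have hγ : HasDerivAt (fun t : ℝ => w + t * d) d 0 := by
    simpa using ((ofRealCLM.hasDerivAt (x := 0)).mul_const d).const_add w
  have ht0 : Tendsto (fun t : ℝ => w + t * d) (𝓝 0) (𝓝 w) := by
    have := hγ.continuousAt.tendsto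
    simpa using this
  have hder := Q.H_hasDerivAt (g := fun t : ℝ => Q.R (w + t * d)) hγ
    (by
      have h1 : ContinuousAt Q.R (w + ((0:ℝ):ℂ) * d) := by
        simpa using (Q.Rdz (Q.notGC hwG)).continuousAt
      exact ContinuousAt.comp (f := fun t : ℝ => w + t * d) h1 hγ.continuousAt)
    (by
      filter_upwards [ht0.eventually (hUo.mem_nhds hwU)] with t ht
      exact Q.Rsq _ (Q.notGC (hsub ht).1)) (by simpa using n1) (by simpa using n2)
  have hloc : IsLocalMax (fun t : ℝ => Q.H (w + t * d) (Q.R (w + t * d))) 0 := by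
    filter_upwards [ht0.eventually (hUo.mem_nhds hwU)] with t ht
    have h1 : Q.F (w + t * d) ≤ Q.F w := hmax (subset_closure ht)
    rw [hFh _ ht, hFh _ hwU] at h1
    simpa [h] using h1
  have := hloc.hasDerivAt_eq_zero hder
  simp only [Complex.ofReal_zero, zero_mul, add_zero] at this
  rw [← hq, hd, Complex.mul_conj, Complex.ofReal_re, Complex.normSq_eq_zero] at this
  exact hq0 this

end SzDat

namespace SzPar
variable (P : SzPar)

def eta (x : ℝ) : ℝ := P.H x (Real.sqrt ((x - P.c) ^ 2 + P.s ^ 2) : ℝ)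

lemma sqrt_p (x : ℝ) : ((Real.sqrt ((x - P.c) ^ 2 + P.s ^ 2) : ℝ) : ℂ) ^ 2 = P.p x := by
  rw [P.p_eq, ← Complex.ofReal_pow, Real.sq_sqrt (by positivity)]; push_cast; ring

lemma eta_hasDerivAt {x : ℝ} (h1 : x ≠ 1) (h2 : x ≠ -1) :
    HasDerivAt P.eta (Real.sqrt ((x - P.c) ^ 2 + P.s ^ 2) / (x ^ 2 - 1)) x := by
  have := P.H_hasDerivAt (γ := fun x : ℝ => (x:ℂ))
    (g := fun x : ℝ => ((Real.sqrt ((x - P.c) ^ 2 + P.s ^ 2) : ℝ) : ℂ)) (t := x)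
    (Complex.ofRealCLM.hasDerivAt) (by
      have : Continuous (fun x : ℝ => ((Real.sqrt ((x - P.c) ^ 2 + P.s ^ 2) : ℝ) : ℂ)) := by fun_prop
      exact this.continuousAt)
    (Eventually.of_forall fun t => P.sqrt_p t) (by exact_mod_cast h1) (by exact_mod_cast h2)
  refine this.congr_deriv ?_
  simp only [Complex.ofRealCLM_apply, Complex.ofReal_one, mul_one]
  rw [← Complex.ofReal_pow, ← Complex.ofReal_one, ← Complex.ofReal_sub, ← Complex.ofReal_div,
    Complex.ofReal_re]

lemma sqrt_pos (x : ℝ) : 0 < Real.sqrt ((x - P.c) ^ 2 + P.s ^ 2) := by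
  have := P.hs
  apply Real.sqrt_pos.2; positivity

lemma eta_anti : StrictAntiOn P.eta (Ioo (-1) 1) := by
  apply strictAntiOn_of_deriv_neg (convex_Ioo _ _)
  · intro x hx
    exact (P.eta_hasDerivAt hx.2.ne hx.1.ne').continuousAt.continuousWithinAt
  · intro x hx
    rw [interior_Ioo] at hx
    rw [(P.eta_hasDerivAt hx.2.ne hx.1.ne').deriv]
    apply div_neg_of_pos_of_neg (P.sqrt_pos x)
    nlinarith [hx.1, hx.2]

lemma eta_mono_r : StrictMonoOn P.eta (Ioi 1) := by
  apply strictMonoOn_of_deriv_pos (convex_Ioi _)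
  · intro x hx
    rw [mem_Ioi] at hx
    exact (P.eta_hasDerivAt hx.ne' (by linarith)).continuousAt.continuousWithinAt
  · intro x hx
    rw [interior_Ioi, mem_Ioi] at hx
    rw [(P.eta_hasDerivAt hx.ne' (by linarith)).deriv]
    apply div_pos (P.sqrt_pos x)
    nlinarith

lemma eta_mono_l : StrictMonoOn P.eta (Iio (-1)) := by
  apply strictMonoOn_of_deriv_pos (convex_Iio _)
  · intro x hx
    rw [mem_Iio] at hx
    exact (P.eta_hasDerivAt (by linarith) hx.ne).continuousAt.continuousWithinAt
  · intro x hx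
    rw [interior_Iio, mem_Iio] at hx
    rw [(P.eta_hasDerivAt (by linarith) hx.ne).deriv]
    apply div_pos (P.sqrt_pos x)
    nlinarith

lemma eta_zero {x : ℝ} (hx : (x:ℂ) ∈ P.Gam) : P.eta x = 0 := (P.Gam_H hx).2.2 _ (P.sqrt_p x)

end SzPar
namespace SzDat
variable (Q : SzDat)

lemma h_real_pos {x : ℝ} (hx : (x:ℂ) ∉ Q.GC) (h : 0 < (Q.R x).re) : Q.h x = Q.eta x := by
  obtain ⟨h1, h2, h3⟩ := Q.R_real hx
  have : Q.R x = ((Real.sqrt ((x - Q.c) ^ 2 + Q.s ^ 2) : ℝ) : ℂ) := by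
    rw [← h3, Real.sqrt_sq h.le]
    apply Complex.ext <;> simp [h1]
  unfold SzDat.h SzPar.eta
  rw [this]

lemma h_real_neg {x : ℝ} (hx : (x:ℂ) ∉ Q.GC) (hx1 : x ≠ 1) (hx2 : x ≠ -1) (h : (Q.R x).re < 0) :
    Q.h x = - Q.eta x := by
  obtain ⟨h1, h2, h3⟩ := Q.R_real hx
  have : Q.R x = -((Real.sqrt ((x - Q.c) ^ 2 + Q.s ^ 2) : ℝ) : ℂ) := by
    rw [← h3, Real.sqrt_sq_eq_abs, abs_of_neg h]
    apply Complex.ext <;> simp [h1]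
  unfold SzDat.h SzPar.eta
  rw [this, Q.H_neg (Q.sqrt_p x) (by exact_mod_cast hx1) (by exact_mod_cast hx2)]

lemma side_C {x0 x : ℝ} (h0 : (x0:ℂ) ∈ Q.GC) (h1 : x0 < x) (h2 : x < 1) : (x:ℂ) ∈ Q.Un := by
  have hm := Q.GC_real h0
  have key : ∀ y : ℝ, x0 < y → y < 1 → Q.eta y < 0 := by
    intro y a b
    rw [← Q.eta_zero (Q.GC_sub h0)]
    exact Q.eta_anti hm ⟨by linarith [hm.1], b⟩ a
  have kG : ∀ y : ℝ, x0 < y → y < 1 → (y:ℂ) ∉ Q.Gam := by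
    intro y a b h
    have := Q.eta_zero h
    linarith [key y a b]
  have hpos : 0 < (Q.R x).re := by
    refine Q.R_sign (S := Ioc x0 1) isPreconnected_Ioc ?_ (x := 1) ⟨hm.2, le_rfl⟩ ⟨h1, h2.le⟩
      (Q.R_pos le_rfl)
    intro y hy
    rcases eq_or_lt_of_le hy.2 with e | e
    · rw [e]; exact_mod_cast Q.one_notGC
    · exact Q.notGC (kG y hy.1 e)
  refine ⟨kG x h1 h2, Or.inr (Or.inr ?_)⟩
  rw [Q.h_real_pos (Q.notGC (kG x h1 h2)) hpos]
  exact key x h1 h2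

lemma side_R {x0 x : ℝ} (h0 : (x0:ℂ) ∈ Q.Gam) (h1 : x < x0) (h2 : 1 < x) : (x:ℂ) ∈ Q.Un := by
  have key : Q.eta x < 0 := by
    rw [← Q.eta_zero h0]
    exact Q.eta_mono_r h2 (h2.trans h1) h1
  have kG : (x:ℂ) ∉ Q.Gam := fun h => by have := Q.eta_zero h; linarith
  refine ⟨kG, Or.inr (Or.inr ?_)⟩
  rw [Q.h_real_pos (Q.notGC kG) (Q.R_pos h2.le)]
  exact key

lemma side_L {x0 x : ℝ} (h0 : (x0:ℂ) ∈ Q.Gam) (h1 : x0 < x) (h2 : x < -1) : (x:ℂ) ∈ Q.Un := by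
  have key : 0 < Q.eta x := by
    rw [← Q.eta_zero h0]
    exact Q.eta_mono_l (h1.trans h2) h2 h1
  have kG : (x:ℂ) ∉ Q.Gam := fun h => by have := Q.eta_zero h; linarith
  refine ⟨kG, Or.inr (Or.inr ?_)⟩
  rw [Q.h_real_neg (Q.notGC kG) (by linarith) (by linarith) (Q.R_neg h2.le)]
  linarith

end SzDat

lemma inv_chart {f : ℂ → ℂ} {U : Set ℂ} (hU : IsOpen U) (hf : DifferentiableOn ℂ f U) {z0 : ℂ}
    (hz : z0 ∈ U) (hd : deriv f z0 ≠ 0) :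
    ∃ ρ > 0, ∃ χ : ℂ → ℂ, DifferentiableOn ℂ χ (Metric.ball (f z0) ρ) ∧
      (∀ x ∈ Metric.ball (f z0) ρ, χ x ∈ U ∧ f (χ x) = x) ∧ χ (f z0) = z0 ∧
      IsOpen (χ '' Metric.ball (f z0) ρ) := by
  have han : AnalyticAt ℂ f z0 := hf.analyticAt (hU.mem_nhds hz)
  have hs : HasStrictDerivAt f (deriv f z0) z0 := han.hasStrictDerivAt
  set e := (hs.hasStrictFDerivAt_equiv hd).toOpenPartialHomeomorph f with he
  have hes : z0 ∈ e.source := (hs.hasStrictFDerivAt_equiv hd).mem_toOpenPartialHomeomorph_source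
  have hef : (e : ℂ → ℂ) = f := rfl
  have hd0 : ∀ᶠ z in 𝓝 z0, deriv f z ≠ 0 :=
    han.deriv.continuousAt.eventually_ne hd
  obtain ⟨N, hN1, hN2, hN3⟩ := mem_nhds_iff.1 hd0
  set O := e.source ∩ (U ∩ N) with hO
  have hOo : IsOpen O := e.open_source.inter (hU.inter hN2)
  have him : IsOpen (e '' O) := e.isOpen_image_of_subset_source hOo inter_subset_left
  obtain ⟨ρ, hρ, hb⟩ := Metric.isOpen_iff.1 him (f z0) ⟨z0, ⟨hes, hz, hN3⟩, rfl⟩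
  have hx : ∀ x ∈ Metric.ball (f z0) ρ, e.symm x ∈ O ∧ f (e.symm x) = x ∧ x ∈ e.target := by
    intro x hx
    obtain ⟨w, hw, rfl⟩ := hb hx
    rw [e.left_inv hw.1]
    exact ⟨hw, rfl, e.map_source hw.1⟩
  refine ⟨ρ, hρ, e.symm, ?_, fun x h => ⟨(hx x h).1.2.1, (hx x h).2.1⟩, e.left_inv hes, ?_⟩
  · intro x h
    obtain ⟨h1, h2, h3⟩ := hx x h
    have : HasDerivAt e (deriv f (e.symm x)) (e.symm x) :=
      (hf.differentiableAt (hU.mem_nhds h1.2.1)).hasDerivAt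
    exact (e.hasDerivAt_symm h3 (hN1 h1.2.2) this).differentiableAt.differentiableWithinAt
  · exact e.symm.isOpen_image_of_subset_source Metric.isOpen_ball (fun x h => (hx x h).2.2)

lemma sq_sub_one_ne {z : ℂ} (h1 : z ≠ 1) (h2 : z ≠ -1) : z ^ 2 - 1 ≠ 0 := by
  intro h
  have : (z - 1) * (z + 1) = 0 := by linear_combination h
  rcases mul_eq_zero.1 this with h | h
  · exact h1 (by linear_combination h)
  · exact h2 (by linear_combination h)

namespace SzPar
variable (P : SzPar)

/-- local chart data at a regular point of the curve -/
structure Loc (z0 : ℂ) (N : Set ℂ) (r Φ : ℂ → ℂ) : Prop where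
  op : IsOpen N
  mem : z0 ∈ N
  ne : ∀ z ∈ N, z ≠ 1 ∧ z ≠ -1
  sq : ∀ z ∈ N, r z ^ 2 = P.p z
  cont : ContinuousOn r N
  der : ∀ z ∈ N, HasDerivAt Φ (r z / (z ^ 2 - 1)) z
  zero : Φ z0 = 0
  rne : r z0 ≠ 0
  heq : ∀ z ∈ N, P.H z (r z) = (Φ z).re
  pc : ∀ ε : ℝ, ε ≠ 0 → IsPreconnected {z ∈ N | 0 < ε * (Φ z).re}
  cl : ∀ ε : ℝ, ε ≠ 0 → ∀ w ∈ N, (Φ w).re = 0 → w ∈ closure {z ∈ N | 0 < ε * (Φ z).re}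

lemma exists_loc {z0 : ℂ} (hz : z0 ∈ P.Gam) (hp : P.p z0 ≠ 0) {O : Set ℂ} (hO : IsOpen O)
    (hzO : z0 ∈ O) : ∃ N r Φ, N ⊆ O ∧ P.Loc z0 N r Φ := by
  obtain ⟨n1, n2, hH⟩ := P.Gam_H hz
  obtain ⟨y0, hy0⟩ := exists_sqrt (P.p z0)
  have hy0n : y0 ≠ 0 := by rintro rfl; apply hp; rw [← hy0]; ring
  have hcp : ContinuousAt (fun z => P.p z / P.p z0) z0 :=
    (P.p_continuous.continuousAt).div_const _
  have ev : ∀ᶠ z in 𝓝 z0, z ∈ O ∧ z ≠ 1 ∧ z ≠ -1 ∧ P.p z / P.p z0 ∈ slitPlane := by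
    have h4 : ∀ᶠ z in 𝓝 z0, P.p z / P.p z0 ∈ slitPlane := by
      apply hcp.eventually
      apply isOpen_slitPlane.mem_nhds
      show P.p z0 / P.p z0 ∈ slitPlane
      rw [div_self hp]; simp
    filter_upwards [hO.mem_nhds hzO, isOpen_ne.mem_nhds n1, isOpen_ne.mem_nhds n2, h4] with z a b c d
    exact ⟨a, b, c, d⟩
  obtain ⟨δ, hδ, hb⟩ := Metric.eventually_nhds_iff_ball.1 ev
  set Bl := Metric.ball z0 δ with hBl
  have hz0B : z0 ∈ Bl := Metric.mem_ball_self hδ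
  set r : ℂ → ℂ := fun z => y0 * Complex.exp (Complex.log (P.p z / P.p z0) / 2) with hr
  have hpd : Differentiable ℂ P.p := by unfold p; fun_prop
  have hrd : DifferentiableOn ℂ r Bl := by
    intro z hz
    have h4 := (hb z hz).2.2.2
    have h5 : DifferentiableAt ℂ (fun z => P.p z / P.p z0) z := (hpd z).div_const _
    exact ((((h5.clog h4).div_const 2).cexp).const_mul y0).differentiableWithinAt
  have hrsq : ∀ z ∈ Bl, r z ^ 2 = P.p z := by
    intro z hz
    have h4 := slitPlane_ne_zero (hb z hz).2.2.2
    simp only [hr]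
    rw [mul_pow, hy0, ← Complex.exp_nat_mul]
    have : ((2:ℕ):ℂ) * (Complex.log (P.p z / P.p z0) / 2) = Complex.log (P.p z / P.p z0) := by
      push_cast; ring
    rw [this, Complex.exp_log h4]; field_simp
  have hrz0 : r z0 = y0 := by simp [hr, div_self hp]
  have hqd : DifferentiableOn ℂ (fun z => r z / (z ^ 2 - 1)) Bl := by
    refine hrd.div (by fun_prop) fun z hz => sq_sub_one_ne (hb z hz).2.1 (hb z hz).2.2.1
  obtain ⟨Φ, hΦ0, hΦ⟩ := (hqd.isExactOn_ball).with_val_at z0 0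
  have heq : ∀ z ∈ Bl, P.H z (r z) = (Φ z).re := by
    intro z hz
    have hmem : ∀ t ∈ Icc (0:ℝ) 1, z0 + t * (z - z0) ∈ Bl := by
      intro t ht
      rw [hBl, Metric.mem_ball, dist_eq_norm] at hz ⊢
      rw [add_sub_cancel_left, norm_mul, Complex.norm_real, Real.norm_of_nonneg ht.1]
      nlinarith [ht.2, norm_nonneg (z - z0)]
    have hγ : ∀ t : ℝ, HasDerivAt (fun t : ℝ => z0 + t * (z - z0)) (z - z0) t := by
      intro t
      simpa using ((ofRealCLM.hasDerivAt (x := t)).mul_const (z - z0)).const_add z0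
    have hd : ∀ t ∈ Icc (0:ℝ) 1, HasDerivAt (fun t : ℝ => P.H (z0 + t * (z - z0)) (r (z0 + t * (z - z0)))
        - (Φ (z0 + t * (z - z0))).re) 0 t := by
      intro t ht
      have hm := hmem t ht
      have hn : Bl ∈ 𝓝 (z0 + t * (z - z0)) := Metric.isOpen_ball.mem_nhds hm
      have a1 := P.H_hasDerivAt (g := fun t : ℝ => r (z0 + t * (z - z0))) (hγ t)
        (ContinuousAt.comp (f := fun t : ℝ => z0 + t * (z - z0))
          ((hrd.differentiableAt hn).continuousAt) (hγ t).continuousAt)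
        (by filter_upwards [(hγ t).continuousAt.eventually hn] with x hx using hrsq _ hx)
        (hb _ hm).2.1 (hb _ hm).2.2.1
      have a2 : HasDerivAt (fun t : ℝ => Φ (z0 + t * (z - z0))) _ t :=
        (hΦ _ hm).comp t (hγ t)
      have a3 := (Complex.reCLM.hasFDerivAt (x := Φ (z0 + t * (z - z0)))).comp_hasDerivAt t a2
      refine (a1.sub a3).congr_deriv ?_
      simp
    have := constant_of_has_deriv_right_zero
      (fun t ht => (hd t ht).continuousAt.continuousWithinAt)
      (fun t ht => (hd t ⟨ht.1, ht.2.le⟩).hasDerivWithinAt) 1 (by simp)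
    simp only [Complex.ofReal_one, one_mul, add_sub_cancel, Complex.ofReal_zero, zero_mul,
      add_zero, hΦ0, hrz0, hH y0 hy0, Complex.zero_re, sub_zero] at this
    linarith
  have hΦd : DifferentiableOn ℂ Φ Bl := fun z hz => (hΦ z hz).differentiableAt.differentiableWithinAt
  have hder0 : deriv Φ z0 ≠ 0 := by
    rw [(hΦ z0 hz0B).deriv, hrz0]
    exact div_ne_zero hy0n (sq_sub_one_ne n1 n2)
  obtain ⟨ρ, hρ, χ, hχd, hχ, hχ0, hχo⟩ := inv_chart Metric.isOpen_ball hΦd hz0B hder0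
  rw [hΦ0] at hχd hχ hχ0 hχo
  have hset : ∀ ε : ℝ, {z ∈ χ '' Metric.ball 0 ρ | 0 < ε * (Φ z).re} =
      χ '' {x ∈ Metric.ball (0:ℂ) ρ | 0 < ε * x.re} := by
    intro ε
    ext z; constructor
    · rintro ⟨⟨x, hx, rfl⟩, h⟩
      rw [(hχ x hx).2] at h
      exact ⟨x, ⟨hx, h⟩, rfl⟩
    · rintro ⟨x, ⟨hx, h⟩, rfl⟩
      refine ⟨⟨x, hx, rfl⟩, ?_⟩
      rwa [(hχ x hx).2]
  have hsub : χ '' Metric.ball 0 ρ ⊆ Bl := by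
    rintro _ ⟨x, hx, rfl⟩; exact (hχ x hx).1
  refine ⟨χ '' Metric.ball 0 ρ, r, Φ, fun z hz => (hb z (hsub hz)).1, hχo,
    ⟨0, Metric.mem_ball_self hρ, hχ0⟩, fun z hz => ⟨(hb z (hsub hz)).2.1, (hb z (hsub hz)).2.2.1⟩,
    fun z hz => hrsq z (hsub hz), hrd.continuousOn.mono hsub, fun z hz => hΦ z (hsub hz), hΦ0,
    by rwa [hrz0], fun z hz => heq z (hsub hz), ?_, ?_⟩
  · intro ε hε
    rw [hset]
    apply IsPreconnected.image
    · apply Convex.isPreconnected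
      have hcv : Convex ℝ {x : ℂ | 0 < ε * x.re} := by
        have : {x : ℂ | 0 < ε * x.re} = {x : ℂ | 0 < (ε • Complex.reLm) x} := by
          ext x; simp
        rw [this]
        exact convex_halfSpace_gt (LinearMap.isLinear _) 0
      exact (convex_ball (0:ℂ) ρ).inter hcv
    · exact hχd.continuousOn.mono fun x hx => hx.1
  · rintro ε hε _ ⟨x0, hx0, rfl⟩ hw
    rw [(hχ x0 hx0).2] at hw
    rw [hset]
    have h0 : x0 ∈ closure {x ∈ Metric.ball (0:ℂ) ρ | 0 < ε * x.re} := by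
      have t : Tendsto (fun τ : ℝ => x0 + ((τ * ε : ℝ) : ℂ)) (𝓝[>] 0) (𝓝 x0) := by
        have : Continuous (fun τ : ℝ => x0 + ((τ * ε : ℝ) : ℂ)) := by fun_prop
        have := this.continuousAt (x := 0) |>.tendsto.mono_left (nhdsWithin_le_nhds (s := Ioi 0))
        simpa using this
      refine mem_closure_of_tendsto t ?_
      filter_upwards [t.eventually (Metric.isOpen_ball.mem_nhds hx0), self_mem_nhdsWithin] with τ h1 h2
      refine ⟨h1, ?_⟩
      rw [Complex.add_re, Complex.ofReal_re, hw]
      have : 0 < ε ^ 2 := by positivity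
      have h3 : 0 < τ := h2
      nlinarith
    have hc : ContinuousAt χ x0 :=
      (hχd.differentiableAt (Metric.isOpen_ball.mem_nhds hx0)).continuousAt
    exact mem_closure_image hc h0

end SzPar

namespace SzDat
variable (Q : SzDat)

open scoped Classical in
def gd (c0 : ℝ) (z : ℂ) : ℂ :=
  (if IsBounded (connectedComponentIn Q.Gamᶜ z) then -((c0:ℂ) * (Q.R z / (z ^ 2 - 1)))
    else (c0:ℂ) * (Q.R z / (z ^ 2 - 1))) + ((c0:ℂ) * Q.a) / (z - 1) + ((c0:ℂ) * Q.b) / (z + 1)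

lemma gd_Un {c0 : ℝ} {z : ℂ} (hz : z ∈ Q.Un) : Q.gd c0 z =
    -((c0:ℂ) * (Q.R z / (z ^ 2 - 1))) + ((c0:ℂ) * Q.a) / (z - 1) + ((c0:ℂ) * Q.b) / (z + 1) := by
  unfold gd; rw [if_pos (Q.bounded_of_Un hz)]

lemma gd_Up {c0 : ℝ} {z : ℂ} (hz : z ∈ Q.Up) : Q.gd c0 z =
    ((c0:ℂ) * (Q.R z / (z ^ 2 - 1))) + ((c0:ℂ) * Q.a) / (z - 1) + ((c0:ℂ) * Q.b) / (z + 1) := by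
  unfold gd; rw [if_neg (Q.not_bounded_of_Up hz)]

variable {Q}
lemma loc_notMem {z0 : ℂ} {N : Set ℂ} {r Φ : ℂ → ℂ} (L : Q.Loc z0 N r Φ) {z : ℂ} (hz : z ∈ N) :
    z ∈ Q.Gam ↔ (Φ z).re = 0 := by
  rw [Q.mem_Gam_iff (L.sq z hz) (L.ne z hz).1 (L.ne z hz).2, L.heq z hz]

lemma loc_R {z0 : ℂ} {N : Set ℂ} {r Φ : ℂ → ℂ} (L : Q.Loc z0 N r Φ) {z : ℂ} (hz : z ∈ N)
    (h : (Φ z).re ≠ 0) : (Q.R z = r z ∧ Q.h z = (Φ z).re) ∨ (Q.R z = - r z ∧ Q.h z = -(Φ z).re) := by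
  have hG : z ∉ Q.Gam := fun hh => h ((loc_notMem L hz).1 hh)
  have h1 := Q.Rsq z (Q.notGC hG)
  have h2 := L.sq z hz
  rcases sq_eq_sq_iff_eq_or_eq_neg.1 (h1.trans h2.symm) with e | e
  · left; refine ⟨e, ?_⟩
    unfold SzDat.h; rw [e, L.heq z hz]
  · right; refine ⟨e, ?_⟩
    unfold SzDat.h; rw [e, Q.H_neg h2 (L.ne z hz).1 (L.ne z hz).2, L.heq z hz]

lemma loc_gd {z0 : ℂ} {N : Set ℂ} {r Φ : ℂ → ℂ} (L : Q.Loc z0 N r Φ) {z : ℂ} (hz : z ∈ N)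
    {ε : ℝ} (hε : ε = 1 ∨ ε = -1) (h : 0 < ε * (Φ z).re) (c0 : ℝ) :
    Q.gd c0 z = (ε:ℂ) * ((c0:ℂ) * (r z / (z ^ 2 - 1))) + ((c0:ℂ) * Q.a) / (z - 1)
      + ((c0:ℂ) * Q.b) / (z + 1) := by
  have h0 : (Φ z).re ≠ 0 := by intro h'; rw [h'] at h; simp at h
  have hG : z ∉ Q.Gam := fun hh => h0 ((loc_notMem L hz).1 hh)
  rcases lt_or_gt_of_ne (Q.h_ne hG (L.ne z hz).1 (L.ne z hz).2) with hh | hh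
  · rw [Q.gd_Un ⟨hG, Or.inr (Or.inr hh)⟩]
    rcases loc_R L hz h0 with ⟨e1, e2⟩ | ⟨e1, e2⟩ <;> rcases hε with rfl | rfl
    · exfalso; linarith
    · rw [e1]; push_cast; ring
    · rw [e1]; push_cast; ring
    · exfalso; linarith
  · rw [Q.gd_Up ⟨hG, (L.ne z hz).1, (L.ne z hz).2, hh⟩]
    rcases loc_R L hz h0 with ⟨e1, e2⟩ | ⟨e1, e2⟩ <;> rcases hε with rfl | rfl
    · rw [e1]; push_cast; ring
    · exfalso; linarith
    · exfalso; linarith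
    · rw [e1]; push_cast; ring

/-- on the part of the complement with negative `h` -/
lemma loc_R_neg {z0 : ℂ} {N : Set ℂ} {r Φ : ℂ → ℂ} (L : Q.Loc z0 N r Φ) {z : ℂ} (hz : z ∈ N)
    {ε : ℝ} (hε : ε = 1 ∨ ε = -1) (h : 0 < ε * (Φ z).re) (hh : Q.h z < 0) :
    Q.R z = -(ε:ℂ) * r z := by
  have h0 : (Φ z).re ≠ 0 := by intro h'; rw [h'] at h; simp at h
  rcases loc_R L hz h0 with ⟨e1, e2⟩ | ⟨e1, e2⟩ <;> rcases hε with rfl | rfl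
  · exfalso; linarith
  · rw [e1]; push_cast; ring
  · rw [e1]; push_cast; ring
  · exfalso; linarith

end SzDat

/-- averaging operator solving `(3/2) k + w k' = M` on a star-shaped open set -/
lemma exists_k {M : ℂ → ℂ} {D : Set ℂ} (hD : IsOpen D)
    (hst : ∀ w ∈ D, ∀ τ ∈ Icc (0:ℝ) 1, (τ:ℂ) * w ∈ D) (hM : DifferentiableOn ℂ M D) :
    ∃ k k' : ℂ → ℂ, ∀ w ∈ D, HasDerivAt k (k' w) w ∧ 3 / 2 * k w + w * k' w = M w := by
  have hM' : DifferentiableOn ℂ (deriv M) D := hM.deriv hD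
  have hst2 : ∀ w ∈ D, ∀ t ∈ Icc (0:ℝ) 1, (t:ℂ)^2 * w ∈ D := by
    intro w hw t ht
    have := hst w hw (t^2) ⟨by positivity, by nlinarith [ht.1, ht.2]⟩
    simpa using this
  refine ⟨fun w => ∫ t in (0:ℝ)..1, 2 * (t:ℂ)^2 * M ((t:ℂ)^2 * w),
    fun w => ∫ t in (0:ℝ)..1, 2 * (t:ℂ)^2 * ((t:ℂ)^2 * deriv M ((t:ℂ)^2 * w)), ?_⟩
  intro w hw
  have hcM : ∀ w ∈ D, ContinuousOn (fun t : ℝ => 2 * (t:ℂ)^2 * M ((t:ℂ)^2 * w)) (Icc 0 1) := by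
    intro w hw
    have : ContinuousOn (fun t : ℝ => M ((t:ℂ)^2 * w)) (Icc 0 1) :=
      hM.continuousOn.comp (by fun_prop) (fun t ht => hst2 w hw t ht)
    exact ContinuousOn.mul (by fun_prop) this
  have hcM' : ∀ w ∈ D, ContinuousOn
      (fun t : ℝ => 2 * (t:ℂ)^2 * ((t:ℂ)^2 * deriv M ((t:ℂ)^2 * w))) (Icc 0 1) := by
    intro w hw
    have : ContinuousOn (fun t : ℝ => deriv M ((t:ℂ)^2 * w)) (Icc 0 1) :=
      hM'.continuousOn.comp (by fun_prop) (fun t ht => hst2 w hw t ht)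
    exact ContinuousOn.mul (by fun_prop) (ContinuousOn.mul (by fun_prop) this)
  have hI : uIoc (0:ℝ) 1 ⊆ Icc 0 1 := by rw [uIoc_of_le zero_le_one]; exact Ioc_subset_Icc_self
  have hu : uIcc (0:ℝ) 1 = Icc 0 1 := uIcc_of_le zero_le_one
  set K : Set ℂ := (fun τ : ℝ => (τ:ℂ) * w) '' Icc 0 1 with hK
  have hKc : IsCompact K := isCompact_Icc.image (by fun_prop)
  have hKD : K ⊆ D := by rintro _ ⟨τ, hτ, rfl⟩; exact hst w hw τ hτ
  obtain ⟨δ, hδ, hδD⟩ := hKc.exists_cthickening_subset_open hD hKD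
  have hcomp : IsCompact (Metric.cthickening δ K) := hKc.cthickening
  obtain ⟨C, hC⟩ := hcomp.exists_bound_of_continuousOn (hM'.continuousOn.mono hδD)
  have hin : ∀ x ∈ Metric.ball w δ, ∀ t ∈ Icc (0:ℝ) 1, (t:ℂ)^2 * x ∈ Metric.cthickening δ K := by
    intro x hx t ht
    refine Metric.mem_cthickening_of_dist_le _ ((t:ℂ)^2 * w) δ K ?_ ?_
    · exact ⟨t^2, ⟨by positivity, by nlinarith [ht.1, ht.2]⟩, by push_cast; ring⟩
    · rw [dist_eq_norm, ← mul_sub, norm_mul, norm_pow, Complex.norm_real, Real.norm_of_nonneg ht.1]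
      rw [Metric.mem_ball, dist_eq_norm] at hx
      have : t^2 ≤ 1 := by nlinarith [ht.1, ht.2]
      nlinarith [norm_nonneg (x - w)]
  have hxD : ∀ x ∈ Metric.ball w δ, x ∈ D := by
    intro x hx
    have := hin x hx 1 (by simp)
    simpa using hδD this
  have main := intervalIntegral.hasDerivAt_integral_of_dominated_loc_of_deriv_le
    (μ := MeasureTheory.volume) (a := 0) (b := 1) (𝕜 := ℂ) (E := ℂ)
    (F := fun w t => 2 * (t:ℂ)^2 * M ((t:ℂ)^2 * w))
    (F' := fun w t => 2 * (t:ℂ)^2 * ((t:ℂ)^2 * deriv M ((t:ℂ)^2 * w)))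
    (x₀ := w) (s := Metric.ball w δ) (bound := fun _ => 2 * C) (Metric.ball_mem_nhds w hδ)
    (by
      filter_upwards [Metric.ball_mem_nhds w hδ] with x hx
      exact ((hcM x (hxD x hx)).mono hI).aestronglyMeasurable measurableSet_uIoc)
    (by
      apply ContinuousOn.intervalIntegrable
      rw [hu]; exact hcM w hw)
    (((hcM' w hw).mono hI).aestronglyMeasurable measurableSet_uIoc)
    (by
      refine Filter.Eventually.of_forall fun t ht x hx => ?_
      have ht' := hI ht
      have h1 := hC _ (hin x hx t ht')
      rw [norm_mul, norm_mul, norm_mul, norm_pow, Complex.norm_real, Real.norm_of_nonneg ht'.1]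
      have h2 : t^2 ≤ 1 := by nlinarith [ht'.1, ht'.2]
      have h3 : 0 ≤ t^2 := by positivity
      have h4 := norm_nonneg (deriv M ((t:ℂ)^2 * x))
      have h5 : t^2 * ‖deriv M ((t:ℂ)^2 * x)‖ ≤ C := by nlinarith
      have h6 : 0 ≤ t^2 * ‖deriv M ((t:ℂ)^2 * x)‖ := by positivity
      norm_num
      nlinarith)
    (by simp)
    (by
      refine Filter.Eventually.of_forall fun t ht x hx => ?_
      have hz := hst2 x (hxD x hx) t (hI ht)
      have h1 := (hM.differentiableAt (hD.mem_nhds hz)).hasDerivAt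
      have h2 : HasDerivAt (fun x : ℂ => (t:ℂ)^2 * x) ((t:ℂ)^2) x := by
        simpa using (hasDerivAt_id x).const_mul ((t:ℂ)^2)
      have h3 := (HasDerivAt.comp x h1 h2).const_mul (2 * (t:ℂ)^2)
      refine h3.congr_deriv ?_
      ring)
  refine ⟨main.2, ?_⟩
  have hFTC : ∫ t in (0:ℝ)..1, (3/2 * (2 * (t:ℂ)^2 * M ((t:ℂ)^2 * w)) +
      w * (2 * (t:ℂ)^2 * ((t:ℂ)^2 * deriv M ((t:ℂ)^2 * w)))) = M w := by
    rw [intervalIntegral.integral_eq_sub_of_hasDerivAt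
      (f := fun t : ℝ => (t:ℂ)^3 * M ((t:ℂ)^2 * w))]
    · simp
    · intro t ht
      rw [hu] at ht
      have hz := hst2 w hw t ht
      have h1 := (hM.differentiableAt (hD.mem_nhds hz)).hasDerivAt
      have h2 : HasDerivAt (fun t : ℝ => (t:ℂ)^2 * w) (2 * (t:ℂ) * w) t := by
        have := ((ofRealCLM.hasDerivAt (x := t)).pow 2).mul_const w
        simpa using this
      have h3 : HasDerivAt (fun t : ℝ => (t:ℂ)^3) (3 * (t:ℂ)^2) t := by
        have := ((ofRealCLM.hasDerivAt (x := t)).pow 3).mul_const (1:ℂ)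
        simpa using this
      have h4 : HasDerivAt (fun t : ℝ => M ((t:ℂ)^2 * w)) _ t := h1.comp t h2
      refine (h3.mul h4).congr_deriv ?_
      ring
    · apply ContinuousOn.intervalIntegrable
      rw [hu]
      exact ((hcM w hw).const_smul (3/2 : ℂ)).add ((hcM' w hw).const_smul w)
  rw [intervalIntegral.integral_add, intervalIntegral.integral_const_mul,
    intervalIntegral.integral_const_mul] at hFTC
  · exact hFTC
  · apply ContinuousOn.intervalIntegrable
    rw [hu]; exact (hcM w hw).const_smul (3/2 : ℂ)
  · apply ContinuousOn.intervalIntegrable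
    rw [hu]; exact (hcM' w hw).const_smul w

namespace SzPar
variable (P : SzPar)

/-- domain of the local analysis at the lower branch point (in the shifted variable) -/
def Dw : Set ℂ := {w | w.im < 2 * P.s ∧ 1 - w / (1 - P.zm) ∈ slitPlane ∧
  1 - w / (-1 - P.zm) ∈ slitPlane}

def Sw (w : ℂ) : ℂ := Complex.exp (Complex.log (w - 2 * P.s * I) / 2)
def Mw (w : ℂ) : ℂ := P.Sw w / ((P.zm + w) ^ 2 - 1)

lemma one_sub_zm : 1 - P.zm ≠ 0 := by
  intro h
  have := congrArg Complex.im h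
  simp [zm] at this
  linarith [P.hs]
lemma neg_one_sub_zm : -1 - P.zm ≠ 0 := by
  intro h
  have := congrArg Complex.im h
  simp [zm] at this
  linarith [P.hs]

lemma Dw_open : IsOpen P.Dw := by
  refine IsOpen.inter (isOpen_lt Complex.continuous_im continuous_const) (IsOpen.inter ?_ ?_)
  · exact isOpen_slitPlane.preimage (by fun_prop)
  · exact isOpen_slitPlane.preimage (by fun_prop)

lemma Dw_zero : (0:ℂ) ∈ P.Dw := by
  refine ⟨by simpa using P.hs, by simp, by simp⟩

lemma slit_star {x : ℂ} (hx : 1 - x ∈ slitPlane) {τ : ℝ} (hτ : τ ∈ Icc (0:ℝ) 1) :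
    1 - τ * x ∈ slitPlane := by
  have := Complex.starConvex_one_slitPlane hx (a := 1 - τ) (b := τ) (by linarith [hτ.2]) hτ.1 (by ring)
  have e : (1 - τ) • (1:ℂ) + τ • (1 - x) = 1 - τ * x := by
    simp [Complex.real_smul]; ring
  rwa [e] at this

lemma Dw_star : ∀ w ∈ P.Dw, ∀ τ ∈ Icc (0:ℝ) 1, (τ:ℂ) * w ∈ P.Dw := by
  rintro w ⟨h1, h2, h3⟩ τ hτ
  refine ⟨?_, ?_, ?_⟩
  · simp
    have := P.hs
    rcases le_or_gt w.im 0 with h | h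
    · nlinarith [hτ.1]
    · nlinarith [hτ.2]
  · rw [mul_div_assoc]; exact slit_star h2 hτ
  · rw [mul_div_assoc]; exact slit_star h3 hτ

lemma Dw_ne {w : ℂ} (hw : w ∈ P.Dw) : P.zm + w ≠ 1 ∧ P.zm + w ≠ -1 := by
  constructor
  · intro h
    have : w = 1 - P.zm := by linear_combination h
    have h2 := hw.2.1
    rw [this, div_self P.one_sub_zm] at h2
    simp at h2
  · intro h
    have : w = -1 - P.zm := by linear_combination h
    have h2 := hw.2.2
    rw [this, div_self P.neg_one_sub_zm] at h2
    simp at h2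

lemma Dw_slit {w : ℂ} (hw : w ∈ P.Dw) : w - 2 * P.s * I ∈ slitPlane := by
  rw [mem_slitPlane_iff]; right
  have := hw.1
  simp; linarith

lemma Sw_sq {w : ℂ} (hw : w ∈ P.Dw) : P.Sw w ^ 2 = w - 2 * P.s * I := by
  unfold Sw
  rw [← Complex.exp_nat_mul]
  have : ((2:ℕ):ℂ) * (Complex.log (w - 2 * P.s * I) / 2) = Complex.log (w - 2 * P.s * I) := by
    push_cast; ring
  rw [this, Complex.exp_log (slitPlane_ne_zero (P.Dw_slit hw))]

lemma Sw_ne (w : ℂ) : P.Sw w ≠ 0 := Complex.exp_ne_zero _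

lemma Sw_diff {w : ℂ} (hw : w ∈ P.Dw) : DifferentiableAt ℂ P.Sw w := by
  have h4 := P.Dw_slit hw
  have h5 : DifferentiableAt ℂ (fun w => w - 2 * P.s * I) w := by fun_prop
  exact (((h5.clog h4).div_const 2).cexp)

lemma Mw_diff : DifferentiableOn ℂ P.Mw P.Dw := by
  intro w hw
  have := P.Sw_diff hw
  unfold Mw
  exact (this.div (by fun_prop) (sq_sub_one_ne (P.Dw_ne hw).1 (P.Dw_ne hw).2)).differentiableWithinAt

lemma Mw_ne {w : ℂ} (hw : w ∈ P.Dw) : P.Mw w ≠ 0 :=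
  div_ne_zero (P.Sw_ne w) (sq_sub_one_ne (P.Dw_ne hw).1 (P.Dw_ne hw).2)

lemma p_shift (w : ℂ) : P.p (P.zm + w) = w * (w - 2 * P.s * I) := by
  unfold p zm zp; ring

def kw : ℂ → ℂ := Classical.choose (exists_k P.Dw_open P.Dw_star P.Mw_diff)
def kw' : ℂ → ℂ := Classical.choose (Classical.choose_spec (exists_k P.Dw_open P.Dw_star P.Mw_diff))
lemma kw_der {w : ℂ} (hw : w ∈ P.Dw) : HasDerivAt P.kw (P.kw' w) w :=
  ((Classical.choose_spec (Classical.choose_spec (exists_k P.Dw_open P.Dw_star P.Mw_diff))) w hw).1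
lemma kw_eq {w : ℂ} (hw : w ∈ P.Dw) : 3 / 2 * P.kw w + w * P.kw' w = P.Mw w :=
  ((Classical.choose_spec (Classical.choose_spec (exists_k P.Dw_open P.Dw_star P.Mw_diff))) w hw).2

lemma kw_zero : P.kw 0 ≠ 0 := by
  intro h
  have := P.kw_eq P.Dw_zero
  rw [h] at this
  exact P.Mw_ne P.Dw_zero (by rw [← this]; ring)

def Vw (w : ℂ) : ℂ := w ^ 3 * P.kw w ^ 2

lemma Vw_der {w : ℂ} (hw : w ∈ P.Dw) : HasDerivAt P.Vw (2 * w ^ 2 * P.kw w * P.Mw w) w := by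
  have h := P.kw_der hw
  refine ((hasDerivAt_pow 3 w).mul (h.pow 2)).congr_deriv ?_
  rw [← P.kw_eq hw]; simp; ring

/-- derivative of `u³ k(w)` along a path -/
lemma u3k_der {w u : ℝ → ℂ} {w' : ℂ} {t : ℝ} (hw : HasDerivAt w w' t) (hu : ContinuousAt u t)
    (hsq : ∀ᶠ x in 𝓝 t, u x ^ 2 = w x) (h0 : u t ≠ 0) (hD : w t ∈ P.Dw) :
    HasDerivAt (fun t => u t ^ 3 * P.kw (w t)) (u t * P.Sw (w t) / ((P.zm + w t) ^ 2 - 1) * w') t := by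
  have hu' := sqrt_hasDerivAt hw hu hsq h0
  have hk : HasDerivAt (fun t => P.kw (w t)) (P.kw' (w t) * w') t := (P.kw_der hD).comp t hw
  have e := P.kw_eq hD
  have e2 := hsq.self_of_nhds
  refine ((hu'.pow 3).mul hk).congr_deriv ?_
  have e3 : u t * P.Sw (w t) / ((P.zm + w t) ^ 2 - 1) = u t * P.Mw (w t) := by unfold Mw; ring
  rw [e3, ← e, ← e2]
  simp
  field_simp

/-- the height function in terms of `k` -/
lemma H_local {w u : ℂ} (hw : w ∈ P.Dw) (hu : u ^ 2 = w) :
    P.H (P.zm + w) (u * P.Sw w) = (u ^ 3 * P.kw w).re := by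
  have hD : ∀ t ∈ Icc (0:ℝ) 1, (t:ℂ)^2 * w ∈ P.Dw := by
    intro t ht
    have := P.Dw_star w hw (t^2) ⟨by positivity, by nlinarith [ht.1, ht.2]⟩
    simpa using this
  have hγ : ∀ t : ℝ, HasDerivAt (fun t : ℝ => (t:ℂ)^2 * w) (2 * t * w) t := by
    intro t
    have := ((ofRealCLM.hasDerivAt (x := t)).pow 2).mul_const w
    simpa using this
  have hγ2 : ∀ t : ℝ, HasDerivAt (fun t : ℝ => P.zm + (t:ℂ)^2 * w) (2 * t * w) t :=
    fun t => (hγ t).const_add _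
  have hev : ∀ t ∈ Icc (0:ℝ) 1, ∀ᶠ x : ℝ in 𝓝 t, (x:ℂ)^2 * w ∈ P.Dw := fun t ht =>
    (hγ t).continuousAt.eventually (P.Dw_open.mem_nhds (hD t ht))
  have hsq : ∀ x : ℝ, (x:ℂ)^2 * w ∈ P.Dw →
      ((x:ℂ) * u * P.Sw ((x:ℂ)^2 * w)) ^ 2 = P.p (P.zm + (x:ℂ)^2 * w) := by
    intro x hx
    rw [P.p_shift, mul_pow, P.Sw_sq hx, mul_pow, hu]
  have hgc : ∀ t ∈ Icc (0:ℝ) 1, ContinuousAt (fun x : ℝ => (x:ℂ) * u * P.Sw ((x:ℂ)^2 * w)) t := by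
    intro t ht
    have h1 : ContinuousAt (fun x : ℝ => P.Sw ((x:ℂ)^2 * w)) t :=
      ContinuousAt.comp (f := fun x : ℝ => (x:ℂ)^2 * w) (P.Sw_diff (hD t ht)).continuousAt
        (hγ t).continuousAt
    have h2 : ContinuousAt (fun x : ℝ => (x:ℂ) * u) t := by fun_prop
    exact h2.mul h1
  have a1 : ∀ t ∈ Icc (0:ℝ) 1, HasDerivAt (fun t : ℝ => P.H (P.zm + (t:ℂ)^2 * w)
      ((t:ℂ) * u * P.Sw ((t:ℂ)^2 * w))) _ t := fun t ht =>
    P.H_hasDerivAt (hγ2 t) (hgc t ht)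
      (by filter_upwards [hev t ht] with x hx using hsq x hx)
      (P.Dw_ne (hD t ht)).1 (P.Dw_ne (hD t ht)).2
  have a2 : ∀ t ∈ Icc (0:ℝ) 1, HasDerivAt (fun t : ℝ => ((t:ℂ) * u) ^ 3 * P.kw ((t:ℂ)^2 * w))
      ((t:ℂ) * u * P.Sw ((t:ℂ)^2 * w) / ((P.zm + (t:ℂ)^2 * w) ^ 2 - 1) * (2 * t * w)) t := by
    intro t ht
    by_cases h0 : (t:ℂ) * u = 0
    · have e1 : (t:ℂ) * w = 0 := by rw [← hu]; linear_combination u * h0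
      have hk : HasDerivAt (fun t : ℝ => P.kw ((t:ℂ)^2 * w)) _ t :=
        HasDerivAt.comp (h := fun t : ℝ => (t:ℂ)^2 * w) t (P.kw_der (hD t ht)) (hγ t)
      have h3 : HasDerivAt (fun t : ℝ => ((t:ℂ) * u)) u t := by
        simpa using (ofRealCLM.hasDerivAt (x := t)).mul_const u
      refine ((h3.pow 3).mul hk).congr_deriv ?_
      simp [h0]
    · refine P.u3k_der (u := fun t : ℝ => (t:ℂ) * u) (hγ t) (by fun_prop) ?_ h0 (hD t ht)
      refine Filter.Eventually.of_forall fun x => ?_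
      rw [mul_pow, hu]
  have hd : ∀ t ∈ Icc (0:ℝ) 1, HasDerivAt (fun t : ℝ => P.H (P.zm + (t:ℂ)^2 * w)
      ((t:ℂ) * u * P.Sw ((t:ℂ)^2 * w)) - (((t:ℂ) * u) ^ 3 * P.kw ((t:ℂ)^2 * w)).re) 0 t := by
    intro t ht
    have a3 := (Complex.reCLM.hasFDerivAt
      (x := ((t:ℂ) * u) ^ 3 * P.kw ((t:ℂ)^2 * w))).comp_hasDerivAt t (a2 t ht)
    refine ((a1 t ht).sub a3).congr_deriv ?_
    simp
  have := constant_of_has_deriv_right_zero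
      (fun t ht => (hd t ht).continuousAt.continuousWithinAt)
      (fun t ht => (hd t ⟨ht.1, ht.2.le⟩).hasDerivWithinAt) 1 (by simp)
  simp only [Complex.ofReal_one, one_pow, one_mul, Complex.ofReal_zero, zero_mul, ne_eq,
    OfNat.ofNat_ne_zero, not_false_eq_true, zero_pow, add_zero, Complex.zero_re, sub_zero,
    P.H_of_sq_zero P.p_zm] at this
  linarith

lemma mem_Gam_Vw {w : ℂ} (hw : w ∈ P.Dw) :
    P.zm + w ∈ P.Gam ↔ (P.Vw w).im = 0 ∧ (P.Vw w).re ≤ 0 := by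
  obtain ⟨u, hu⟩ := exists_sqrt w
  have hsq : (u * P.Sw w) ^ 2 = P.p (P.zm + w) := by
    rw [P.p_shift, mul_pow, hu, P.Sw_sq hw]
  rw [P.mem_Gam_iff hsq (P.Dw_ne hw).1 (P.Dw_ne hw).2, P.H_local hw hu]
  have e : P.Vw w = (u ^ 3 * P.kw w) ^ 2 := by unfold Vw; rw [← hu]; ring
  rw [e]
  generalize u ^ 3 * P.kw w = X
  rw [sq, Complex.mul_im, Complex.mul_re]
  constructor
  · intro h; rw [h]; constructor
    · ring
    · nlinarith [sq_nonneg X.im]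
  · rintro ⟨h1, h2⟩
    have : X.re * X.im = 0 := by linarith
    rcases mul_eq_zero.1 this with h | h
    · exact h
    · rw [h] at h2; nlinarith

end SzPar

namespace SzPar
variable (P : SzPar)

/-- cubic chart at the lower branch point -/
lemma exists_locz {O : Set ℂ} (hO : IsOpen O) (h0 : (0:ℂ) ∈ O) :
    ∃ ρ > 0, ∃ χ ψ : ℂ → ℂ, DifferentiableOn ℂ χ (Metric.ball 0 ρ) ∧
      (∀ x ∈ Metric.ball (0:ℂ) ρ, χ x ∈ O ∧ χ x ∈ P.Dw ∧ P.Vw (χ x) = x ^ 3 ∧ ψ (χ x) = x) ∧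
      χ 0 = 0 ∧ IsOpen (χ '' Metric.ball 0 ρ) ∧ ContinuousAt ψ 0 ∧ ψ 0 = 0 := by
  have hk0 := P.kw_zero
  obtain ⟨K0, hK0⟩ : ∃ K : ℂ, K ^ 3 = P.kw 0 ^ 2 := IsAlgClosed.exists_pow_nat_eq _ (by norm_num)
  have hK0n : K0 ≠ 0 := by
    rintro rfl
    have : P.kw 0 ^ 2 = 0 := by rw [← hK0]; ring
    exact hk0 (by simpa using this)
  have ev : ∀ᶠ w in 𝓝 (0:ℂ), w ∈ O ∧ w ∈ P.Dw ∧ P.kw w / P.kw 0 ∈ slitPlane := by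
    have hc : ContinuousAt (fun w => P.kw w / P.kw 0) 0 :=
      (P.kw_der P.Dw_zero).continuousAt.div_const _
    have h4 : ∀ᶠ w in 𝓝 (0:ℂ), P.kw w / P.kw 0 ∈ slitPlane := by
      apply hc.eventually
      apply isOpen_slitPlane.mem_nhds
      show P.kw 0 / P.kw 0 ∈ slitPlane
      rw [div_self hk0]; simp
    filter_upwards [hO.mem_nhds h0, P.Dw_open.mem_nhds P.Dw_zero, h4] with w a b c using ⟨a, b, c⟩
  obtain ⟨δ, hδ, hb⟩ := Metric.eventually_nhds_iff_ball.1 ev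
  set ψ : ℂ → ℂ := fun w => w * (K0 * Complex.exp (2 / 3 * Complex.log (P.kw w / P.kw 0))) with hψ
  have h5d : ∀ w ∈ Metric.ball (0:ℂ) δ, DifferentiableAt ℂ
      (fun w => K0 * Complex.exp (2 / 3 * Complex.log (P.kw w / P.kw 0))) w := by
    intro w hw
    have h4 := (hb w hw).2.2
    have h5 : DifferentiableAt ℂ (fun z => P.kw z / P.kw 0) w :=
      ((P.kw_der (hb w hw).2.1).differentiableAt).div_const _
    exact (((h5.clog h4).const_mul (2/3)).cexp).const_mul K0
  have hψd : DifferentiableOn ℂ ψ (Metric.ball 0 δ) := fun w hw =>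
    (differentiableAt_id.mul (h5d w hw)).differentiableWithinAt
  have h0b : (0:ℂ) ∈ Metric.ball (0:ℂ) δ := Metric.mem_ball_self hδ
  have hψ0 : ψ 0 = 0 := by simp [hψ]
  have hder : deriv ψ 0 ≠ 0 := by
    have : HasDerivAt ψ _ 0 := (hasDerivAt_id (0:ℂ)).mul (h5d 0 h0b).hasDerivAt
    rw [this.deriv]
    simp only [id, one_mul, zero_mul, add_zero]
    exact mul_ne_zero hK0n (Complex.exp_ne_zero _)
  have hψ3 : ∀ w ∈ Metric.ball (0:ℂ) δ, ψ w ^ 3 = P.Vw w := by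
    intro w hw
    have h4 := slitPlane_ne_zero (hb w hw).2.2
    simp only [hψ, Vw]
    rw [mul_pow, mul_pow, hK0, ← Complex.exp_nat_mul]
    have : ((3:ℕ):ℂ) * (2 / 3 * Complex.log (P.kw w / P.kw 0)) =
        ((2:ℕ):ℂ) * Complex.log (P.kw w / P.kw 0) := by
      push_cast; ring
    rw [this, Complex.exp_nat_mul, Complex.exp_log h4]; field_simp
  obtain ⟨ρ, hρ, χ, h1, h2, h3, h4⟩ := inv_chart Metric.isOpen_ball hψd h0b hder
  rw [hψ0] at h1 h2 h3 h4
  refine ⟨ρ, hρ, χ, ψ, h1, ?_, h3, h4,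
    (hψd.differentiableAt (Metric.ball_mem_nhds 0 hδ)).continuousAt, hψ0⟩
  intro x hx
  obtain ⟨a, b⟩ := h2 x hx
  refine ⟨(hb _ a).1, (hb _ a).2.1, ?_, b⟩
  rw [← hψ3 _ a, b]

end SzPar

structure SzG extends SzDat where
  c0 : ℝ
  c0pos : 0 < c0
  hc : c0 * (1 + a + b) = 1
  G : ℂ → ℂ
  hG : ∀ z ∉ toSzPar.Gam, ∀ γ : ℝ → ℂ, ContDiff ℝ 1 γ → γ 0 = toSzPar.zm → γ 1 = z →
      (∀ t ∈ Set.Ioc (0:ℝ) 1, γ t ∉ toSzPar.Gam) →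
      G z = Complex.exp (∫ t in (0:ℝ)..1, toSzDat.gd c0 (γ t) * deriv γ t)

namespace SzDat
variable (Q : SzDat)

/-- regular points -/
def W : Set ℂ := {z | z ∉ Q.Gam ∧ z ≠ 1 ∧ z ≠ -1}

lemma W_open : IsOpen Q.W :=
  Q.Gam_closed.isOpen_compl.inter (isOpen_ne.inter isOpen_ne)

lemma gd_diff {c0 : ℝ} {z : ℂ} (hz : z ∈ Q.W) : DifferentiableAt ℂ (Q.gd c0) z := by
  obtain ⟨h0, h1, h2⟩ := hz
  have hR := Q.Rdz (Q.notGC h0)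
  have a1 : z ^ 2 - 1 ≠ 0 := sq_sub_one_ne h1 h2
  have a2 : z - 1 ≠ 0 := sub_ne_zero.2 h1
  have a3 : z + 1 ≠ 0 := fun h => h2 (by linear_combination h)
  have d1 : DifferentiableAt ℂ (fun z => Q.R z / (z ^ 2 - 1)) z := hR.div (by fun_prop) a1
  have d2 : DifferentiableAt ℂ (fun z => ((c0:ℂ) * Q.a) / (z - 1)) z :=
    (differentiableAt_const _).div (by fun_prop) a2
  have d3 : DifferentiableAt ℂ (fun z => ((c0:ℂ) * Q.b) / (z + 1)) z :=
    (differentiableAt_const _).div (by fun_prop) a3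
  rcases Q.Up_Un_cover h0 with h | h
  · refine ((((d1.const_mul (c0:ℂ))).add d2).add d3).congr_of_eventuallyEq ?_
    filter_upwards [Q.Up_open.mem_nhds h] with w hw using Q.gd_Up hw
  · refine ((((d1.const_mul (c0:ℂ)).neg).add d2).add d3).congr_of_eventuallyEq ?_
    filter_upwards [Q.Un_open.mem_nhds h] with w hw using Q.gd_Un hw

lemma zm_ne : Q.zm ≠ 1 ∧ Q.zm ≠ -1 :=
  ⟨fun h => Q.one_sub_zm (by rw [h]; ring), fun h => Q.neg_one_sub_zm (by rw [h]; ring)⟩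

lemma gd_bound (c0 : ℝ) : ∃ C : ℝ, ∀ᶠ z in 𝓝 Q.zm, z ∉ Q.Gam → ‖Q.gd c0 z‖ ≤ C := by
  obtain ⟨n1, n2⟩ := Q.zm_ne
  have a1 : Q.zm ^ 2 - 1 ≠ 0 := sq_sub_one_ne n1 n2
  have a2 : Q.zm - 1 ≠ 0 := sub_ne_zero.2 n1
  have a3 : Q.zm + 1 ≠ 0 := fun h => n2 (by linear_combination h)
  set f : ℂ → ℝ := fun z => |c0| * (Real.sqrt ‖Q.p z‖ / ‖z ^ 2 - 1‖) + ‖((c0:ℂ) * Q.a) / (z - 1)‖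
    + ‖((c0:ℂ) * Q.b) / (z + 1)‖ with hf
  have hcf : ContinuousAt f Q.zm := by
    have h1 : ContinuousAt (fun z => Real.sqrt ‖Q.p z‖) Q.zm :=
      (Real.continuous_sqrt.comp Q.p_continuous.norm).continuousAt
    have h2 : ContinuousAt (fun z : ℂ => ‖z ^ 2 - 1‖) Q.zm := by fun_prop
    have h3 : ContinuousAt (fun z : ℂ => ((c0:ℂ) * Q.a) / (z - 1)) Q.zm :=
      continuousAt_const.div (by fun_prop) a2
    have h4 : ContinuousAt (fun z : ℂ => ((c0:ℂ) * Q.b) / (z + 1)) Q.zm :=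
      continuousAt_const.div (by fun_prop) a3
    exact ((continuousAt_const.mul (h1.div h2 (norm_ne_zero_iff.2 a1))).add h3.norm).add h4.norm
  refine ⟨f Q.zm + 1, ?_⟩
  filter_upwards [hcf.eventually (gt_mem_nhds (lt_add_one (f Q.zm)))] with z hz hG
  refine le_trans ?_ hz.le
  have hR : ‖Q.R z‖ = Real.sqrt ‖Q.p z‖ := by
    rw [← Q.Rsq z (Q.notGC hG), norm_pow, Real.sqrt_sq (norm_nonneg _)]
  have key : ‖(c0:ℂ) * (Q.R z / (z ^ 2 - 1))‖ = |c0| * (Real.sqrt ‖Q.p z‖ / ‖z ^ 2 - 1‖) := by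
    rw [norm_mul, norm_div, hR, Complex.norm_real, Real.norm_eq_abs]
  rw [hf]
  rcases Q.Up_Un_cover hG with h | h
  · rw [Q.gd_Up h]
    refine (norm_add_le _ _).trans (add_le_add_left ((norm_add_le _ _).trans ?_) _)
    rw [key]
  · rw [Q.gd_Un h]
    refine (norm_add_le _ _).trans (add_le_add_left ((norm_add_le _ _).trans ?_) _)
    rw [norm_neg, key]

/-- integrability along paths issuing from the branch point -/
lemma gd_integrable (c0 : ℝ) {γ : ℝ → ℂ} (hγ : ContDiff ℝ 1 γ) (h0 : γ 0 = Q.zm) {b : ℝ} (hb : 0 < b)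
    (hW : ∀ t ∈ Ioc (0:ℝ) b, γ t ∈ Q.W) :
    IntervalIntegrable (fun t => Q.gd c0 (γ t) * deriv γ t) MeasureTheory.volume 0 b := by
  have hcd : Continuous (deriv γ) := hγ.continuous_deriv le_rfl
  have hcont : ContinuousOn (fun t => Q.gd c0 (γ t) * deriv γ t) (Ioc 0 b) := by
    intro t ht
    have h1 : ContinuousAt (fun t => Q.gd c0 (γ t)) t :=
      ContinuousAt.comp (f := γ) (Q.gd_diff (hW t ht)).continuousAt hγ.continuous.continuousAt
    exact (h1.mul hcd.continuousAt).continuousWithinAt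
  obtain ⟨C, hC⟩ := Q.gd_bound c0
  have hev : ∀ᶠ t in 𝓝 (0:ℝ), γ t ∉ Q.Gam → ‖Q.gd c0 (γ t)‖ ≤ C := by
    have := hγ.continuous.continuousAt (x := 0)
    rw [ContinuousAt, h0] at this
    exact this.eventually hC
  have hev2 : ∀ᶠ t in 𝓝 (0:ℝ), ‖deriv γ t‖ ≤ ‖deriv γ 0‖ + 1 := by
    have := hcd.norm.continuousAt (x := 0)
    filter_upwards [this.eventually (gt_mem_nhds (lt_add_one _))] with t ht using ht.le
  obtain ⟨δ, hδ, hδb⟩ := Metric.eventually_nhds_iff_ball.1 (hev.and hev2)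
  set d := min (δ / 2) b with hd
  have hd0 : 0 < d := lt_min (by linarith) hb
  have hdb : d ≤ b := min_le_right _ _
  refine IntervalIntegrable.trans (b := d) ?_ ?_
  · rw [intervalIntegrable_iff_integrableOn_Ioc_of_le hd0.le]
    refine MeasureTheory.IntegrableOn.of_bound (by simp)
      ((hcont.mono (Ioc_subset_Ioc_right hdb)).aestronglyMeasurable measurableSet_Ioc)
      (C * (‖deriv γ 0‖ + 1)) ?_
    rw [MeasureTheory.ae_restrict_iff' measurableSet_Ioc]
    refine Filter.Eventually.of_forall fun t ht => ?_
    have htb : t ∈ Metric.ball (0:ℝ) δ := by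
      rw [Metric.mem_ball, Real.dist_eq, sub_zero, abs_of_pos ht.1]
      have := ht.2.trans (min_le_left _ _)
      linarith
    obtain ⟨e1, e2⟩ := hδb t htb
    have e3 := e1 (hW t ⟨ht.1, ht.2.trans hdb⟩).1
    rw [norm_mul]
    exact mul_le_mul e3 e2 (norm_nonneg _) ((norm_nonneg _).trans e3)
  · apply ContinuousOn.intervalIntegrable
    rw [uIcc_of_le hdb]
    exact hcont.mono fun t ht => ⟨hd0.trans_le ht.1, ht.2⟩

structure Adm (γ : ℝ → ℂ) (z : ℂ) : Prop where
  smooth : ContDiff ℝ 1 γ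
  e0 : γ 0 = Q.zm
  e1 : γ 1 = z
  mem : ∀ t ∈ Ioc (0:ℝ) 1, γ t ∈ Q.W

end SzDat

namespace SzG
variable (T : SzG)

/-- extension of an admissible path by a segment -/
lemma ext {γ0 : ℝ → ℂ} {z0 z : ℂ} (h0 : T.Adm γ0 z0) (hz : z ∉ T.Gam) {P gt : ℂ → ℂ}
    (hseg : ∀ τ ∈ Ico (0:ℝ) 1, z0 + τ * (z - z0) ∈ T.W ∧
      T.gd T.c0 (z0 + τ * (z - z0)) = gt (z0 + τ * (z - z0)))
    (hP : ∀ τ ∈ Icc (0:ℝ) 1, HasDerivAt P (gt (z0 + τ * (z - z0))) (z0 + τ * (z - z0)))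
    (hgt : ∀ τ ∈ Icc (0:ℝ) 1, ContinuousAt gt (z0 + τ * (z - z0))) :
    T.G z = T.G z0 * Complex.exp (P z - P z0) ∧ (z ∈ T.W → ∃ γ, T.Adm γ z) := by
  set s := Real.smoothTransition with hs
  have hsc : ContDiff ℝ 1 s := by simpa using Real.smoothTransition.contDiff (n := 1)
  have h2 : ContDiff ℝ 1 (fun t : ℝ => s (2 * t)) := hsc.comp (by fun_prop)
  have h3 : ContDiff ℝ 1 (fun t : ℝ => s (2 * t - 1)) := hsc.comp (by fun_prop)
  set γ : ℝ → ℂ := fun t => γ0 (s (2 * t)) + (s (2 * t - 1) : ℝ) * (z - z0) with hγ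
  have hγs : ContDiff ℝ 1 γ :=
    (h0.smooth.comp h2).add ((ofRealCLM.contDiff.comp h3).mul contDiff_const)
  have hlow : ∀ t ≤ (1/2 : ℝ), γ t = γ0 (s (2 * t)) := by
    intro t ht
    simp only [hγ]
    rw [hs, Real.smoothTransition.zero_of_nonpos (x := 2 * t - 1) (by linarith)]; simp
  have hhigh : ∀ t ≥ (1/2 : ℝ), γ t = z0 + (s (2 * t - 1) : ℝ) * (z - z0) := by
    intro t ht
    simp only [hγ]
    rw [hs, Real.smoothTransition.one_of_one_le (x := 2 * t) (by linarith), h0.e1]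
  have hγ0 : γ 0 = T.zm := by
    rw [hlow 0 (by norm_num), hs]; simp [h0.e0]
  have hγh : γ (1/2) = z0 := by
    rw [hlow (1/2) le_rfl, hs]; norm_num [h0.e1]
  have hγ1 : γ 1 = z := by
    rw [hhigh 1 (by norm_num), hs]; norm_num
  have hWlow : ∀ t ∈ Ioc (0:ℝ) (1/2), γ t ∈ T.W := by
    intro t ht
    rw [hlow t ht.2]
    exact h0.mem _ ⟨Real.smoothTransition.pos_of_pos (by linarith [ht.1]),
      Real.smoothTransition.le_one _⟩
  have hsI : ∀ t < (1:ℝ), s (2 * t - 1) ∈ Ico (0:ℝ) 1 := fun t ht =>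
    ⟨Real.smoothTransition.nonneg _, Real.smoothTransition.lt_one_of_lt_one (by linarith)⟩
  have hsI' : ∀ t, s (2 * t - 1) ∈ Icc (0:ℝ) 1 := fun t =>
    ⟨Real.smoothTransition.nonneg _, Real.smoothTransition.le_one _⟩
  have hWhigh : ∀ t ∈ Ico (1/2:ℝ) 1, γ t ∈ T.W := by
    intro t ht
    rw [hhigh t ht.1]
    exact (hseg _ (hsI t ht.2)).1
  have hcd : Continuous (deriv γ) := hγs.continuous_deriv le_rfl
  have hGz := T.hG z hz γ hγs hγ0 hγ1 (by
    intro t ht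
    rcases le_or_gt t (1/2) with h | h
    · exact (hWlow t ⟨ht.1, h⟩).1
    · rcases ht.2.lt_or_eq with h' | h'
      · exact (hWhigh t ⟨h.le, h'⟩).1
      · rw [h', hγ1]; exact hz)
  have hz0W : z0 ∈ T.W := by rw [← hγh]; exact hWlow _ (by norm_num)
  have hγ1s : ContDiff ℝ 1 (fun t : ℝ => γ (t / 2)) := hγs.comp (by fun_prop)
  have hGz0 := T.hG z0 hz0W.1 (fun t => γ (t / 2)) hγ1s (by simpa using hγ0) (by simpa using hγh) (by
    intro t ht
    exact (hWlow (t / 2) ⟨by linarith [ht.1], by linarith [ht.2]⟩).1)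
  have hder : ∀ t : ℝ, deriv (fun t : ℝ => γ (t / 2)) t = deriv γ (t / 2) * (1 / 2) := by
    intro t
    have h1 : HasDerivAt γ (deriv γ (t / 2)) (t / 2) :=
      ((hγs.differentiable (by norm_num)) _).hasDerivAt
    have h2 : HasDerivAt (fun t : ℝ => t / 2) (1 / 2 : ℝ) t := (hasDerivAt_id t).div_const 2
    have h3 := h1.scomp t h2
    have h4 : deriv (γ ∘ fun t : ℝ => t / 2) t = _ := h3.deriv
    have e : (γ ∘ fun t : ℝ => t / 2) = fun t : ℝ => γ (t / 2) := rfl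
    rw [e] at h4
    rw [h4, Complex.real_smul]; push_cast; ring
  have e1 : ∫ t in (0:ℝ)..1, T.gd T.c0 (γ (t / 2)) * deriv (fun t : ℝ => γ (t / 2)) t =
      ∫ t in (0:ℝ)..(1/2), T.gd T.c0 (γ t) * deriv γ t := by
    have : ∀ t : ℝ, T.gd T.c0 (γ (t / 2)) * deriv (fun t : ℝ => γ (t / 2)) t =
        (fun x : ℝ => T.gd T.c0 (γ x) * deriv γ x * (1 / 2)) (t / 2) := by
      intro t; rw [hder]; ring
    simp only [this]
    rw [intervalIntegral.integral_comp_div (fun x : ℝ => T.gd T.c0 (γ x) * deriv γ x * (1 / 2))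
      (two_ne_zero), intervalIntegral.integral_mul_const]
    rw [Complex.real_smul]; push_cast
    rw [zero_div]; ring
  have hEq : EqOn (fun t => gt (γ t) * deriv γ t) (fun t => T.gd T.c0 (γ t) * deriv γ t)
      (Ioo (1/2) 1) := by
    intro t ht
    simp only
    rw [hhigh t ht.1.le, (hseg _ (hsI t ht.2)).2]
  have hle : (1/2:ℝ) ≤ 1 := by norm_num
  have hint2' : IntervalIntegrable (fun t => gt (γ t) * deriv γ t) MeasureTheory.volume (1/2) 1 := by
    apply ContinuousOn.intervalIntegrable
    rw [uIcc_of_le hle]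
    intro t ht
    have h1 : ContinuousAt (fun t => gt (γ t)) t := by
      refine ContinuousAt.comp (f := γ) ?_ hγs.continuous.continuousAt
      rw [hhigh t ht.1]
      exact hgt _ (hsI' t)
    exact (h1.mul hcd.continuousAt).continuousWithinAt
  have hint2 : IntervalIntegrable (fun t => T.gd T.c0 (γ t) * deriv γ t) MeasureTheory.volume (1/2) 1 := by
    refine hint2'.congr_uIoo ?_
    rw [uIoo_of_le hle]; exact hEq
  have e2 : ∫ t in (1/2:ℝ)..1, T.gd T.c0 (γ t) * deriv γ t = P z - P z0 := by
    rw [← intervalIntegral.integral_congr_Ioo_of_le hle hEq]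
    rw [intervalIntegral.integral_eq_sub_of_hasDerivAt_of_le (f := fun t => P (γ t)) hle _ _ hint2']
    · rw [hγ1, hγh]
    · intro t ht
      refine (ContinuousAt.comp (f := γ) ?_ hγs.continuous.continuousAt).continuousWithinAt
      rw [hhigh t ht.1]
      exact (hP _ (hsI' t)).continuousAt
    · intro t ht
      have h1 : HasDerivAt P (gt (γ t)) (γ t) := by
        rw [hhigh t ht.1.le]; exact hP _ (hsI' t)
      exact HasDerivAt.comp (h₂ := P) t h1 ((hγs.differentiable (by norm_num)) t).hasDerivAt
  have hint1 := T.gd_integrable T.c0 hγs hγ0 (by norm_num : (0:ℝ) < 1/2) hWlow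
  refine ⟨?_, ?_⟩
  · rw [hGz, hGz0, e1, ← Complex.exp_add, ← e2,
      intervalIntegral.integral_add_adjacent_intervals hint1 hint2]
  · intro hzW
    refine ⟨γ, hγs, hγ0, hγ1, ?_⟩
    intro t ht
    rcases le_or_gt t (1/2) with h | h
    · exact hWlow t ⟨ht.1, h⟩
    · rcases ht.2.lt_or_eq with h' | h'
      · exact hWhigh t ⟨h.le, h'⟩
      · rw [h', hγ1]; exact hzW

end SzG

namespace SzG
variable (T : SzG)

lemma near_zm : (∀ᶠ z in 𝓝 T.zm, z ∉ T.Gam → ∃ γ, T.Adm γ z) ∧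
    Tendsto T.G (𝓝[T.Gamᶜ] T.zm) (𝓝 1) := by
  obtain ⟨C, hC⟩ := T.gd_bound T.c0
  obtain ⟨r, hr, hCr⟩ := Metric.eventually_nhds_iff_ball.1 hC
  obtain ⟨ρ, hρ, χ, ψ, hχd, hχ, hχ0, hχo, hψc, hψ0⟩ :=
    T.exists_locz (O := Metric.ball 0 r) Metric.isOpen_ball (Metric.mem_ball_self hr)
  set s := Real.smoothTransition with hs
  have hsc : ContDiff ℝ 1 s := by simpa using Real.smoothTransition.contDiff (n := 1)
  obtain ⟨C2, hC2⟩ := isCompact_Icc.exists_bound_of_continuousOn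
    ((hsc.continuous_deriv le_rfl).continuousOn (s := Icc (0:ℝ) 1))
  have hsub : Metric.closedBall (0:ℂ) (ρ/2) ⊆ Metric.ball 0 ρ :=
    Metric.closedBall_subset_ball (by linarith)
  obtain ⟨C1, hC1⟩ := (isCompact_closedBall (0:ℂ) (ρ/2)).exists_bound_of_continuousOn
    (((hχd.deriv Metric.isOpen_ball).continuousOn).mono hsub)
  have key : ∀ x ∈ Metric.closedBall (0:ℂ) (ρ/2), T.zm + χ x ∉ T.Gam →
      ∃ γ, T.Adm γ (T.zm + χ x) ∧
        ‖∫ t in (0:ℝ)..1, T.gd T.c0 (γ t) * deriv γ t‖ ≤ C * (C1 * (C2 * ‖x‖)) := by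
    intro x hx hG
    have hin : ∀ t : ℝ, ((s t : ℝ) : ℂ) * x ∈ Metric.closedBall (0:ℂ) (ρ/2) := by
      intro t
      rw [mem_closedBall_zero_iff] at hx ⊢
      rw [norm_mul, Complex.norm_real, Real.norm_of_nonneg (Real.smoothTransition.nonneg t)]
      have := Real.smoothTransition.le_one t
      have := Real.smoothTransition.nonneg t
      nlinarith [norm_nonneg x]
    have hsx : ContDiff ℝ 1 (fun t : ℝ => ((s t : ℝ) : ℂ) * x) :=
      (ofRealCLM.contDiff.comp hsc).mul contDiff_const
    have hχc : ∀ y ∈ Metric.ball (0:ℂ) ρ, ContDiffAt ℝ 1 χ y := by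
      intro y hy
      have h1 : ContDiffOn ℂ 1 χ (Metric.ball 0 ρ) := hχd.contDiffOn Metric.isOpen_ball
      exact (h1.contDiffAt (Metric.isOpen_ball.mem_nhds hy)).restrict_scalars ℝ
    have hsm : ContDiff ℝ 1 (fun t : ℝ => T.zm + χ (((s t : ℝ) : ℂ) * x)) := by
      rw [contDiff_iff_contDiffAt]
      intro t
      exact contDiffAt_const.add
        (ContDiffAt.comp (g := χ) t (hχc _ (hsub (hin t))) hsx.contDiffAt)
    have hnG : ∀ t ∈ Ioc (0:ℝ) 1, T.zm + χ (((s t : ℝ) : ℂ) * x) ∉ T.Gam := by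
      intro t ht
      have hst : 0 < s t := Real.smoothTransition.pos_of_pos ht.1
      obtain ⟨-, a1, a2, -⟩ := hχ _ (hsub (hin t))
      obtain ⟨-, b1, b2, -⟩ := hχ x (hsub hx)
      rw [T.mem_Gam_Vw b1, b2] at hG
      rw [T.mem_Gam_Vw a1, a2]
      have e : (((s t : ℝ) : ℂ) * x) ^ 3 = ((s t ^ 3 : ℝ) : ℂ) * x ^ 3 := by push_cast; ring
      rw [e, Complex.im_ofReal_mul, Complex.re_ofReal_mul]
      have h3 : 0 < s t ^ 3 := by positivity
      rintro ⟨q1, q2⟩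
      apply hG
      refine ⟨?_, ?_⟩
      · rcases mul_eq_zero.1 q1 with q | q
        · linarith
        · exact q
      · by_contra hcon
        push Not at hcon
        nlinarith
    refine ⟨fun t => T.zm + χ (((s t : ℝ) : ℂ) * x), ⟨hsm, ?_, ?_, ?_⟩, ?_⟩
    · simp [hs, hχ0]
    · simp [hs]
    · intro t ht
      exact ⟨hnG t ht, T.Dw_ne (hχ _ (hsub (hin t))).2.1⟩
    · have hb : ∀ t ∈ uIoc (0:ℝ) 1, ‖T.gd T.c0 (T.zm + χ (((s t : ℝ) : ℂ) * x)) *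
          deriv (fun t => T.zm + χ (((s t : ℝ) : ℂ) * x)) t‖ ≤ C * (C1 * (C2 * ‖x‖)) := by
        intro t ht
        rw [uIoc_of_le zero_le_one] at ht
        have hd1 : HasDerivAt (fun t : ℝ => ((s t : ℝ) : ℂ) * x) (((deriv s t : ℝ) : ℂ) * x) t :=
          ((hsc.differentiable (by norm_num) t).hasDerivAt.ofReal_comp).mul_const x
        have hd2 := (hχd.differentiableAt (Metric.isOpen_ball.mem_nhds (hsub (hin t)))).hasDerivAt
        have hd3 : HasDerivAt (fun t : ℝ => T.zm + χ (((s t : ℝ) : ℂ) * x)) _ t :=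
          (HasDerivAt.comp (h₂ := χ) t hd2 hd1).const_add T.zm
        rw [hd3.deriv, norm_mul, norm_mul, norm_mul]
        have n1 : ‖T.gd T.c0 (T.zm + χ (((s t : ℝ) : ℂ) * x))‖ ≤ C := by
          refine hCr _ ?_ (hnG t ht)
          have := (hχ _ (hsub (hin t))).1
          rw [mem_ball_zero_iff] at this
          rw [Metric.mem_ball, dist_eq_norm, add_sub_cancel_left]
          exact this
        have n2 := hC1 _ (hin t)
        have n3 : ‖((deriv s t : ℝ) : ℂ)‖ ≤ C2 := by
          rw [Complex.norm_real]; exact hC2 t ⟨ht.1.le, ht.2⟩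
        have p1 := (norm_nonneg _).trans n1
        have p2 := (norm_nonneg _).trans n2
        gcongr
      have := intervalIntegral.norm_integral_le_of_norm_le_const hb
      simpa using this
  have hcz : Tendsto (fun z => z - T.zm) (𝓝 T.zm) (𝓝 0) := by
    have : Continuous (fun z => z - T.zm) := by fun_prop
    simpa using this.tendsto T.zm
  have hψt : Tendsto (fun z => ψ (z - T.zm)) (𝓝 T.zm) (𝓝 0) := by
    have := hψc.tendsto
    rw [hψ0] at this
    exact this.comp hcz
  have hev : ∀ᶠ z in 𝓝 T.zm, ψ (z - T.zm) ∈ Metric.closedBall (0:ℂ) (ρ/2) ∧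
      T.zm + χ (ψ (z - T.zm)) = z := by
    have h1 : ∀ᶠ z in 𝓝 T.zm, z - T.zm ∈ χ '' Metric.ball 0 ρ :=
      hcz.eventually (hχo.mem_nhds ⟨0, Metric.mem_ball_self hρ, hχ0⟩)
    filter_upwards [h1, hψt.eventually (Metric.closedBall_mem_nhds 0 (half_pos hρ))] with z a b
    refine ⟨b, ?_⟩
    obtain ⟨x, hx, e⟩ := a
    rw [← e, (hχ x hx).2.2.2, e]; ring
  constructor
  · filter_upwards [hev] with z ⟨a, b⟩ hz
    obtain ⟨γ, h1, h2⟩ := key _ a (by rwa [b])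
    rw [b] at h1
    exact ⟨γ, h1⟩
  · have : ∀ᶠ z in 𝓝[T.Gamᶜ] T.zm, ∃ I : ℂ, ‖I‖ ≤ C * (C1 * (C2 * ‖ψ (z - T.zm)‖)) ∧
        T.G z = Complex.exp I := by
      filter_upwards [nhdsWithin_le_nhds hev, self_mem_nhdsWithin] with z ⟨a, b⟩ hz
      obtain ⟨γ, h1, h2⟩ := key _ a (by rwa [b])
      rw [b] at h1
      exact ⟨_, h2, T.hG z hz γ h1.smooth h1.e0 h1.e1 fun t ht => (h1.mem t ht).1⟩
    rw [← Complex.exp_zero]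
    have hex : ∀ z : ℂ, ∃ I : ℂ, (∃ I : ℂ, ‖I‖ ≤ C * (C1 * (C2 * ‖ψ (z - T.zm)‖)) ∧
        T.G z = Complex.exp I) → ‖I‖ ≤ C * (C1 * (C2 * ‖ψ (z - T.zm)‖)) ∧
        T.G z = Complex.exp I := by
      intro z
      by_cases h : ∃ I : ℂ, ‖I‖ ≤ C * (C1 * (C2 * ‖ψ (z - T.zm)‖)) ∧ T.G z = Complex.exp I
      · obtain ⟨I, hI⟩ := h; exact ⟨I, fun _ => hI⟩
      · exact ⟨0, fun h' => absurd h' h⟩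
    choose J hJ using hex
    have hJ0 : Tendsto J (𝓝[T.Gamᶜ] T.zm) (𝓝 0) := by
      have hb : Tendsto (fun z => C * (C1 * (C2 * ‖ψ (z - T.zm)‖))) (𝓝[T.Gamᶜ] T.zm) (𝓝 0) := by
        have h1 := ((hψt.norm.const_mul C2).const_mul C1).const_mul C
        simp only [norm_zero, mul_zero] at h1
        exact h1.mono_left nhdsWithin_le_nhds
      refine squeeze_zero_norm' ?_ hb
      filter_upwards [this] with z hz using (hJ z hz).1
    refine Tendsto.congr' ?_ ((Complex.continuous_exp.tendsto 0).comp hJ0)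
    filter_upwards [this] with z hz
    exact (hJ z hz).2.symm

def Reach : Set ℂ := {z | ∃ γ, T.Adm γ z}

lemma Reach_sub : T.Reach ⊆ T.W := by
  rintro z ⟨γ, h⟩
  rw [← h.e1]; exact h.mem 1 (by simp)

lemma G_ne_of {z : ℂ} (h : z ∈ T.Reach) : T.G z ≠ 0 := by
  have hW := T.Reach_sub h
  obtain ⟨γ, h⟩ := h
  rw [T.hG z hW.1 γ h.smooth h.e0 h.e1 fun t ht => (h.mem t ht).1]
  exact Complex.exp_ne_zero _

lemma seg_mem_ball {z1 : ℂ} {r : ℝ} {z z' : ℂ} (h : z ∈ Metric.ball z1 r) (h' : z' ∈ Metric.ball z1 r)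
    {τ : ℝ} (hτ : τ ∈ Icc (0:ℝ) 1) : z + τ * (z' - z) ∈ Metric.ball z1 r := by
  have := (convex_ball z1 r) h h' (by linarith [hτ.2] : 0 ≤ 1 - τ) hτ.1 (by ring)
  have e : (1 - τ) • z + τ • z' = z + τ * (z' - z) := by
    simp [Complex.real_smul]; ring
  rwa [e] at this

lemma step {z1 : ℂ} (h1 : z1 ∈ T.W) : ∃ r > 0, Metric.ball z1 r ⊆ T.W ∧ ∃ P : ℂ → ℂ,
    (∀ w ∈ Metric.ball z1 r, HasDerivAt P (T.gd T.c0 w) w) ∧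
    ∀ z ∈ Metric.ball z1 r, ∀ z' ∈ Metric.ball z1 r, z ∈ T.Reach →
      z' ∈ T.Reach ∧ T.G z' = T.G z * Complex.exp (P z' - P z) := by
  obtain ⟨r, hr, hsub⟩ := Metric.isOpen_iff.1 T.W_open z1 h1
  have hd : DifferentiableOn ℂ (T.gd T.c0) (Metric.ball z1 r) := fun w hw =>
    (T.gd_diff (hsub hw)).differentiableWithinAt
  obtain ⟨P, -, hP⟩ := (hd.isExactOn_ball).with_val_at z1 0
  refine ⟨r, hr, hsub, P, hP, ?_⟩
  intro z hz z' hz' hR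
  obtain ⟨γ0, hγ0⟩ := hR
  have := T.ext (P := P) (gt := T.gd T.c0) hγ0 (hsub hz').1
    (fun τ hτ => ⟨hsub (seg_mem_ball hz hz' ⟨hτ.1, hτ.2.le⟩), rfl⟩)
    (fun τ hτ => hP _ (seg_mem_ball hz hz' hτ))
    (fun τ hτ => (T.gd_diff (hsub (seg_mem_ball hz hz' hτ))).continuousAt)
  exact ⟨this.2 (hsub hz'), this.1⟩

lemma Reach_open : IsOpen T.Reach := by
  rw [isOpen_iff_mem_nhds]
  intro z hz
  obtain ⟨r, hr, -, P, -, h⟩ := T.step (T.Reach_sub hz)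
  filter_upwards [Metric.ball_mem_nhds z hr] with w hw
  exact (h z (Metric.mem_ball_self hr) w hw hz).1

lemma NReach_open : IsOpen (T.W \ T.Reach) := by
  rw [isOpen_iff_mem_nhds]
  rintro z ⟨hz, hn⟩
  obtain ⟨r, hr, hsub, P, -, h⟩ := T.step hz
  filter_upwards [Metric.ball_mem_nhds z hr] with w hw
  exact ⟨hsub hw, fun hw' => hn (h w hw z (Metric.mem_ball_self hr) hw').1⟩

lemma arc_p_ne {γ : ℝ → ℂ} (hγ : T.IsArc γ) {t : ℝ} (ht : t ∈ Ioo (0:ℝ) 1) : T.p (γ t) ≠ 0 := by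
  intro h
  have htI : t ∈ Icc (0:ℝ) 1 := ⟨ht.1.le, ht.2.le⟩
  rcases T.p_eq_zero h with h | h
  · rw [← hγ.e0] at h
    have := hγ.inj htI (by simp) h
    linarith [ht.1]
  · rw [← hγ.e1] at h
    have := hγ.inj htI (by simp) h
    linarith [ht.2]

lemma arc_dichotomy {γ : ℝ → ℂ} (hγ : T.IsArc γ) {t : ℝ} (ht : t ∈ Ioo (0:ℝ) 1) :
    γ t ∉ closure (T.W \ T.Reach) := by
  intro hcl
  set Qs := T.W \ T.Reach with hQ
  have hdisj : Disjoint Qs T.Reach := Set.disjoint_sdiff_left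
  have main : Ioo (0:ℝ) 1 ⊆ {t | t ∈ Ioo (0:ℝ) 1 ∧ γ t ∈ closure Qs} := by
    refine isPreconnected_Ioo.subset_of_closure_inter_subset ?_ ⟨t, ht, ht, hcl⟩ ?_
    · rw [isOpen_iff_mem_nhds]
      rintro t0 ⟨ht0, hc0⟩
      obtain ⟨N, r, Φ, -, L⟩ := T.exists_loc (hγ.sub t0 ⟨ht0.1.le, ht0.2.le⟩) (T.arc_p_ne hγ ht0)
        isOpen_univ (mem_univ _)
      obtain ⟨q, hqN, hq⟩ := mem_closure_iff.1 hc0 N L.op L.mem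
      have hq0 : (Φ q).re ≠ 0 := fun h => hq.1.1 ((SzDat.loc_notMem L hqN).2 h)
      obtain ⟨ε, hε, hqε⟩ : ∃ ε : ℝ, ε ≠ 0 ∧ 0 < ε * (Φ q).re := ⟨(Φ q).re, hq0, mul_self_pos.2 hq0⟩
      have hsub : {z ∈ N | 0 < ε * (Φ z).re} ⊆ Qs := by
        have hcov : {z ∈ N | 0 < ε * (Φ z).re} ⊆ Qs ∪ T.Reach := by
          rintro z ⟨hzN, hz⟩
          have hzW : z ∈ T.W := ⟨fun h => by
            rw [(SzDat.loc_notMem L hzN).1 h] at hz; simp at hz, L.ne z hzN⟩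
          by_cases hzR : z ∈ T.Reach
          · exact Or.inr hzR
          · exact Or.inl ⟨hzW, hzR⟩
        refine ((L.pc ε hε).subset_or_subset T.NReach_open T.Reach_open hdisj hcov).resolve_right ?_
        intro h
        exact hq.2 (h ⟨hqN, hqε⟩)
      have hc := hγ.smooth.continuous.continuousAt (x := t0)
      filter_upwards [hc.eventually (L.op.mem_nhds L.mem), Ioo_mem_nhds ht0.1 ht0.2] with x hx hxI
      refine ⟨hxI, closure_mono hsub (L.cl ε hε _ hx ?_)⟩
      exact (SzDat.loc_notMem L hx).1 (hγ.sub x ⟨hxI.1.le, hxI.2.le⟩)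
    · rintro x ⟨hx, hxI⟩
      refine ⟨hxI, ?_⟩
      have : IsClosed {x : ℝ | γ x ∈ closure Qs} := isClosed_closure.preimage hγ.smooth.continuous
      exact this.closure_subset_iff.2 (fun y hy => hy.2) hx
  have hzm : T.zm ∈ closure Qs := by
    have hcl' : IsClosed {x : ℝ | γ x ∈ closure Qs} := isClosed_closure.preimage hγ.smooth.continuous
    have h1 : (1:ℝ) ∈ closure (Ioo (0:ℝ) 1) := by rw [closure_Ioo (by norm_num)]; simp
    have := hcl'.closure_subset_iff.2 (fun y hy => (main hy).2) h1
    have h2 : γ 1 ∈ closure Qs := this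
    rwa [hγ.e1] at h2
  obtain ⟨O, hO, hOo, hOm⟩ := eventually_nhds_iff.1 T.near_zm.1
  obtain ⟨q, hqO, hq⟩ := mem_closure_iff.1 hzm O hOo hOm
  exact hq.2 (hO q hqO hq.1.1)

lemma Reach_eq : T.Reach = T.W := by
  refine Subset.antisymm T.Reach_sub ?_
  by_contra hne
  obtain ⟨q, hqW, hqR⟩ := Set.not_subset.1 hne
  set Qs := T.W \ T.Reach with hQ
  have hconn : IsPreconnected ({T.zp, T.zm, 1, -1} : Set ℂ)ᶜ := by
    have hcount : ({T.zp, T.zm, 1, -1} : Set ℂ).Countable := (Set.toFinite _).countable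
    refine (hcount.isConnected_compl_of_one_lt_rank ?_).isPreconnected
    rw [Complex.rank_real_complex]; norm_num
  have harc : ∀ z ∈ T.Gam, z ≠ T.zp → z ≠ T.zm → z ∉ closure Qs := by
    intro z hz h1 h2
    have aux : ∀ γ, T.IsArc γ → z ∈ γ '' Icc 0 1 → z ∉ closure Qs := by
      rintro γ hγ ⟨t, ht, rfl⟩
      refine T.arc_dichotomy hγ ⟨lt_of_le_of_ne ht.1 ?_, lt_of_le_of_ne ht.2 ?_⟩
      · rintro rfl; exact h1 hγ.e0
      · rintro rfl; exact h2 hγ.e1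
    rw [← T.union] at hz
    rcases hz with (hz | hz) | hz
    · exact aux _ T.aL hz
    · exact aux _ T.aC hz
    · exact aux _ T.aR hz
  have hmain : ({T.zp, T.zm, 1, -1} : Set ℂ)ᶜ ⊆ Qs := by
    have hqx : q ∈ ({T.zp, T.zm, 1, -1} : Set ℂ)ᶜ := by
      simp only [mem_compl_iff, mem_insert_iff, mem_singleton_iff, not_or]
      refine ⟨?_, ?_, hqW.2.1, hqW.2.2⟩
      · rintro rfl; exact hqW.1 (T.GC_sub T.zp_mem)
      · rintro rfl; exact hqW.1 (T.GC_sub T.zm_mem)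
    refine hconn.subset_of_closure_inter_subset T.NReach_open ⟨q, hqx, hqW, hqR⟩ ?_
    rintro z ⟨hzc, hz⟩
    simp only [mem_compl_iff, mem_insert_iff, mem_singleton_iff, not_or] at hz
    have hzG : z ∉ T.Gam := fun h => harc z h hz.1 hz.2.1 hzc
    refine ⟨⟨hzG, hz.2.2.1, hz.2.2.2⟩, ?_⟩
    intro hzR
    obtain ⟨y, hy1, hy2⟩ := mem_closure_iff.1 hzc _ T.Reach_open hzR
    exact hy2.2 hy1
  have hh : (1/2:ℝ) ∈ Ioo (0:ℝ) 1 := by norm_num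
  have hG : T.gC (1/2) ∈ T.Gam := T.aC.sub _ ⟨hh.1.le, hh.2.le⟩
  have hp := T.arc_p_ne T.aC hh
  have : T.gC (1/2) ∈ ({T.zp, T.zm, 1, -1} : Set ℂ)ᶜ := by
    simp only [mem_compl_iff, mem_insert_iff, mem_singleton_iff, not_or]
    obtain ⟨n1, n2, -⟩ := T.Gam_H hG
    refine ⟨fun h => hp ?_, fun h => hp ?_, n1, n2⟩
    · rw [h]; exact T.p_zp
    · rw [h]; exact T.p_zm
  exact (hmain this).1.1 hG

lemma G_hasDerivAt {z : ℂ} (hz : z ∈ T.W) : HasDerivAt T.G (T.gd T.c0 z * T.G z) z := by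
  obtain ⟨r, hr, hsub, P, hP, h⟩ := T.step hz
  have hm : z ∈ Metric.ball z r := Metric.mem_ball_self hr
  have h1 : HasDerivAt (fun w => T.G z * Complex.exp (P w - P z))
      (T.G z * (Complex.exp (P z - P z) * T.gd T.c0 z)) z :=
    (((hP z hm).sub_const (P z)).cexp).const_mul (T.G z)
  rw [sub_self, Complex.exp_zero] at h1
  refine (h1.congr_of_eventuallyEq ?_).congr_deriv (by ring)
  filter_upwards [Metric.ball_mem_nhds z hr] with w hw
  exact (h z hm w hw (by rw [T.Reach_eq]; exact hz)).2

lemma G_ne {z : ℂ} (hz : z ∈ T.W) : T.G z ≠ 0 := T.G_ne_of (by rw [T.Reach_eq]; exact hz)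

/-- removable points -/
lemma G_diff_pole {e : ℂ} (he : e ∉ T.Gam) {r : ℝ} (hr : 0 < r) {gt : ℂ → ℂ}
    (hW : ∀ z ∈ Metric.ball e r, z ≠ e → z ∈ T.W ∧ T.gd T.c0 z = gt z)
    (hgt : DifferentiableOn ℂ gt (Metric.ball e r)) : DifferentiableAt ℂ T.G e := by
  obtain ⟨P, -, hP⟩ := (hgt.isExactOn_ball).with_val_at e 0
  have hm : e ∈ Metric.ball e r := Metric.mem_ball_self hr
  have key : ∀ z ∈ Metric.ball e r, T.G z = T.G e * Complex.exp (P z - P e) := by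
    intro z hz
    by_cases hze : z = e
    · subst hze; simp
    have hzR : z ∈ T.Reach := by rw [T.Reach_eq]; exact (hW z hz hze).1
    obtain ⟨γ0, hγ0⟩ := hzR
    have := (T.ext (P := P) (gt := gt) hγ0 he
      (fun τ hτ => hW _ (seg_mem_ball hz hm ⟨hτ.1, hτ.2.le⟩) (by
        intro h
        have h2 : (1 - (τ:ℂ)) * (z - e) = 0 := by linear_combination h
        rcases mul_eq_zero.1 h2 with h3 | h3
        · have : τ = 1 := by
            have : (τ:ℂ) = 1 := by linear_combination -h3
            exact_mod_cast this
          linarith [hτ.2]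
        · exact hze (sub_eq_zero.1 h3)))
      (fun τ hτ => hP _ (seg_mem_ball hz hm hτ))
      (fun τ hτ => (hgt.differentiableAt
        (Metric.isOpen_ball.mem_nhds (seg_mem_ball hz hm hτ))).continuousAt)).1
    rw [this, mul_assoc, ← Complex.exp_add]
    simp
  have h1 : DifferentiableAt ℂ (fun w => T.G e * Complex.exp (P w - P e)) e :=
    (((hP e hm).sub_const (P e)).cexp.const_mul (T.G e)).differentiableAt
  refine h1.congr_of_eventuallyEq ?_
  filter_upwards [Metric.ball_mem_nhds e hr] with w hw using key w hw

lemma G_diff : DifferentiableOn ℂ T.G T.Gamᶜ := by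
  intro z hz
  apply DifferentiableAt.differentiableWithinAt
  by_cases h1 : z = 1
  · subst h1
    have hUn : (1:ℂ) ∈ T.Un := ⟨hz, Or.inl rfl⟩
    obtain ⟨r0, hr0, hb0⟩ := Metric.isOpen_iff.1 T.Un_open 1 hUn
    set r := min r0 1
    have hr : 0 < r := lt_min hr0 one_pos
    have hb : Metric.ball (1:ℂ) r ⊆ T.Un := (Metric.ball_subset_ball (min_le_left _ _)).trans hb0
    have hn : ∀ w ∈ Metric.ball (1:ℂ) r, w + 1 ≠ 0 := by
      intro w hw h
      have := Metric.ball_subset_ball (min_le_right r0 1) hw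
      rw [Metric.mem_ball, dist_eq_norm, eq_neg_of_add_eq_zero_left h] at this
      norm_num at this
    set N : ℂ → ℂ := fun z => -((T.c0:ℂ) * T.R z) + T.c0 * T.a * (z + 1) with hN
    have hNd : DifferentiableOn ℂ N (Metric.ball 1 r) := by
      intro w hw
      have := T.Rdz (T.notGC (hb hw).1)
      apply DifferentiableAt.differentiableWithinAt
      exact ((this.const_mul _).neg).add (by fun_prop)
    have hN1 : N 1 = 0 := by simp only [hN, T.R_one]; ring
    refine T.G_diff_pole hz hr (gt := fun w => (dslope N 1 w + T.c0 * T.b) / (w + 1)) ?_ ?_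
    · intro w hw hw1
      have a3 := hn w hw
      have hwm : w ≠ -1 := fun h => a3 (by rw [h]; ring)
      refine ⟨⟨(hb hw).1, hw1, hwm⟩, ?_⟩
      rw [T.gd_Un (hb hw), dslope_of_ne _ hw1, slope_def_field, hN1]
      have a1 := sq_sub_one_ne hw1 hwm
      have a2 : w - 1 ≠ 0 := sub_ne_zero.2 hw1
      have e : w ^ 2 - 1 = (w - 1) * (w + 1) := by ring
      simp only [hN]
      rw [e]
      field_simp
      ring
    · have := (Complex.differentiableOn_dslope (Metric.ball_mem_nhds (1:ℂ) hr)).2 hNd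
      exact (this.add_const _).div (by fun_prop) hn
  by_cases h2 : z = -1
  · subst h2
    have hUn : (-1:ℂ) ∈ T.Un := ⟨hz, Or.inr (Or.inl rfl)⟩
    obtain ⟨r0, hr0, hb0⟩ := Metric.isOpen_iff.1 T.Un_open (-1) hUn
    set r := min r0 1
    have hr : 0 < r := lt_min hr0 one_pos
    have hb : Metric.ball (-1:ℂ) r ⊆ T.Un := (Metric.ball_subset_ball (min_le_left _ _)).trans hb0
    have hn : ∀ w ∈ Metric.ball (-1:ℂ) r, w - 1 ≠ 0 := by
      intro w hw h
      have := Metric.ball_subset_ball (min_le_right r0 1) hw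
      rw [Metric.mem_ball, dist_eq_norm, sub_eq_zero.1 h] at this
      norm_num at this
    set N : ℂ → ℂ := fun z => -((T.c0:ℂ) * T.R z) + T.c0 * T.b * (z - 1) with hN
    have hNd : DifferentiableOn ℂ N (Metric.ball (-1) r) := by
      intro w hw
      have := T.Rdz (T.notGC (hb hw).1)
      apply DifferentiableAt.differentiableWithinAt
      exact ((this.const_mul _).neg).add (by fun_prop)
    have hN1 : N (-1) = 0 := by simp only [hN, T.R_neg_one]; ring
    refine T.G_diff_pole hz hr (gt := fun w => (dslope N (-1) w + T.c0 * T.a) / (w - 1)) ?_ ?_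
    · intro w hw hw1
      have a3 := hn w hw
      have hwm : w ≠ 1 := fun h => a3 (by rw [h]; ring)
      refine ⟨⟨(hb hw).1, hwm, hw1⟩, ?_⟩
      rw [T.gd_Un (hb hw), dslope_of_ne _ hw1, slope_def_field, hN1]
      have a1 := sq_sub_one_ne hwm hw1
      have a2 : w + 1 ≠ 0 := fun h => hw1 (by linear_combination h)
      have e : w ^ 2 - 1 = (w - 1) * (w + 1) := by ring
      have e' : w - -1 = w + 1 := by ring
      simp only [hN]
      rw [e, e']
      field_simp
      ring
    · have := (Complex.differentiableOn_dslope (Metric.ball_mem_nhds (-1:ℂ) hr)).2 hNd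
      exact (this.add_const _).div (by fun_prop) hn
  exact (T.G_hasDerivAt ⟨hz, h1, h2⟩).differentiableAt

end SzG

lemma punct_ball_pc {δ : ℝ} (hδ : 0 < δ) : IsPreconnected (Metric.ball (0:ℂ) δ \ {0}) := by
  have e : Metric.ball (0:ℂ) δ \ {0} = Complex.exp '' {w | w.re < Real.log δ} := by
    ext z
    simp only [mem_diff, Metric.mem_ball, dist_zero_right, mem_singleton_iff, mem_image, mem_setOf_eq]
    constructor
    · rintro ⟨h1, h2⟩
      refine ⟨Complex.log z, ?_, Complex.exp_log h2⟩
      rw [Complex.log_re]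
      exact Real.log_lt_log (norm_pos_iff.2 h2) h1
    · rintro ⟨w, hw, rfl⟩
      refine ⟨?_, Complex.exp_ne_zero _⟩
      rw [Complex.norm_exp]
      exact (Real.lt_log_iff_exp_lt hδ).1 hw
  rw [e]
  exact (convex_halfSpace_re_lt _).isPreconnected.image _ Complex.continuous_exp.continuousOn

namespace SzG
variable (T : SzG)

lemma G_inf : ∃ κ : ℂ, κ ≠ 0 ∧ Tendsto (fun z => T.G z / z) (cobounded ℂ) (𝓝 κ) := by
  obtain ⟨M, hM1, hMG, hMh⟩ := T.h_near_inf
  have hM0 : 0 < M := by linarith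
  set δ : ℝ := 1 / M with hδd
  have hδ : 0 < δ := by positivity
  have hδ1 : δ < 1 := by rw [hδd, div_lt_one hM0]; exact hM1
  have hUp : ∀ z : ℂ, M ≤ ‖z‖ → z ∈ T.Up := by
    intro z hz
    refine ⟨fun h => ?_, ?_, ?_, hMh z hz⟩
    · linarith [hMG z h]
    · rintro rfl; simp at hz; linarith
    · rintro rfl; simp at hz; linarith
  have hinv : ∀ x ∈ Metric.ball (0:ℂ) δ \ {0}, x ≠ 0 ∧ x⁻¹ ∈ T.Up := by
    rintro x ⟨hx, hx0⟩
    have hx0 : x ≠ 0 := by simpa using hx0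
    refine ⟨hx0, hUp _ ?_⟩
    rw [Metric.mem_ball, dist_zero_right, hδd, lt_div_iff₀ hM0] at hx
    rw [norm_inv, le_inv_comm₀ hM0 (norm_pos_iff.2 hx0)]
    rw [← one_div, le_div_iff₀ hM0]; exact hx.le
  set ρ : ℂ → ℂ := Function.update (fun x => T.R x⁻¹ * x) 0 1 with hρ
  have hρne : ∀ x : ℂ, x ≠ 0 → ρ x = T.R x⁻¹ * x := fun x hx => by
    simp [hρ, hx]
  have hρ0 : ρ 0 = 1 := by simp [hρ]
  have hρd0 : ∀ x ∈ Metric.ball (0:ℂ) δ \ {0}, DifferentiableAt ℂ ρ x := by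
    intro x hx
    obtain ⟨hx0, hu⟩ := hinv x hx
    have h1 : DifferentiableAt ℂ (fun x => T.R x⁻¹ * x) x :=
      ((T.Rdz (T.notGC hu.1)).comp x (differentiableAt_inv hx0)).mul differentiableAt_id
    refine h1.congr_of_eventuallyEq ?_
    filter_upwards [isOpen_ne.mem_nhds hx0] with y hy using hρne y hy
  have hpb : Metric.ball (0:ℂ) δ \ {0} ∈ 𝓝[≠] (0:ℂ) := by
    rw [diff_eq]
    exact inter_mem (mem_nhdsWithin_of_mem_nhds (Metric.ball_mem_nhds 0 hδ)) self_mem_nhdsWithin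
  have hρc : ContinuousAt ρ 0 := by
    rw [hρ, continuousAt_update_same]
    have h1 := T.Rinf.comp (tendsto_inv₀_nhdsNE_zero (α := ℂ))
    refine h1.congr' ?_
    filter_upwards [self_mem_nhdsWithin] with x hx
    simp
  have hρd : DifferentiableOn ℂ ρ (Metric.ball 0 δ) := by
    intro x hx
    apply DifferentiableAt.differentiableWithinAt
    by_cases h : x = 0
    · subst h
      exact (analyticAt_of_differentiable_on_punctured_nhds_of_continuousAt
        (by filter_upwards [hpb] with y hy using hρd0 y hy) hρc).differentiableAt
    · exact hρd0 x ⟨hx, h⟩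
  have hn1 : ∀ x ∈ Metric.ball (0:ℂ) δ, 1 - x ≠ 0 ∧ 1 + x ≠ 0 := by
    intro x hx
    rw [Metric.mem_ball, dist_zero_right] at hx
    refine ⟨fun h => ?_, fun h => ?_⟩
    · rw [← sub_eq_zero.1 h] at hx; simp at hx; linarith
    · rw [eq_neg_of_add_eq_zero_right h] at hx; simp at hx; linarith
  set N : ℂ → ℂ := fun x => 1 - T.c0 * ρ x / ((1 - x) * (1 + x)) - T.c0 * T.a / (1 - x)
    - T.c0 * T.b / (1 + x) with hN
  have hNd : DifferentiableOn ℂ N (Metric.ball 0 δ) := by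
    refine ((((differentiableOn_const _).sub ((hρd.const_mul _).div (by fun_prop) ?_))).sub
      ((differentiableOn_const _).div (by fun_prop) ?_)).sub
      ((differentiableOn_const _).div (by fun_prop) ?_)
    · intro x hx; exact mul_ne_zero (hn1 x hx).1 (hn1 x hx).2
    · intro x hx; exact (hn1 x hx).1
    · intro x hx; exact (hn1 x hx).2
  have hN0 : N 0 = 0 := by
    have : (T.c0 : ℂ) * (1 + T.a + T.b) = 1 := by exact_mod_cast T.hc
    simp only [hN, hρ0]; simp; linear_combination -this
  have hsd := (Complex.differentiableOn_dslope (Metric.ball_mem_nhds (0:ℂ) hδ)).2 hNd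
  obtain ⟨P, -, hP⟩ := (hsd.isExactOn_ball).with_val_at 0 0
  set K : ℂ → ℂ := fun x => T.G x⁻¹ * x * Complex.exp (-P x) with hK
  have hKd : ∀ x ∈ Metric.ball (0:ℂ) δ \ {0}, HasDerivAt K 0 x := by
    intro x hx
    obtain ⟨hx0, hu⟩ := hinv x hx
    have hW : x⁻¹ ∈ T.W := ⟨hu.1, hu.2.1, hu.2.2.1⟩
    have h1 : HasDerivAt (fun x => T.G x⁻¹) _ x := (T.G_hasDerivAt hW).comp x (hasDerivAt_inv hx0)
    have h2 := (h1.mul (hasDerivAt_id x)).mul ((hP x hx.1).neg.cexp)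
    refine h2.congr_deriv ?_
    rw [dslope_of_ne _ hx0, slope_def_field, hN0, T.gd_Up hu]
    obtain ⟨a1, a2⟩ := hn1 x hx.1
    simp only [hN, hρne x hx0, id]
    have e1 : x⁻¹ ^ 2 - 1 = (1 - x) * (1 + x) / x ^ 2 := by field_simp <;> ring
    have e2 : x⁻¹ - 1 = (1 - x) / x := by field_simp
    have e3 : x⁻¹ + 1 = (1 + x) / x := by field_simp
    rw [e1, e2, e3]
    simp only [Pi.neg_apply, Pi.mul_apply, id]
    field_simp
    ring
  have hop : IsOpen (Metric.ball (0:ℂ) δ \ {0}) := Metric.isOpen_ball.sdiff isClosed_singleton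
  have hconst : ∀ x ∈ Metric.ball (0:ℂ) δ \ {0}, ∀ y ∈ Metric.ball (0:ℂ) δ \ {0}, K x = K y :=
    fun x hx y hy => hop.is_const_of_deriv_eq_zero (punct_ball_pc hδ)
      (fun z hz => (hKd z hz).differentiableAt.differentiableWithinAt)
      (fun z hz => (hKd z hz).deriv) hx hy
  set x0 : ℂ := ((δ / 2 : ℝ) : ℂ) with hx0d
  have hx0 : x0 ∈ Metric.ball (0:ℂ) δ \ {0} := by
    refine ⟨?_, ?_⟩
    · rw [Metric.mem_ball, dist_zero_right, hx0d, Complex.norm_real, Real.norm_eq_abs,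
        abs_of_pos (by positivity)]; linarith
    · simp [hx0d, hδ.ne']
  have hK0 : K x0 ≠ 0 := by
    obtain ⟨h0, hu⟩ := hinv x0 hx0
    exact mul_ne_zero (mul_ne_zero (T.G_ne ⟨hu.1, hu.2.1, hu.2.2.1⟩) h0) (Complex.exp_ne_zero _)
  refine ⟨K x0 * Complex.exp (P 0), mul_ne_zero hK0 (Complex.exp_ne_zero _), ?_⟩
  have hlim : Tendsto (fun x => K x0 * Complex.exp (P x)) (𝓝[≠] 0) (𝓝 (K x0 * Complex.exp (P 0))) := by
    have : ContinuousAt (fun x => K x0 * Complex.exp (P x)) 0 :=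
      ((hP 0 (Metric.mem_ball_self hδ)).cexp.const_mul (K x0)).continuousAt
    exact this.tendsto.mono_left nhdsWithin_le_nhds
  have h3 := hlim.comp (tendsto_inv₀_cobounded' (α := ℂ))
  refine h3.congr' ?_
  filter_upwards [(tendsto_inv₀_cobounded' (α := ℂ)).eventually hpb] with z hz
  have hz' : z⁻¹ ∈ Metric.ball (0:ℂ) δ \ {0} := hz
  simp only [Function.comp]
  rw [hconst x0 hx0 _ hz']
  simp only [hK, inv_inv]
  rw [mul_assoc, ← Complex.exp_add]; simp [div_eq_mul_inv]

end SzG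

namespace SzPar
variable (P : SzPar)

lemma slit_aux {x y : ℂ} (hx : 0 ≤ x.im) (hx0 : x ≠ 0) (hy : 0 < y.im) : x / y ∈ slitPlane := by
  have hy0 : y ≠ 0 := by rintro rfl; simp at hy
  by_contra h
  rw [mem_slitPlane_iff_not_le_zero, not_not] at h
  obtain ⟨h1, h2⟩ := Complex.le_def.1 h
  have e : x / y = ((x / y).re : ℂ) := by
    apply Complex.ext <;> simp [h2]
  have e2 : x = ((x / y).re : ℂ) * y := by rw [← e]; field_simp
  have h3 : x.im = (x / y).re * y.im := by
    conv_lhs => rw [e2]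
    simp
  simp only [Complex.zero_re] at h1
  have h4 : (x / y).re = 0 := by
    by_contra hne
    have : (x / y).re < 0 := lt_of_le_of_ne h1 hne
    nlinarith
  rw [h4] at e2
  exact hx0 (by simpa using e2)

lemma mem_Dw {z : ℂ} (him : z.im ≤ 0) (h1 : z ≠ 1) (h2 : z ≠ -1) : z - P.zm ∈ P.Dw := by
  have hs := P.hs
  have e1 : 1 - (z - P.zm) / (1 - P.zm) = (1 - z) / (1 - P.zm) := by
    have := P.one_sub_zm; field_simp; ring
  have e2 : 1 - (z - P.zm) / (-1 - P.zm) = (-1 - z) / (-1 - P.zm) := by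
    have := P.neg_one_sub_zm; field_simp; ring
  refine ⟨?_, ?_, ?_⟩
  · simp [zm]; linarith
  · rw [e1]
    refine slit_aux (by simpa using him) (fun h => h1 (sub_eq_zero.1 h).symm) (by simpa [zm] using hs)
  · rw [e2]
    refine slit_aux (by simpa using him) (fun h => h2 (sub_eq_zero.1 h).symm) (by simpa [zm] using hs)

lemma conj_zp : (starRingEnd ℂ) P.zp = P.zm := by
  simp [zp, zm]; ring

/-- strict negativity along the reflected arc -/
lemma Vw_neg {γ : ℝ → ℂ} (hγ : P.IsArc γ) {t0 : ℝ} (ht0 : t0 ∈ Ioo (0:ℝ) 1)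
    (him : ∀ t ∈ Icc (0:ℝ) t0, 0 ≤ (γ t).im) :
    (P.Vw ((starRingEnd ℂ) (γ t0) - P.zm)).re < 0 := by
  set w : ℝ → ℂ := fun t => (starRingEnd ℂ) (γ t) - P.zm with hw
  have hIcc : ∀ t ∈ Icc (0:ℝ) t0, t ∈ Icc (0:ℝ) 1 := fun t ht => ⟨ht.1, ht.2.trans ht0.2.le⟩
  have hcG : ∀ t ∈ Icc (0:ℝ) t0, (starRingEnd ℂ) (γ t) ∈ P.Gam := fun t ht =>
    P.Gam_conj (hγ.sub t (hIcc t ht))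
  have hwD : ∀ t ∈ Icc (0:ℝ) t0, w t ∈ P.Dw := by
    intro t ht
    have hg := P.Gam_H (hcG t ht)
    exact P.mem_Dw (by simpa using him t ht) hg.1 hg.2.1
  have hV : ∀ t ∈ Icc (0:ℝ) t0, (P.Vw (w t)).im = 0 ∧ (P.Vw (w t)).re ≤ 0 := by
    intro t ht
    rw [← P.mem_Gam_Vw (hwD t ht)]
    have e : P.zm + w t = (starRingEnd ℂ) (γ t) := by simp [hw]
    rw [e]; exact hcG t ht
  have hw0 : w 0 = 0 := by simp [hw, hγ.e0, P.conj_zp]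
  have hwne : ∀ t ∈ Ioc (0:ℝ) t0, w t ≠ 0 := by
    intro t ht h
    have h1 : (starRingEnd ℂ) (γ t) = (starRingEnd ℂ) (γ 0) := by
      rw [hγ.e0, P.conj_zp]; exact sub_eq_zero.1 h
    have h2 : γ t = γ 0 := (starRingEnd ℂ).injective h1
    have := hγ.inj ⟨ht.1.le, ht.2.trans ht0.2.le⟩ (by simp) h2
    linarith [ht.1]
  have hwder : ∀ t, HasDerivAt w ((starRingEnd ℂ) (deriv γ t)) t := by
    intro t
    have hd := (hγ.smooth.differentiable one_ne_zero t).hasDerivAt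
    exact (hd.star).sub_const _
  have hVder : ∀ t ∈ Icc (0:ℝ) t0, HasDerivAt (fun t => P.Vw (w t))
      (2 * w t ^ 2 * P.kw (w t) * P.Mw (w t) * (starRingEnd ℂ) (deriv γ t)) t :=
    fun t ht => (P.Vw_der (hwD t ht)).comp t (hwder t)
  have hfder : ∀ t ∈ Icc (0:ℝ) t0, HasDerivAt (fun t => (P.Vw (w t)).re)
      (2 * w t ^ 2 * P.kw (w t) * P.Mw (w t) * (starRingEnd ℂ) (deriv γ t)).re t :=
    fun t ht => Complex.reCLM.hasFDerivAt.comp_hasDerivAt t (hVder t ht)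
  have hgder : ∀ t ∈ Icc (0:ℝ) t0, HasDerivAt (fun t => (P.Vw (w t)).im)
      (2 * w t ^ 2 * P.kw (w t) * P.Mw (w t) * (starRingEnd ℂ) (deriv γ t)).im t :=
    fun t ht => Complex.imCLM.hasFDerivAt.comp_hasDerivAt t (hVder t ht)
  have hf0 : (P.Vw (w 0)).re = 0 := by rw [hw0]; simp [Vw]
  have rolle : ∀ t1 ∈ Ioc (0:ℝ) t0, (P.Vw (w t1)).re = 0 →
      ∃ t2 ∈ Ioo (0:ℝ) t1, P.kw (w t2) = 0 := by
    intro t1 ht1 h1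
    obtain ⟨t2, ht2, h2⟩ := exists_deriv_eq_zero (f := fun t => (P.Vw (w t)).re) ht1.1
      (fun t ht => (hfder t ⟨ht.1, ht.2.trans ht1.2⟩).continuousAt.continuousWithinAt) (by rw [hf0, h1])
    refine ⟨t2, ht2, ?_⟩
    have hm : t2 ∈ Icc (0:ℝ) t0 := ⟨ht2.1.le, ht2.2.le.trans ht1.2⟩
    rw [(hfder t2 hm).deriv] at h2
    have h3 : (2 * w t2 ^ 2 * P.kw (w t2) * P.Mw (w t2) * (starRingEnd ℂ) (deriv γ t2)).im = 0 := by
      rw [← (hgder t2 hm).deriv]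
      have : (fun t => (P.Vw (w t)).im) =ᶠ[𝓝 t2] fun _ => 0 := by
        filter_upwards [Ioo_mem_nhds ht2.1 (ht2.2.trans_le ht1.2)] with t ht
        exact (hV t ⟨ht.1.le, ht.2.le⟩).1
      rw [this.deriv_eq, deriv_const]
    have h4 : 2 * w t2 ^ 2 * P.kw (w t2) * P.Mw (w t2) * (starRingEnd ℂ) (deriv γ t2) = 0 :=
      Complex.ext h2 h3
    have hw2 := hwne t2 ⟨ht2.1, hm.2⟩
    have hM := P.Mw_ne (hwD t2 hm)
    have hr : (starRingEnd ℂ) (deriv γ t2) ≠ 0 := by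
      simpa using hγ.reg t2 (hIcc t2 hm)
    simpa [hw2, hM, hr] using h4
  by_contra hcon
  have hz0 : (P.Vw (w t0)).re = 0 := le_antisymm (hV t0 ⟨ht0.1.le, le_rfl⟩).2 (not_lt.1 hcon)
  have hkc : ContinuousAt (fun t => P.kw (w t)) 0 := by
    have h1 : ContinuousAt P.kw (w 0) := by rw [hw0]; exact (P.kw_der P.Dw_zero).continuousAt
    exact h1.comp (hwder 0).continuousAt
  have hk0 : P.kw (w 0) ≠ 0 := by rw [hw0]; exact P.kw_zero
  obtain ⟨η, hη, hηk⟩ := Metric.eventually_nhds_iff.1 (hkc.eventually_ne hk0)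
  set Z : Set ℝ := {t ∈ Icc (η / 2) t0 | (P.Vw (w t)).re = 0} with hZ
  have hη2 : ∀ t ∈ Ioc (0:ℝ) t0, P.kw (w t) = 0 → η / 2 ≤ t := by
    intro t ht hk
    by_contra hlt
    push Not at hlt
    refine hηk (y := t) ?_ hk
    rw [Real.dist_eq, sub_zero, abs_of_pos ht.1]; linarith
  have hZne : Z.Nonempty := by
    obtain ⟨t2, ht2, hk⟩ := rolle t0 ⟨ht0.1, le_rfl⟩ hz0
    refine ⟨t2, ⟨hη2 t2 ⟨ht2.1, ht2.2.le⟩ hk, ht2.2.le⟩, ?_⟩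
    simp [Vw, hk]
  have hZc : IsCompact Z := by
    have hco : ContinuousOn (fun t => (P.Vw (w t)).re) (Icc (η / 2) t0) := fun t ht =>
      (hfder t ⟨by linarith [ht.1], ht.2⟩).continuousAt.continuousWithinAt
    exact isCompact_Icc.of_isClosed_subset (hco.preimage_isClosed_of_isClosed isClosed_Icc
      (isClosed_singleton (x := (0:ℝ)))) (fun t ht => ht.1)
  obtain ⟨t1, ht1, hmin⟩ := hZc.exists_isLeast hZne
  obtain ⟨t2, ht2, hk⟩ := rolle t1 ⟨by linarith [ht1.1.1], ht1.1.2⟩ ht1.2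
  have hm2 : t2 ∈ Ioc (0:ℝ) t0 := ⟨ht2.1, ht2.2.le.trans ht1.1.2⟩
  have : t2 ∈ Z := ⟨⟨hη2 t2 hm2 hk, hm2.2⟩, by simp [Vw, hk]⟩
  linarith [hmin this, ht2.2]

end SzPar

namespace SzDat
variable (Q : SzDat)

/-- lower critical orthogonal trajectories -/
def OL : Set ℂ :=
  {z | z.im < 0 ∧ ∃ γ : ℝ → ℂ, ContDiff ℝ 1 γ ∧ γ 0 = Q.zm ∧ γ 1 = z ∧
    (∀ t ∈ Set.Ioc (0:ℝ) 1, (γ t).im < 0 ∧ γ t ∉ Q.GC) ∧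
    (∫ t in (0:ℝ)..1, Q.R (γ t) / ((γ t) ^ 2 - 1) * deriv γ t).im = 0}

lemma OL_nonneg {z : ℂ} (hz : z ∈ Q.OL) : 0 ≤ (Q.Vw (z - Q.zm)).re := by
  obtain ⟨-, γ, hγ, g0, g1, hav, hintg⟩ := hz
  have hγc := hγ.continuous
  set w : ℝ → ℂ := fun t => γ t - Q.zm with hw
  have hwc : Continuous w := hγc.sub continuous_const
  have hne : ∀ t ∈ Icc (0:ℝ) 1, (γ t).im < 0 := by
    intro t ht
    rcases ht.1.eq_or_lt with h | h
    · rw [← h, g0]; simpa [SzPar.zm] using Q.hs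
    · exact (hav t ⟨h, ht.2⟩).1
  have hne1 : ∀ t ∈ Icc (0:ℝ) 1, γ t ≠ 1 ∧ γ t ≠ -1 := by
    intro t ht
    have := hne t ht
    constructor <;> (intro h; rw [h] at this; simp at this)
  have hD : ∀ t ∈ Icc (0:ℝ) 1, w t ∈ Q.Dw := fun t ht =>
    Q.mem_Dw (hne t ht).le (hne1 t ht).1 (hne1 t ht).2
  set u : ℝ → ℂ := fun t => if t = 0 then 0 else Q.R (γ t) / Q.Sw (w t) with hu
  have husq : ∀ t ∈ Icc (0:ℝ) 1, u t ^ 2 = w t := by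
    intro t ht
    by_cases h : t = 0
    · subst h; simp [hu, hw, g0]
    · have htp : 0 < t := lt_of_le_of_ne ht.1 (Ne.symm h)
      have h1 : Q.R (γ t) ^ 2 = Q.p (γ t) := Q.Rsq _ (hav t ⟨htp, ht.2⟩).2
      have e : γ t = Q.zm + w t := by simp [hw]
      have h2 := Q.p_shift (w t)
      rw [← e, ← Q.Sw_sq (hD t ht)] at h2
      have := Q.Sw_ne (w t)
      simp only [hu, if_neg h, div_pow, h1, h2]
      field_simp
  have hucIoc : ∀ t ∈ Ioc (0:ℝ) 1, ContinuousAt u t := by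
    intro t ht
    have h1 : ContinuousAt (fun t => Q.R (γ t) / Q.Sw (w t)) t :=
      ((Q.Rdz (hav t ht).2).continuousAt.comp hγc.continuousAt).div
        ((Q.Sw_diff (hD t ⟨ht.1.le, ht.2⟩)).continuousAt.comp hwc.continuousAt) (Q.Sw_ne _)
    refine h1.congr ?_
    filter_upwards [isOpen_ne.mem_nhds ht.1.ne'] with x hx
    simp only [hu]; rw [if_neg hx]
  have huc : ContinuousOn u (Icc 0 1) := by
    intro t ht
    rcases ht.1.eq_or_lt with h | h
    · subst h
      have hu0 : u 0 = 0 := by simp [hu]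
      rw [ContinuousWithinAt, hu0, tendsto_zero_iff_norm_tendsto_zero]
      have h1 : Tendsto (fun t => Real.sqrt ‖w t‖) (𝓝[Icc 0 1] (0:ℝ)) (𝓝 0) := by
        have : ContinuousAt (fun t => Real.sqrt ‖w t‖) 0 :=
          (Real.continuous_sqrt.comp hwc.norm).continuousAt
        have h2 := this.tendsto
        simp only [hw, g0, sub_self, norm_zero, Real.sqrt_zero] at h2
        exact h2.mono_left nhdsWithin_le_nhds
      refine h1.congr' ?_
      filter_upwards [self_mem_nhdsWithin] with x hx
      rw [← husq x hx, norm_pow, Real.sqrt_sq (norm_nonneg _)]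
    · exact (hucIoc t ⟨h, ht.2⟩).continuousWithinAt
  set f : ℝ → ℂ := fun t => u t * Q.Sw (w t) / ((γ t) ^ 2 - 1) * deriv γ t with hf
  have hfc : ContinuousOn f (Icc 0 1) := by
    refine ((huc.mul ?_).div (by fun_prop) ?_).mul (hγ.continuous_deriv le_rfl).continuousOn
    · intro t ht
      exact ((Q.Sw_diff (hD t ht)).continuousAt.comp hwc.continuousAt).continuousWithinAt
    · intro t ht; exact sq_sub_one_ne (hne1 t ht).1 (hne1 t ht).2
  have hFc : ContinuousOn (fun t => u t ^ 3 * Q.kw (w t)) (Icc 0 1) := by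
    refine (huc.pow 3).mul ?_
    intro t ht
    exact ((Q.kw_der (hD t ht)).continuousAt.comp hwc.continuousAt).continuousWithinAt
  have hFd : ∀ t ∈ Ioo (0:ℝ) 1, HasDerivAt (fun t => u t ^ 3 * Q.kw (w t)) (f t) t := by
    intro t ht
    have htc : t ∈ Icc (0:ℝ) 1 := ⟨ht.1.le, ht.2.le⟩
    have hwd : HasDerivAt w (deriv γ t) t :=
      ((hγ.differentiable one_ne_zero t).hasDerivAt).sub_const _
    have hut : u t ≠ 0 := by
      simp only [hu, if_neg ht.1.ne']
      exact div_ne_zero (Q.R_ne (hav t ⟨ht.1, ht.2.le⟩).2) (Q.Sw_ne _)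
    have := Q.u3k_der hwd (hucIoc t ⟨ht.1, ht.2.le⟩) (by
      filter_upwards [Ioo_mem_nhds ht.1 ht.2] with x hx using husq x ⟨hx.1.le, hx.2.le⟩) hut (hD t htc)
    have e : Q.zm + w t = γ t := by simp [hw]
    rw [e] at this; exact this
  have hI := intervalIntegral.integral_eq_sub_of_hasDerivAt_of_le zero_le_one hFc hFd
    (hfc.intervalIntegrable_of_Icc zero_le_one)
  have hI2 : (∫ t in (0:ℝ)..1, Q.R (γ t) / ((γ t) ^ 2 - 1) * deriv γ t) = ∫ t in (0:ℝ)..1, f t := by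
    apply intervalIntegral.integral_congr_ae
    refine Filter.Eventually.of_forall ?_
    intro t ht
    rw [uIoc_of_le zero_le_one] at ht
    have := Q.Sw_ne (w t)
    simp only [hf, hu, if_neg ht.1.ne']
    field_simp
  rw [hI2, hI] at hintg
  have hu0 : u 0 = 0 := by simp [hu]
  simp only [hu0] at hintg
  have hintg' : (u 1 ^ 3 * Q.kw (w 1)).im = 0 := by simpa using hintg
  have hVe : Q.Vw (w 1) = (u 1 ^ 3 * Q.kw (w 1)) ^ 2 := by
    have := husq 1 (by simp)
    unfold SzPar.Vw
    rw [← this]; ring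
  have e1 : w 1 = z - Q.zm := by simp [hw, g1]
  rw [← e1, hVe, pow_two, Complex.mul_re, hintg']
  nlinarith [mul_self_nonneg (u 1 ^ 3 * Q.kw (w 1)).re]

lemma OL_avoid {γ : ℝ → ℂ} (hγ : Q.IsArc γ) {t0 : ℝ} (ht0 : t0 ∈ Ioo (0:ℝ) 1)
    (him : (γ t0).im < 0 ∨ ∀ t ∈ Icc (0:ℝ) t0, 0 ≤ (γ t).im) :
    ∀ᶠ z in 𝓝 (γ t0), (starRingEnd ℂ) z ∉ Q.OL := by
  rcases him with h | h
  · filter_upwards [(isOpen_lt Complex.continuous_im continuous_const).mem_nhds h] with z hz hzO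
    have h1 := hzO.1
    have h2 : z.im < 0 := hz
    simp at h1; linarith
  · have hneg := Q.Vw_neg hγ ht0 h
    have hcG := Q.Gam_H (Q.Gam_conj (hγ.sub t0 ⟨ht0.1.le, ht0.2.le⟩))
    have hD : (starRingEnd ℂ) (γ t0) - Q.zm ∈ Q.Dw :=
      Q.mem_Dw (by simpa using h t0 ⟨ht0.1.le, le_rfl⟩) hcG.1 hcG.2.1
    have hc : ContinuousAt (fun z => (Q.Vw ((starRingEnd ℂ) z - Q.zm)).re) (γ t0) := by
      have h1 : ContinuousAt (fun z => (starRingEnd ℂ) z - Q.zm) (γ t0) :=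
        (Complex.continuous_conj.sub continuous_const).continuousAt
      have h2 : ContinuousAt Q.Vw ((starRingEnd ℂ) (γ t0) - Q.zm) := (Q.Vw_der hD).continuousAt
      exact Complex.continuous_re.continuousAt.comp
        (ContinuousAt.comp (f := fun z => (starRingEnd ℂ) z - Q.zm) h2 h1)
    filter_upwards [hc.eventually_lt_const hneg] with z hz hzO
    have := Q.OL_nonneg hzO
    linarith

end SzDat

/-- sign of the real part along a transversal direction -/
lemma dir_side {Φ : ℂ → ℂ} {D z v : ℂ} {σ : ℝ} (hΦ : HasDerivAt Φ D z) (h0 : (Φ z).re = 0)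
    (hv : 0 < σ * (D * v).re) {N : Set ℂ} (hN : N ∈ 𝓝 z) :
    (∀ᶠ ε : ℝ in 𝓝[>] 0, z + (ε:ℂ) * v ∈ N ∧ 0 < σ * (Φ (z + (ε:ℂ) * v)).re) ∧
    (∀ᶠ ε : ℝ in 𝓝[<] 0, z + (ε:ℂ) * v ∈ N ∧ 0 < (-σ) * (Φ (z + (ε:ℂ) * v)).re) := by
  have hl : HasDerivAt (fun ε : ℝ => z + (ε:ℂ) * v) v 0 := by
    have h1 : HasDerivAt (fun ε : ℝ => (ε:ℂ)) 1 0 := Complex.ofRealCLM.hasDerivAt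
    simpa using (h1.mul_const v).const_add z
  have hz : z + ((0:ℝ):ℂ) * v = z := by simp
  have h1 : HasDerivAt (fun ε : ℝ => Φ (z + (ε:ℂ) * v)) (D * v) 0 :=
    HasDerivAt.comp (h₂ := Φ) (h := fun ε : ℝ => z + (ε:ℂ) * v) (0:ℝ) (by rw [hz]; exact hΦ) hl
  have h2 : HasDerivAt (fun ε : ℝ => (Φ (z + (ε:ℂ) * v)).re) (D * v).re 0 :=
    Complex.reCLM.hasFDerivAt.comp_hasDerivAt (0:ℝ) h1
  have h3 := (hasDerivAt_iff_tendsto_slope.1 (h2.const_mul σ)).eventually_const_lt hv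
  have hNe : ∀ᶠ ε : ℝ in 𝓝 0, z + (ε:ℂ) * v ∈ N := by
    have : Tendsto (fun ε : ℝ => z + (ε:ℂ) * v) (𝓝 0) (𝓝 z) := by
      have := hl.continuousAt.tendsto; rwa [hz] at this
    exact this hN
  have key : ∀ ε : ℝ, 0 < slope (fun ε : ℝ => σ * (Φ (z + (ε:ℂ) * v)).re) 0 ε →
      0 < (σ * (Φ (z + (ε:ℂ) * v)).re) / ε := by
    intro ε h
    rw [slope_def_field] at h
    simpa [h0] using h
  constructor
  · have h4 : 𝓝[>] (0:ℝ) ≤ 𝓝[≠] 0 := nhdsWithin_mono _ (fun x hx => ne_of_gt hx)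
    filter_upwards [h4 h3, nhdsWithin_le_nhds hNe, self_mem_nhdsWithin] with ε a b c
    exact ⟨b, (div_pos_iff_of_pos_right c).1 (key ε a)⟩
  · have h4 : 𝓝[<] (0:ℝ) ≤ 𝓝[≠] 0 := nhdsWithin_mono _ (fun x hx => ne_of_lt hx)
    filter_upwards [h4 h3, nhdsWithin_le_nhds hNe, self_mem_nhdsWithin] with ε a b c
    refine ⟨b, ?_⟩
    have h5 := key ε a
    have hc : ε < 0 := c
    rcases div_pos_iff.1 h5 with h6 | h6
    · linarith [h6.2]
    · linarith [h6.1]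

namespace SzDat
variable (Q : SzDat)

structure GArc (γ : ℝ → ℂ) (τ : ℝ) : Prop where
  arc : Q.IsArc γ
  tau : τ = 1 ∨ τ = -1
  uniq : ∀ t ∈ Icc (0:ℝ) 1, ∀ t' ∈ Icc (0:ℝ) 1, (γ t).im = 0 → (γ t').im = 0 → t = t'
  side : ∀ t ∈ Icc (0:ℝ) 1, (γ t).im = 0 →
    ∀ᶠ δ : ℝ in 𝓝[>] 0, (((γ t).re + τ * δ : ℝ) : ℂ) ∈ Q.Un

lemma real_eq {z : ℂ} (h : z.im = 0) : ((z.re : ℝ) : ℂ) = z := by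
  apply Complex.ext <;> simp [h]

lemma uniq_of {γ : ℝ → ℂ} (hγ : Q.IsArc γ) {S : Set ℝ} (hS : InjOn Q.eta S)
    (hm : ∀ t ∈ Icc (0:ℝ) 1, (γ t).im = 0 → (γ t).re ∈ S) :
    ∀ t ∈ Icc (0:ℝ) 1, ∀ t' ∈ Icc (0:ℝ) 1, (γ t).im = 0 → (γ t').im = 0 → t = t' := by
  intro t ht t' ht' h h'
  have g := hγ.sub t ht
  have g' := hγ.sub t' ht'
  rw [← real_eq h] at g
  rw [← real_eq h'] at g'
  have := hS (hm t ht h) (hm t' ht' h') ((Q.eta_zero g).trans (Q.eta_zero g').symm)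
  apply hγ.inj ht ht'
  rw [← real_eq h, ← real_eq h', this]

lemma garc_L : Q.GArc Q.gL 1 where
  arc := Q.aL
  tau := Or.inl rfl
  uniq := Q.uniq_of Q.aL Q.eta_mono_l.injOn Q.crossL
  side := by
    intro t ht h
    have h1 := Q.crossL t ht h
    have g := Q.aL.sub t ht
    rw [← real_eq h] at g
    filter_upwards [Ioo_mem_nhdsGT (show (0:ℝ) < -1 - (Q.gL t).re by linarith)] with δ hδ
    exact Q.side_L g (by linarith [hδ.1]) (by linarith [hδ.2])

lemma garc_C : Q.GArc Q.gC 1 where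
  arc := Q.aC
  tau := Or.inl rfl
  uniq := Q.uniq_of Q.aC Q.eta_anti.injOn Q.crossC
  side := by
    intro t ht h
    have h1 := Q.crossC t ht h
    have g : (((Q.gC t).re : ℝ) : ℂ) ∈ Q.GC := by rw [real_eq h]; exact ⟨t, ht, rfl⟩
    filter_upwards [Ioo_mem_nhdsGT (show (0:ℝ) < 1 - (Q.gC t).re by linarith [h1.2])] with δ hδ
    exact Q.side_C g (by linarith [hδ.1]) (by linarith [hδ.2])

lemma garc_R : Q.GArc Q.gR (-1) where
  arc := Q.aR
  tau := Or.inr rfl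
  uniq := Q.uniq_of Q.aR Q.eta_mono_r.injOn Q.crossR
  side := by
    intro t ht h
    have h1 := Q.crossR t ht h
    have g := Q.aR.sub t ht
    rw [← real_eq h] at g
    filter_upwards [Ioo_mem_nhdsGT (show (0:ℝ) < (Q.gR t).re - 1 by linarith)] with δ hδ
    exact Q.side_R g (by linarith [hδ.1]) (by linarith [hδ.2])

variable {Q}
lemma GArc.cross {γ : ℝ → ℂ} {τ : ℝ} (hγ : Q.GArc γ τ) : ∃ tx ∈ Ioo (0:ℝ) 1, (γ tx).im = 0 ∧
    ∀ t ∈ Icc (0:ℝ) 1, (t < tx → 0 < (γ t).im) ∧ (tx < t → (γ t).im < 0) := by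
  have hs := Q.hs
  have hc : Continuous fun t => (γ t).im := Complex.continuous_im.comp hγ.arc.smooth.continuous
  have h0 : 0 < (γ 0).im := by rw [hγ.arc.e0]; simpa [SzPar.zp] using hs
  have h1 : (γ 1).im < 0 := by rw [hγ.arc.e1]; simpa [SzPar.zm] using hs
  obtain ⟨tx, htx, hx⟩ := intermediate_value_Ioo' (zero_le_one' ℝ) hc.continuousOn ⟨h1, h0⟩
  refine ⟨tx, htx, hx, ?_⟩
  have htx' : tx ∈ Icc (0:ℝ) 1 := ⟨htx.1.le, htx.2.le⟩
  intro t ht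
  constructor
  · intro hlt
    by_contra hcon
    push Not at hcon
    obtain ⟨y, hy, hy0⟩ := intermediate_value_Icc' ht.1 hc.continuousOn ⟨hcon, h0.le⟩
    have := hγ.uniq y ⟨hy.1, hy.2.trans ht.2⟩ tx htx' hy0 hx
    linarith [hy.2]
  · intro hlt
    by_contra hcon
    push Not at hcon
    obtain ⟨y, hy, hy0⟩ := intermediate_value_Icc' ht.2 hc.continuousOn ⟨h1.le, hcon⟩
    have := hγ.uniq y ⟨ht.1.trans hy.1, hy.2⟩ tx htx' hy0 hx
    linarith [hy.1]

lemma GArc.avoid {γ : ℝ → ℂ} {τ : ℝ} (hγ : Q.GArc γ τ) {t0 : ℝ} (ht0 : t0 ∈ Ioo (0:ℝ) 1) :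
    ∀ᶠ z in 𝓝 (γ t0), (starRingEnd ℂ) z ∉ Q.OL := by
  obtain ⟨tx, htx, hx, hs⟩ := hγ.cross
  apply Q.OL_avoid hγ.arc ht0
  rcases lt_or_ge tx t0 with h | h
  · exact Or.inl ((hs t0 ⟨ht0.1.le, ht0.2.le⟩).2 h)
  · right
    intro t ht
    rcases (ht.2.trans h).eq_or_lt with h2 | h2
    · rw [h2, hx]
    · exact ((hs t ⟨ht.1, ht.2.trans ht0.2.le⟩).1 h2).le

lemma arc_p_ne' {γ : ℝ → ℂ} (hγ : Q.IsArc γ) {t : ℝ} (ht : t ∈ Ioo (0:ℝ) 1) : Q.p (γ t) ≠ 0 := by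
  intro h
  rcases Q.p_eq_zero h with h | h
  · rw [← hγ.e0] at h
    have := hγ.inj ⟨ht.1.le, ht.2.le⟩ (by simp) h
    linarith [ht.1]
  · rw [← hγ.e1] at h
    have := hγ.inj ⟨ht.1.le, ht.2.le⟩ (by simp) h
    linarith [ht.2]

/-- the tangential derivative is purely imaginary -/
lemma loc_m {z0 : ℂ} {N : Set ℂ} {r Φ : ℂ → ℂ} (L : Q.Loc z0 N r Φ) {γ : ℝ → ℂ} (hγ : Q.IsArc γ)
    {t : ℝ} (ht : t ∈ Ioo (0:ℝ) 1) (hN : γ t ∈ N) :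
    (r (γ t) / (γ t ^ 2 - 1) * deriv γ t).re = 0 ∧ (r (γ t) / (γ t ^ 2 - 1) * deriv γ t).im ≠ 0 := by
  have hd := (hγ.smooth.differentiable one_ne_zero t).hasDerivAt
  have h1 : HasDerivAt (fun t => Φ (γ t)) (r (γ t) / (γ t ^ 2 - 1) * deriv γ t) t :=
    (L.der _ hN).comp t hd
  have h2 : HasDerivAt (fun t => (Φ (γ t)).re) (r (γ t) / (γ t ^ 2 - 1) * deriv γ t).re t :=
    Complex.reCLM.hasFDerivAt.comp_hasDerivAt t h1
  have h3 : (fun t => (Φ (γ t)).re) =ᶠ[𝓝 t] fun _ => 0 := by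
    filter_upwards [hd.continuousAt (L.op.mem_nhds hN), Ioo_mem_nhds ht.1 ht.2] with x hx hx1
    exact (loc_notMem L hx).1 (hγ.sub x ⟨hx1.1.le, hx1.2.le⟩)
  have h4 : (r (γ t) / (γ t ^ 2 - 1) * deriv γ t).re = 0 := by
    rw [← h2.deriv, h3.deriv_eq, deriv_const]
  refine ⟨h4, fun h5 => ?_⟩
  have h6 : r (γ t) / (γ t ^ 2 - 1) * deriv γ t = 0 := Complex.ext h4 h5
  have hr : r (γ t) ≠ 0 := by
    intro h
    have := L.sq _ hN
    rw [h] at this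
    exact arc_p_ne' hγ ht (by rw [← this]; simp)
  rcases mul_eq_zero.1 h6 with h | h
  · exact div_ne_zero hr (sq_sub_one_ne (L.ne _ hN).1 (L.ne _ hN).2) h
  · exact hγ.reg t ⟨ht.1.le, ht.2.le⟩ h

/-- the chart at a point of an arc with a definite sign on the plus side -/
lemma GArc.chart {γ : ℝ → ℂ} {τ : ℝ} (hγ : Q.GArc γ τ) {t0 : ℝ} (ht0 : t0 ∈ Ioo (0:ℝ) 1)
    {O : Set ℂ} (hO : IsOpen O) (hO0 : γ t0 ∈ O) :
    ∃ N r Φ, N ⊆ O ∧ Q.Loc (γ t0) N r Φ ∧ ∃ σ : ℝ, (σ = 1 ∨ σ = -1) ∧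
      ∀ᶠ t in 𝓝 t0, t ∈ Ioo (0:ℝ) 1 ∧ γ t ∈ N ∧ (Φ (γ t)).re = 0 ∧
        (∀ᶠ ε : ℝ in 𝓝[>] 0, γ t + (ε:ℂ) * (I * (τ * deriv γ t)) ∈
          {z ∈ N | 0 < σ * (Φ z).re}) ∧
        (∀ᶠ ε : ℝ in 𝓝[<] 0, γ t + (ε:ℂ) * (I * (τ * deriv γ t)) ∈
          {z ∈ N | 0 < (-σ) * (Φ z).re}) := by
  obtain ⟨N, r, Φ, hNO, L⟩ := Q.exists_loc (hγ.arc.sub t0 ⟨ht0.1.le, ht0.2.le⟩) (arc_p_ne' hγ.arc ht0)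
    hO hO0
  refine ⟨N, r, Φ, hNO, L, ?_⟩
  have hγc := hγ.arc.smooth.continuous
  set m : ℝ → ℝ := fun t => -(τ * (r (γ t) / (γ t ^ 2 - 1) * deriv γ t).im) with hm
  have hmc : ContinuousAt m t0 := by
    have h1 : ContinuousAt (fun t => r (γ t)) t0 :=
      ContinuousAt.comp (g := r) (f := γ) (L.cont.continuousAt (L.op.mem_nhds L.mem)) hγc.continuousAt
    have h2 : ContinuousAt (fun t => r (γ t) / (γ t ^ 2 - 1) * deriv γ t) t0 :=
      (h1.div (by fun_prop) (sq_sub_one_ne (L.ne _ L.mem).1 (L.ne _ L.mem).2)).mul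
        (hγ.arc.smooth.continuous_deriv le_rfl).continuousAt
    exact (continuousAt_const.mul (Complex.continuous_im.continuousAt.comp h2)).neg
  have hm0 : m t0 ≠ 0 := by
    have h1 := (loc_m L hγ.arc ht0 L.mem).2
    simp only [hm]
    rcases hγ.tau with h | h <;> rw [h] <;> intro hh <;> apply h1 <;> linarith
  obtain ⟨σ, hσ, hσm⟩ : ∃ σ : ℝ, (σ = 1 ∨ σ = -1) ∧ 0 < σ * m t0 := by
    rcases lt_or_gt_of_ne hm0 with h | h
    · exact ⟨-1, Or.inr rfl, by linarith⟩
    · exact ⟨1, Or.inl rfl, by linarith⟩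
  refine ⟨σ, hσ, ?_⟩
  filter_upwards [Ioo_mem_nhds ht0.1 ht0.2, hγc.continuousAt (L.op.mem_nhds L.mem),
    (continuousAt_const.mul hmc).eventually_const_lt hσm] with t a b c
  have hre := (loc_notMem L b).1 (hγ.arc.sub t ⟨a.1.le, a.2.le⟩)
  have hside := dir_side (σ := σ) (v := I * (τ * deriv γ t)) (L.der _ b) hre (by
    have e : (r (γ t) / (γ t ^ 2 - 1) * (I * (τ * deriv γ t))).re = m t := by
      have : r (γ t) / (γ t ^ 2 - 1) * (I * (τ * deriv γ t)) =
        (τ:ℂ) * (I * (r (γ t) / (γ t ^ 2 - 1) * deriv γ t)) := by ring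
      rw [this, Complex.re_ofReal_mul, Complex.I_mul_re]; simp only [hm]; ring
    rw [e]; exact c) (L.op.mem_nhds b)
  exact ⟨a, b, hre, hside.1, hside.2⟩

lemma loc_side_sub {z0 : ℂ} {N : Set ℂ} {r Φ : ℂ → ℂ} (L : Q.Loc z0 N r Φ) (σ : ℝ) :
    {z ∈ N | 0 < σ * (Φ z).re} ⊆ Q.Gamᶜ := by
  rintro z ⟨hz, h⟩ hG
  rw [(loc_notMem L hz).1 hG] at h; simp at h

/-- near the crossing of the real line -/
lemma GArc.at_cross {γ : ℝ → ℂ} {τ : ℝ} (hγ : Q.GArc γ τ) {t : ℝ} (ht : t ∈ Ioo (0:ℝ) 1)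
    (hx : (γ t).im = 0) (hs : ∀ t' ∈ Icc (0:ℝ) 1, (t' < t → 0 < (γ t').im) ∧ (t < t' → (γ t').im < 0)) :
    ∀ᶠ ε : ℝ in 𝓝[>] 0, γ t + (ε:ℂ) * (I * (τ * deriv γ t)) ∈ Q.Un := by
  have htc : t ∈ Icc (0:ℝ) 1 := ⟨ht.1.le, ht.2.le⟩
  obtain ⟨N, r, Φ, -, L⟩ := Q.exists_loc (hγ.arc.sub t htc) (arc_p_ne' hγ.arc ht)
    isOpen_univ (mem_univ _)
  have hm := loc_m L hγ.arc ht L.mem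
  set x := (γ t).re with hxd
  have hxe : ((x:ℝ):ℂ) = γ t := real_eq hx
  -- `r` is real at the crossing
  obtain ⟨y, hy⟩ : ∃ y : ℝ, r (γ t) = y := by
    have h1 := L.sq _ L.mem
    rw [← hxe, ← Q.sqrt_p x] at h1
    rw [hxe] at h1
    rcases sq_eq_sq_iff_eq_or_eq_neg.1 h1 with h | h
    · exact ⟨_, h⟩
    · exact ⟨-Real.sqrt ((x - Q.c) ^ 2 + Q.s ^ 2), by rw [h]; push_cast; rfl⟩
  have e1 : r (γ t) / (γ t ^ 2 - 1) = ((y / (x ^ 2 - 1) : ℝ) : ℂ) := by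
    rw [hy, ← hxe]; push_cast; rfl
  rw [e1, Complex.re_ofReal_mul, Complex.im_ofReal_mul] at hm
  have hre : (deriv γ t).re = 0 := by
    rcases mul_eq_zero.1 hm.1 with h | h
    · exact absurd (by rw [h]; simp) hm.2
    · exact h
  have hne : (deriv γ t).im ≠ 0 := fun h => hm.2 (by rw [h]; simp)
  have hd := (hγ.arc.smooth.differentiable one_ne_zero t).hasDerivAt
  have hdi : HasDerivAt (fun t => (γ t).im) (deriv γ t).im t :=
    Complex.imCLM.hasFDerivAt.comp_hasDerivAt t hd
  have hle : (deriv γ t).im ≤ 0 := by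
    by_contra hcon
    push Not at hcon
    have h3 := (hasDerivAt_iff_tendsto_slope.1 hdi).eventually_const_lt hcon
    have h4 : 𝓝[>] t ≤ 𝓝[≠] t := nhdsWithin_mono _ (fun x hx => ne_of_gt hx)
    have h3' : ∀ᶠ x in 𝓝[>] t, 0 < slope (fun t => (γ t).im) t x := h4 h3
    have h3'' : ∀ᶠ x in 𝓝[>] t, x ∈ Ioo t 1 := Ioo_mem_nhdsGT ht.2
    obtain ⟨t', a, b⟩ := (h3'.and h3'').exists
    have h5 := (hs t' ⟨by linarith [b.1, ht.1], b.2.le⟩).2 b.1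
    have a' : 0 < slope (fun t => (γ t).im) t t' := a
    rw [slope_def_field, hx, sub_zero, div_pos_iff_of_pos_right (by linarith [b.1])] at a'
    linarith
  set q : ℝ := -(deriv γ t).im with hq
  have hqp : 0 < q := by rcases hle.lt_or_eq with h | h; · linarith
                         · exact absurd h hne
  have e2 : I * (τ * deriv γ t) = ((τ * q : ℝ) : ℂ) := by
    apply Complex.ext <;> simp [hq, hre]
  have ht0 : Tendsto (fun ε : ℝ => q * ε) (𝓝[>] 0) (𝓝[>] 0) := by
    apply tendsto_nhdsWithin_of_tendsto_nhds_of_eventually_within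
    · have : ContinuousAt (fun ε : ℝ => q * ε) 0 := by fun_prop
      have h := this.tendsto; simp only [mul_zero] at h
      exact h.mono_left nhdsWithin_le_nhds
    · filter_upwards [self_mem_nhdsWithin] with ε hε using mul_pos hqp hε
  filter_upwards [ht0.eventually (hγ.side t htc hx)] with ε hε
  rw [e2, ← hxe]
  convert hε using 1
  push_cast; ring

/-- the plus side of every arc lies in the region with negative `h` -/
lemma GArc.plus {γ : ℝ → ℂ} {τ : ℝ} (hγ : Q.GArc γ τ) {t : ℝ} (ht : t ∈ Ioo (0:ℝ) 1) :
    ∀ᶠ ε : ℝ in 𝓝[>] 0, γ t + (ε:ℂ) * (I * (τ * deriv γ t)) ∈ Q.Un := by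
  obtain ⟨tx, htx, hx, hs⟩ := hγ.cross
  set S : Set ℝ := {t | ∀ᶠ ε : ℝ in 𝓝[>] 0, γ t + (ε:ℂ) * (I * (τ * deriv γ t)) ∈ Q.Un} with hS
  have hloc : ∀ t0 ∈ Ioo (0:ℝ) 1, (∀ᶠ t in 𝓝 t0, t ∈ S) ∨ (∀ᶠ t in 𝓝 t0, t ∉ S) := by
    intro t0 ht0
    obtain ⟨N, r, Φ, -, L, σ, hσ, hev⟩ := hγ.chart ht0 isOpen_univ (mem_univ _)
    have hσ0 : σ ≠ 0 := by rcases hσ with h | h <;> rw [h] <;> norm_num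
    by_cases hU : {z ∈ N | 0 < σ * (Φ z).re} ⊆ Q.Un
    · left
      filter_upwards [hev] with t h
      exact h.2.2.2.1.mono (fun ε hε => hU hε)
    · right
      filter_upwards [hev] with t h hts
      apply hU
      obtain ⟨ε, h1, h2⟩ := (h.2.2.2.1.and hts).exists
      exact Q.sub_of_mem_Un (L.pc σ hσ0) (loc_side_sub L σ) h1 h2
  have hsub : Ioo (0:ℝ) 1 ⊆ interior S := by
    refine isPreconnected_Ioo.subset_left_of_subset_union (v := interior Sᶜ) isOpen_interior isOpen_interior ?_ ?_ ?_
    · exact Disjoint.mono interior_subset interior_subset disjoint_compl_right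
    · intro t0 ht0
      rcases hloc t0 ht0 with h | h
      · left; exact mem_interior_iff_mem_nhds.2 h
      · right; exact mem_interior_iff_mem_nhds.2 h
    · refine ⟨tx, htx, ?_⟩
      rcases hloc tx htx with h | h
      · exact mem_interior_iff_mem_nhds.2 h
      · exact absurd (hγ.at_cross htx hx hs) h.self_of_nhds
  have hmem : t ∈ S := interior_subset (hsub ht)
  exact hmem

end SzDat

/-- boundary values inherit a limit -/
lemma bdry_lim {f : ℂ → ℂ} {S : Set ℂ} {z1 ℓ : ℂ} (hf : Tendsto f (𝓝[S] z1) (𝓝 ℓ))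
    {l : Filter ℝ} {γ Lf : ℝ → ℂ} (hγ : Tendsto γ l (𝓝 z1)) {F : ℝ → Filter ℝ} {pt : ℝ → ℝ → ℂ}
    (hne : ∀ t, (F t).NeBot)
    (h : ∀ᶠ t in l, Tendsto (pt t) (F t) (𝓝 (γ t)) ∧ (∀ᶠ ε in F t, pt t ε ∈ S) ∧
      Tendsto (fun ε => f (pt t ε)) (F t) (𝓝 (Lf t))) : Tendsto Lf l (𝓝 ℓ) := by
  rw [(Metric.nhds_basis_closedBall).tendsto_right_iff]
  intro ε hε
  have h1 : ∀ᶠ z in 𝓝[S] z1, f z ∈ Metric.closedBall ℓ ε := hf (Metric.closedBall_mem_nhds ℓ hε)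
  obtain ⟨O, hO, hzO, hsub⟩ := mem_nhdsWithin.1 h1
  filter_upwards [h, hγ (hO.mem_nhds hzO)] with t ⟨a, b, c⟩ d
  have := hne t
  refine Metric.isClosed_closedBall.mem_of_tendsto c ?_
  filter_upwards [a (hO.mem_nhds d), b] with e he1 he2
  exact hsub ⟨he1, he2⟩

lemma log_near {L : ℝ → ℂ} {v : ℝ → ℂ} {t0 : ℝ} (hL : ContinuousAt L t0)
    (hv : ∀ᶠ t in 𝓝 t0, Complex.exp (L t) = v t) :
    ∀ᶠ t in 𝓝 t0, L t = L t0 + Complex.log (v t / v t0) := by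
  have hc : ContinuousAt (fun t => (L t - L t0).im) t0 :=
    Complex.continuous_im.continuousAt.comp (hL.sub continuousAt_const)
  have h1 : ∀ᶠ t in 𝓝 t0, (L t - L t0).im ∈ Ioo (-Real.pi) Real.pi := by
    apply hc
    apply Ioo_mem_nhds <;> simp [Real.pi_pos]
  filter_upwards [h1, hv] with t h2 h3
  rw [← h3, ← hv.self_of_nhds, ← Complex.exp_sub, Complex.log_exp h2.1 h2.2.le]
  ring

namespace SzG
variable (T : SzG)

lemma side_open {z0 : ℂ} {N : Set ℂ} {r Φ : ℂ → ℂ} (L : T.Loc z0 N r Φ) (σ : ℝ) :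
    IsOpen {z ∈ N | 0 < σ * (Φ z).re} := by
  have h1 : ContinuousOn (fun z => σ * (Φ z).re) N := fun z hz =>
    (continuousAt_const.mul
      (Complex.continuous_re.continuousAt.comp (L.der z hz).continuousAt)).continuousWithinAt
  have := h1.isOpen_inter_preimage L.op (isOpen_Ioi (a := (0:ℝ)))
  exact this

lemma side_G {z0 : ℂ} {N : Set ℂ} {r Φ : ℂ → ℂ} (L : T.Loc z0 N r Φ) {σ : ℝ}
    (hσ : σ = 1 ∨ σ = -1) {la lb : ℂ → ℂ} (hla : ∀ z ∈ N, HasDerivAt la (1 / (z - 1)) z)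
    (hlb : ∀ z ∈ N, HasDerivAt lb (1 / (z + 1)) z) :
    ∃ K : ℂ, K ≠ 0 ∧ ∀ z ∈ {z ∈ N | 0 < σ * (Φ z).re},
      T.G z = K * Complex.exp ((σ:ℂ) * (T.c0 * Φ z) + T.c0 * T.a * la z + T.c0 * T.b * lb z) := by
  set E : ℂ → ℂ := fun z => (σ:ℂ) * (T.c0 * Φ z) + T.c0 * T.a * la z + T.c0 * T.b * lb z with hE
  set S : Set ℂ := {z ∈ N | 0 < σ * (Φ z).re} with hS
  have hσ0 : σ ≠ 0 := by rcases hσ with h | h <;> rw [h] <;> norm_num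
  have hW : ∀ z ∈ S, z ∈ T.W := fun z hz =>
    ⟨SzDat.loc_side_sub L σ hz, L.ne z hz.1⟩
  have hd : ∀ z ∈ S, HasDerivAt (fun z => T.G z * Complex.exp (-E z)) 0 z := by
    intro z hz
    have h1 := T.G_hasDerivAt (hW z hz)
    have h2 : HasDerivAt E ((σ:ℂ) * (T.c0 * (r z / (z ^ 2 - 1))) + T.c0 * T.a * (1 / (z - 1))
        + T.c0 * T.b * (1 / (z + 1))) z :=
      ((((L.der z hz.1).const_mul (T.c0:ℂ)).const_mul (σ:ℂ)).add
        ((hla z hz.1).const_mul _)).add ((hlb z hz.1).const_mul _)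
    have h3 := h1.mul h2.neg.cexp
    rw [SzDat.loc_gd L hz.1 hσ hz.2] at h3
    refine HasDerivAt.congr_deriv h3 ?_
    simp only [Pi.neg_apply]
    ring
  have hso := T.side_open L σ
  obtain ⟨K, hK⟩ := hso.exists_is_const_of_deriv_eq_zero (L.pc σ hσ0)
    (fun z hz => (hd z hz).differentiableAt.differentiableWithinAt)
    (fun z hz => (hd z hz).deriv)
  have hKG : ∀ z ∈ S, T.G z = K * Complex.exp (E z) := by
    intro z hz
    rw [← hK z hz, mul_assoc, ← Complex.exp_add]; simp
  refine ⟨K, ?_, hKG⟩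
  obtain ⟨w, -, hw⟩ := mem_closure_iff_nhds.1 (L.cl σ hσ0 z0 L.mem (by rw [L.zero]; simp)) univ
    univ_mem
  intro h
  have := hKG w hw
  rw [h, zero_mul] at this
  exact T.G_ne (hW w hw) this

lemma side_phi {z0 : ℂ} {N : Set ℂ} {r Φ : ℂ → ℂ} (L : T.Loc z0 N r Φ) {σ : ℝ}
    (hσ : σ = 1 ∨ σ = -1) (hUn : {z ∈ N | 0 < σ * (Φ z).re} ⊆ T.Un) {φ : ℂ → ℂ}
    (hφ : ∀ z ∈ {z ∈ N | 0 < σ * (Φ z).re}, HasDerivAt φ (T.c0 * (T.R z / (z ^ 2 - 1))) z) :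
    ∃ C : ℂ, ∀ z ∈ {z ∈ N | 0 < σ * (Φ z).re}, φ z = C - (σ:ℂ) * (T.c0 * Φ z) := by
  set S : Set ℂ := {z ∈ N | 0 < σ * (Φ z).re} with hS
  have hσ0 : σ ≠ 0 := by rcases hσ with h | h <;> rw [h] <;> norm_num
  have hd : ∀ z ∈ S, HasDerivAt (fun z => φ z + (σ:ℂ) * (T.c0 * Φ z)) 0 z := by
    intro z hz
    have h1 := hφ z hz
    have hh : T.h z < 0 := by
      rcases (hUn hz).2 with h | h | h
      · exact absurd h (L.ne z hz.1).1
      · exact absurd h (L.ne z hz.1).2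
      · exact h
    rw [SzDat.loc_R_neg L hz.1 hσ hz.2 hh] at h1
    refine HasDerivAt.congr_deriv (h1.add (((L.der z hz.1).const_mul (T.c0:ℂ)).const_mul (σ:ℂ))) ?_
    ring
  obtain ⟨C, hC⟩ := (T.side_open L σ).exists_is_const_of_deriv_eq_zero (L.pc σ hσ0)
    (fun z hz => (hd z hz).differentiableAt.differentiableWithinAt)
    (fun z hz => (hd z hz).deriv)
  exact ⟨C, fun z hz => by rw [← hC z hz]; ring⟩

/-- the excluded set of `φ` -/
def Ex : Set ℂ := T.GC ∪ {z | (starRingEnd ℂ) z ∈ T.OL} ∪ {(1:ℂ), -1}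

/-- point on the normal -/
def pt (γ : ℝ → ℂ) (τ t ε : ℝ) : ℂ := γ t + (ε:ℂ) * (I * (τ * deriv γ t))

lemma pt_tendsto (γ : ℝ → ℂ) (τ t : ℝ) (s : Set ℝ) : Tendsto (pt γ τ t) (𝓝[s] 0) (𝓝 (γ t)) := by
  have : ContinuousAt (pt γ τ t) 0 := by unfold pt; fun_prop
  have h := this.tendsto
  simp only [pt, Complex.ofReal_zero, zero_mul, add_zero] at h
  exact h.mono_left nhdsWithin_le_nhds

/-- boundary data at the point with parameter `t` -/
def Inv (φ : ℂ → ℂ) (γ : ℝ → ℂ) (τ : ℝ) (w : ℝ → ℂ) (c d : ℂ) (t : ℝ) (Gp Gm φp : ℂ) : Prop :=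
  Tendsto (fun ε => T.G (pt γ τ t ε)) (𝓝[>] 0) (𝓝 Gp) ∧
  Tendsto (fun ε => T.G (pt γ τ t ε)) (𝓝[<] 0) (𝓝 Gm) ∧
  Tendsto (fun ε => φ (pt γ τ t ε)) (𝓝[>] 0) (𝓝 φp) ∧
  (∀ᶠ ε in 𝓝[>] 0, pt γ τ t ε ∈ T.Gamᶜ) ∧ (∀ᶠ ε in 𝓝[<] 0, pt γ τ t ε ∈ T.Gamᶜ) ∧
  (∀ᶠ ε in 𝓝[>] 0, pt γ τ t ε ∈ T.Exᶜ) ∧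
  Gm ≠ 0 ∧ Gp * Gm * Complex.exp (w t) = c ∧ Gp / Gm * Complex.exp (2 * φp) = d

lemma inv_local {γ : ℝ → ℂ} {τ : ℝ} (hγ : T.GArc γ τ) {φ : ℂ → ℂ}
    (hφ : ∀ z ∉ T.Ex, HasDerivAt φ (T.c0 * (T.R z / (z ^ 2 - 1))) z)
    {La Lb : ℝ → ℂ} (hLa : ContinuousOn La (Icc 0 1)) (hLb : ContinuousOn Lb (Icc 0 1))
    (hea : ∀ t ∈ Icc (0:ℝ) 1, Complex.exp (La t) = 1 - γ t)
    (heb : ∀ t ∈ Icc (0:ℝ) 1, Complex.exp (Lb t) = 1 + γ t)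
    {t0 : ℝ} (ht0 : t0 ∈ Ioo (0:ℝ) 1) :
    ∃ c d : ℂ, ∀ᶠ t in 𝓝 t0, ∃ Gp Gm φp,
      T.Inv φ γ τ (fun t => -(2 * T.c0 * T.a * La t + 2 * T.c0 * T.b * Lb t)) c d t Gp Gm φp := by
  have hI : Icc (0:ℝ) 1 ∈ 𝓝 t0 := Icc_mem_nhds ht0.1 ht0.2
  have ht0c : t0 ∈ Icc (0:ℝ) 1 := ⟨ht0.1.le, ht0.2.le⟩
  set z0 := γ t0 with hz0
  have n1 : 1 - z0 ≠ 0 := by rw [← hea t0 ht0c]; exact Complex.exp_ne_zero _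
  have n2 : 1 + z0 ≠ 0 := by rw [← heb t0 ht0c]; exact Complex.exp_ne_zero _
  have ev : ∀ᶠ z in 𝓝 z0, ((starRingEnd ℂ) z ∉ T.OL) ∧ (1 - z) / (1 - z0) ∈ slitPlane ∧
      (1 + z) / (1 + z0) ∈ slitPlane := by
    refine (hγ.avoid ht0).and (Filter.Eventually.and ?_ ?_)
    · have : ContinuousAt (fun z => (1 - z) / (1 - z0)) z0 := by fun_prop
      exact this (isOpen_slitPlane.mem_nhds (by simp only [div_self n1]; simp))
    · have : ContinuousAt (fun z => (1 + z) / (1 + z0)) z0 := by fun_prop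
      exact this (isOpen_slitPlane.mem_nhds (by simp only [div_self n2]; simp))
  obtain ⟨O, hOs, hO, hzO⟩ := mem_nhds_iff.1 ev
  obtain ⟨N, r, Φ, hNO, L, σ, hσ, hev⟩ := hγ.chart ht0 hO hzO
  have hσ0 : σ ≠ 0 := by rcases hσ with h | h <;> rw [h] <;> norm_num
  have hσ' : -σ = 1 ∨ -σ = -1 := by rcases hσ with h | h <;> rw [h] <;> simp
  set la : ℂ → ℂ := fun z => Complex.log ((1 - z) / (1 - z0)) with hla
  set lb : ℂ → ℂ := fun z => Complex.log ((1 + z) / (1 + z0)) with hlb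
  have dla : ∀ z ∈ N, HasDerivAt la (1 / (z - 1)) z := by
    intro z hz
    have h1 : HasDerivAt (fun z => (1 - z) / (1 - z0)) (-1 / (1 - z0)) z :=
      ((hasDerivAt_id z).const_sub 1).div_const _
    have h2 := h1.clog (hOs (hNO hz)).2.1
    convert h2 using 1
    have : z - 1 ≠ 0 := sub_ne_zero.2 (L.ne z hz).1
    have : 1 - z ≠ 0 := sub_ne_zero.2 (L.ne z hz).1.symm
    field_simp; ring
  have dlb : ∀ z ∈ N, HasDerivAt lb (1 / (z + 1)) z := by
    intro z hz
    have h1 : HasDerivAt (fun z => (1 + z) / (1 + z0)) (1 / (1 + z0)) z :=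
      ((hasDerivAt_id z).const_add 1).div_const _
    have h2 := h1.clog (hOs (hNO hz)).2.2
    convert h2 using 1
    have : z + 1 ≠ 0 := fun h => (L.ne z hz).2 (eq_neg_of_add_eq_zero_left h)
    have : 1 + z ≠ 0 := by rwa [add_comm]
    field_simp; ring
  obtain ⟨K1, k1, hK1⟩ := T.side_G L hσ dla dlb
  obtain ⟨K2, k2, hK2⟩ := T.side_G L hσ' dla dlb
  have hUn : {z ∈ N | 0 < σ * (Φ z).re} ⊆ T.Un := by
    obtain ⟨ε, h1, h2⟩ := (hev.self_of_nhds.2.2.2.1.and (hγ.plus ht0)).exists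
    exact T.sub_of_mem_Un (L.pc σ hσ0) (SzDat.loc_side_sub L σ) h1 h2
  have hEx : {z ∈ N | 0 < σ * (Φ z).re} ⊆ T.Exᶜ := by
    rintro z hz ((h | h) | h)
    · exact SzDat.loc_side_sub L σ hz (T.GC_sub h)
    · exact (hOs (hNO hz.1)).1 h
    · rcases h with h | h
      · exact (L.ne z hz.1).1 h
      · exact (L.ne z hz.1).2 h
  obtain ⟨C, hC⟩ := T.side_phi L hσ hUn (fun z hz => hφ z (hEx hz))
  refine ⟨K1 * K2 * Complex.exp (-(2 * T.c0 * T.a * La t0 + 2 * T.c0 * T.b * Lb t0)),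
    K1 / K2 * Complex.exp (2 * C), ?_⟩
  have ela := log_near (hLa.continuousAt hI) (v := fun t => 1 - γ t)
    (by filter_upwards [hI] with t ht using hea t ht)
  have elb := log_near (hLb.continuousAt hI) (v := fun t => 1 + γ t)
    (by filter_upwards [hI] with t ht using heb t ht)
  filter_upwards [hev, ela, elb] with t h ha hb
  obtain ⟨hti, hN, hre, hp, hm⟩ := h
  have cΦ : ContinuousAt Φ (γ t) := (L.der _ hN).continuousAt
  have ca : ContinuousAt la (γ t) := (dla _ hN).continuousAt
  have cb : ContinuousAt lb (γ t) := (dlb _ hN).continuousAt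
  have lim : ∀ (K : ℂ) (s : ℝ), ContinuousAt (fun z => K * Complex.exp
      ((s:ℂ) * (T.c0 * Φ z) + T.c0 * T.a * la z + T.c0 * T.b * lb z)) (γ t) := by
    intro K s; fun_prop
  refine ⟨_, _, _, ((lim K1 σ).tendsto.comp (pt_tendsto γ τ t _)).congr' ?_,
    ((lim K2 (-σ)).tendsto.comp (pt_tendsto γ τ t _)).congr' ?_,
    ((show ContinuousAt (fun z => C - (σ:ℂ) * (T.c0 * Φ z)) (γ t) by fun_prop).tendsto.comp
      (pt_tendsto γ τ t _)).congr' ?_, ?_, ?_, ?_, ?_, ?_, ?_⟩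
  · filter_upwards [hp] with ε hε
    exact (hK1 _ hε).symm
  · filter_upwards [hm] with ε hε
    exact (hK2 _ hε).symm
  · filter_upwards [hp] with ε hε
    exact (hC _ hε).symm
  · exact hp.mono fun ε hε => SzDat.loc_side_sub L σ hε
  · exact hm.mono fun ε hε => SzDat.loc_side_sub L (-σ) hε
  · exact hp.mono fun ε hε => hEx hε
  · exact mul_ne_zero k2 (Complex.exp_ne_zero _)
  · have e1 : la (γ t) = La t - La t0 := by rw [ha]; simp [hla, hz0]
    have e2 : lb (γ t) = Lb t - Lb t0 := by rw [hb]; simp [hlb, hz0]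
    rw [e1, e2, mul_mul_mul_comm, mul_assoc, ← Complex.exp_add, ← Complex.exp_add]
    congr 2
    push_cast; ring
  · rw [mul_div_mul_comm, ← Complex.exp_sub, mul_assoc, ← Complex.exp_add]
    congr 2
    push_cast; ring

lemma Inv.unique {φ : ℂ → ℂ} {γ : ℝ → ℂ} {τ : ℝ} {w : ℝ → ℂ} {c d c' d' : ℂ} {t : ℝ}
    {Gp Gm φp Gp' Gm' φp' : ℂ} {T : SzG} (h : T.Inv φ γ τ w c d t Gp Gm φp)
    (h' : T.Inv φ γ τ w c' d' t Gp' Gm' φp') : c = c' ∧ d = d' := by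
  obtain ⟨a1, a2, a3, -, -, -, -, a4, a5⟩ := h
  obtain ⟨b1, b2, b3, -, -, -, -, b4, b5⟩ := h'
  have e1 := tendsto_nhds_unique a1 b1
  have e2 := tendsto_nhds_unique a2 b2
  have e3 := tendsto_nhds_unique a3 b3
  subst e1 e2 e3
  exact ⟨a4.symm.trans b4, a5.symm.trans b5⟩

lemma inv_global {γ : ℝ → ℂ} {τ : ℝ} {φ : ℂ → ℂ} {w : ℝ → ℂ}
    (hloc : ∀ t0 ∈ Ioo (0:ℝ) 1, ∃ c d : ℂ, ∀ᶠ t in 𝓝 t0, ∃ Gp Gm φp, T.Inv φ γ τ w c d t Gp Gm φp) :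
    ∃ c d : ℂ, ∀ t ∈ Ioo (0:ℝ) 1, ∃ Gp Gm φp, T.Inv φ γ τ w c d t Gp Gm φp := by
  have hm : (1/2:ℝ) ∈ Ioo (0:ℝ) 1 := by constructor <;> norm_num
  obtain ⟨c, d, hcd⟩ := hloc _ hm
  refine ⟨c, d, ?_⟩
  set S : Set ℝ := {t | ∃ Gp Gm φp, T.Inv φ γ τ w c d t Gp Gm φp} with hS
  have hl : ∀ t0 ∈ Ioo (0:ℝ) 1, (∀ᶠ t in 𝓝 t0, t ∈ S) ∨ (∀ᶠ t in 𝓝 t0, t ∉ S) := by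
    intro t0 ht0
    obtain ⟨c', d', h'⟩ := hloc t0 ht0
    by_cases hh : c = c' ∧ d = d'
    · obtain ⟨rfl, rfl⟩ := hh
      exact Or.inl h'
    · right
      filter_upwards [h'] with t ht hts
      obtain ⟨_, _, _, h1⟩ := hts
      obtain ⟨_, _, _, h2⟩ := ht
      exact hh (h1.unique h2)
  have hsub : Ioo (0:ℝ) 1 ⊆ interior S := by
    refine isPreconnected_Ioo.subset_left_of_subset_union (v := interior Sᶜ) isOpen_interior
      isOpen_interior ?_ ?_ ?_
    · exact Disjoint.mono interior_subset interior_subset disjoint_compl_right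
    · intro t0 ht0
      rcases hl t0 ht0 with h | h
      · left; exact mem_interior_iff_mem_nhds.2 h
      · right; exact mem_interior_iff_mem_nhds.2 h
    · exact ⟨_, hm, mem_interior_iff_mem_nhds.2 hcd⟩
  intro t ht
  have hmem : t ∈ S := interior_subset (hsub ht)
  exact hmem

theorem arc_jump {γ : ℝ → ℂ} {τ : ℝ} (hγ : T.GArc γ τ) {φ : ℂ → ℂ}
    (hφ : ∀ z ∉ T.Ex, HasDerivAt φ (T.c0 * (T.R z / (z ^ 2 - 1))) z)
    (hφ0 : Tendsto φ (𝓝[T.Exᶜ] T.zm) (𝓝 0))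
    {La Lb : ℝ → ℂ} (hLa : ContinuousOn La (Icc 0 1)) (hLb : ContinuousOn Lb (Icc 0 1))
    (hea : ∀ t ∈ Icc (0:ℝ) 1, Complex.exp (La t) = 1 - γ t)
    (heb : ∀ t ∈ Icc (0:ℝ) 1, Complex.exp (Lb t) = 1 + γ t)
    {A B : ℝ} (hA : A = -(2 * T.c0 * T.a)) (hB : B = -(2 * T.c0 * T.b)) {t : ℝ}
    (ht : t ∈ Ioo (0:ℝ) 1) : ∃ Gp Gm φp : ℂ,
      Tendsto (fun ε => T.G (pt γ τ t ε)) (𝓝[>] 0) (𝓝 Gp) ∧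
      Tendsto (fun ε => T.G (pt γ τ t ε)) (𝓝[<] 0) (𝓝 Gm) ∧
      Tendsto (fun ε => φ (pt γ τ t ε)) (𝓝[>] 0) (𝓝 φp) ∧
      Gp * Gm = Complex.exp ((A : ℂ) * La 1 + (B : ℂ) * Lb 1) /
          Complex.exp ((A : ℂ) * La t + (B : ℂ) * Lb t) ∧
      Gp / Gm = Complex.exp (-2 * φp) := by
  obtain ⟨c, d, hcd⟩ := T.inv_global (fun t0 ht0 => T.inv_local hγ hφ hLa hLb hea heb ht0)
  set w : ℝ → ℂ := fun t => -(2 * T.c0 * T.a * La t + 2 * T.c0 * T.b * Lb t) with hw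
  have hwe : ∀ t, w t = (A : ℂ) * La t + (B : ℂ) * Lb t := by
    intro t; rw [hw, hA, hB]; push_cast; ring
  choose! Gp Gm φp hinv using hcd
  have hin : ∀ᶠ t in 𝓝[<] (1:ℝ), t ∈ Ioo (0:ℝ) 1 := Ioo_mem_nhdsLT zero_lt_one
  have hg1 : Tendsto γ (𝓝[<] 1) (𝓝 T.zm) := by
    have h := hγ.arc.smooth.continuous.continuousAt (x := (1:ℝ)).tendsto
    rw [hγ.arc.e1] at h
    exact h.mono_left nhdsWithin_le_nhds
  have l1 : Tendsto Gp (𝓝[<] 1) (𝓝 1) :=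
    bdry_lim T.near_zm.2 hg1 (F := fun _ => 𝓝[>] 0) (pt := pt γ τ) (fun _ => inferInstance)
      (hin.mono fun t ht => ⟨pt_tendsto γ τ t _, (hinv t ht).2.2.2.1, (hinv t ht).1⟩)
  have l2 : Tendsto Gm (𝓝[<] 1) (𝓝 1) :=
    bdry_lim T.near_zm.2 hg1 (F := fun _ => 𝓝[<] 0) (pt := pt γ τ) (fun _ => inferInstance)
      (hin.mono fun t ht => ⟨pt_tendsto γ τ t _, (hinv t ht).2.2.2.2.1, (hinv t ht).2.1⟩)
  have l3 : Tendsto φp (𝓝[<] 1) (𝓝 0) :=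
    bdry_lim hφ0 hg1 (F := fun _ => 𝓝[>] 0) (pt := pt γ τ) (fun _ => inferInstance)
      (hin.mono fun t ht => ⟨pt_tendsto γ τ t _, (hinv t ht).2.2.2.2.2.1, (hinv t ht).2.2.1⟩)
  have hle : 𝓝[<] (1:ℝ) ≤ 𝓝[Icc 0 1] 1 := by
    rw [← nhdsWithin_Ioo_eq_nhdsLT (zero_lt_one (α := ℝ))]
    exact nhdsWithin_mono _ Ioo_subset_Icc_self
  have m1 : (1:ℝ) ∈ Icc (0:ℝ) 1 := by simp
  have l4 : Tendsto w (𝓝[<] 1) (𝓝 (w 1)) := by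
    have h1 : ContinuousWithinAt w (Icc 0 1) 1 := by
      have a1 := hLa 1 m1
      have a2 := hLb 1 m1
      exact ((continuousWithinAt_const.mul a1).add (continuousWithinAt_const.mul a2)).neg
    exact h1.tendsto.mono_left hle
  have l5 : Tendsto (fun t => Gp t * Gm t * Complex.exp (w t)) (𝓝[<] 1)
      (𝓝 (1 * 1 * Complex.exp (w 1))) := (l1.mul l2).mul l4.cexp
  have l6 : Tendsto (fun t => Gp t / Gm t * Complex.exp (2 * φp t)) (𝓝[<] 1)
      (𝓝 (1 / 1 * Complex.exp (2 * 0))) := (l1.div l2 one_ne_zero).mul (l3.const_mul 2).cexp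
  have hc : c = Complex.exp (w 1) := by
    have l7 : Tendsto (fun _ : ℝ => c) (𝓝[<] (1:ℝ)) (𝓝 (1 * 1 * Complex.exp (w 1))) :=
      l5.congr' (hin.mono fun t ht => (hinv t ht).2.2.2.2.2.2.2.1)
    simpa using tendsto_nhds_unique tendsto_const_nhds l7
  have hd : d = 1 := by
    have l7 : Tendsto (fun _ : ℝ => d) (𝓝[<] (1:ℝ)) (𝓝 (1 / 1 * Complex.exp (2 * 0))) :=
      l6.congr' (hin.mono fun t ht => (hinv t ht).2.2.2.2.2.2.2.2)
    simpa using tendsto_nhds_unique tendsto_const_nhds l7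
  obtain ⟨a1, a2, a3, -, -, -, -, a4, a5⟩ := hinv t ht
  refine ⟨_, _, _, a1, a2, a3, ?_, ?_⟩
  · rw [← hwe, ← hwe, eq_div_iff (Complex.exp_ne_zero _), a4, hc]
  · rw [neg_mul, Complex.exp_neg, ← one_mul (Complex.exp _)⁻¹, ← hd, ← a5, mul_assoc, mul_inv_cancel₀ (Complex.exp_ne_zero _), mul_one]

end SzG

/-- the abstract parameters attached to `A`, `B` -/
lemma exists_par (A B : ℝ) (hA : -1 < A) (hA0 : A < 0) (hB : -1 < B) (hB0 : B < 0)
    (hAB1 : A + B < -1) :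
    ∃ P : SzPar, P.zp = zetaP A B ∧ P.zm = zetaM A B ∧ P.a = -A / (A + B + 2) ∧
      P.b = -B / (A + B + 2) := by
  have hD : 0 < A + B + 2 := by linarith
  have hDc : (A:ℂ) + B + 2 ≠ 0 := by
    have : ((A + B + 2 : ℝ) : ℂ) ≠ 0 := by exact_mod_cast hD.ne'
    push_cast at this; exact this
  have hq : 0 < (A + 1) * (B + 1) * (-A - B - 1) :=
    mul_pos (mul_pos (by linarith) (by linarith)) (by linarith)
  have hsq := Real.sq_sqrt hq.le
  set q := Real.sqrt ((A + 1) * (B + 1) * (-A - B - 1)) with hqd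
  have hq0 : 0 < q := Real.sqrt_pos.2 hq
  refine ⟨{ c := (B ^ 2 - A ^ 2) / (A + B + 2) ^ 2, s := 4 * q / (A + B + 2) ^ 2,
            a := -A / (A + B + 2), b := -B / (A + B + 2), hs := by positivity,
            ha := div_pos (by linarith) hD, hb := div_pos (by linarith) hD,
            h1 := ?_, h2 := ?_ }, ?_, ?_, rfl, rfl⟩
  · have e : (4 * q / (A + B + 2) ^ 2) ^ 2 =
        16 * ((A + 1) * (B + 1) * (-A - B - 1)) / (A + B + 2) ^ 4 := by
      rw [← hsq, div_pow, mul_pow, ← pow_mul]; norm_num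
    rw [e]; field_simp; ring
  · have e : (4 * q / (A + B + 2) ^ 2) ^ 2 =
        16 * ((A + 1) * (B + 1) * (-A - B - 1)) / (A + B + 2) ^ 4 := by
      rw [← hsq, div_pow, mul_pow, ← pow_mul]; norm_num
    rw [e]; field_simp; ring
  · unfold SzPar.zp zetaP
    rw [← hqd]; push_cast; field_simp
  · unfold SzPar.zm zetaM
    rw [← hqd]; push_cast; field_simp

lemma deriv_rev (γ : ℝ → ℂ) (t : ℝ) : deriv (fun t => γ (1 - t)) t = -deriv γ (1 - t) := by
  simpa using deriv_comp_const_sub (f := γ) (a := 1) (x := t)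

lemma rev_mem {t : ℝ} (ht : t ∈ Icc (0:ℝ) 1) : 1 - t ∈ Icc (0:ℝ) 1 :=
  ⟨by linarith [ht.2], by linarith [ht.1]⟩

/-- the abstract data attached to the hypotheses -/
lemma exists_SzG (A B : ℝ) (hA : -1 < A) (hA0 : A < 0) (hB : -1 < B) (hB0 : B < 0)
    (hAB1 : A + B < -1)
    (γL γC γR : ℝ → ℂ) (harcs : ArcParam A B γL γC γR)
    (R : ℂ → ℂ) (hR : IsSqrtBranch A B γC R)
    (G : ℂ → ℂ)
    (hG : ∀ z ∉ GammaSet A B, ∀ γ : ℝ → ℂ, ContDiff ℝ 1 γ → γ 0 = zetaM A B → γ 1 = z →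
      (∀ t ∈ Set.Ioc (0:ℝ) 1, γ t ∉ GammaSet A B) →
      G z = Complex.exp (∫ t in (0:ℝ)..1, gD A B R (γ t) * deriv γ t)) :
    ∃ T : SzG, T.zm = zetaM A B ∧ T.Gam = GammaSet A B ∧ T.gL = γL ∧ T.gC = γC ∧
      T.gR = (fun t => γR (1 - t)) ∧ T.R = R ∧ T.G = G ∧ T.c0 = (A + B + 2) / 2 ∧
      A = -(2 * T.c0 * T.a) ∧ B = -(2 * T.c0 * T.b) := by
  have hD : 0 < A + B + 2 := by linarith
  obtain ⟨P, hzp, hzm, ha, hb⟩ := exists_par A B hA hA0 hB hB0 hAB1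
  have hGam : P.Gam = GammaSet A B := by
    unfold SzPar.Gam GammaSet; rw [hzp, hzm]
  have hrev : (fun t => γR (1 - t)) '' Icc (0:ℝ) 1 = γR '' Icc 0 1 := by
    ext z; constructor
    · rintro ⟨t, ht, rfl⟩; exact ⟨1 - t, rev_mem ht, rfl⟩
    · rintro ⟨t, ht, rfl⟩; exact ⟨1 - t, rev_mem ht, by simp⟩
  have hun := harcs.union
  let Q : SzDat :=
    { toSzPar := P
      gL := γL
      gC := γC
      gR := fun t => γR (1 - t)
      aL := { smooth := harcs.smoothL, inj := harcs.injL, reg := harcs.regL,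
              e0 := harcs.endL0.trans hzp.symm, e1 := harcs.endL1.trans hzm.symm,
              sub := fun t ht => by
                rw [hGam, ← hun]; exact Or.inl (Or.inl (mem_image_of_mem _ ht)) }
      aC := { smooth := harcs.smoothC, inj := harcs.injC, reg := harcs.regC,
              e0 := harcs.endC0.trans hzp.symm, e1 := harcs.endC1.trans hzm.symm,
              sub := fun t ht => by
                rw [hGam, ← hun]; exact Or.inl (Or.inr (mem_image_of_mem _ ht)) }
      aR := { smooth := harcs.smoothR.comp (contDiff_const.sub contDiff_id),
              inj := fun t ht t' ht' h => by
                have := harcs.injR (rev_mem ht) (rev_mem ht') h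
                linarith
              reg := fun t ht => by
                rw [deriv_rev]; exact neg_ne_zero.2 (harcs.regR _ (rev_mem ht))
              e0 := by simpa [hzp] using harcs.endR1
              e1 := by simpa [hzm] using harcs.endR0
              sub := fun t ht => by
                rw [hGam, ← hun]; exact Or.inr (mem_image_of_mem _ (rev_mem ht)) }
      union := by rw [hrev, hGam]; exact hun
      crossL := harcs.crossL
      crossC := harcs.crossC
      crossR := fun t ht => harcs.crossR _ (rev_mem ht)
      R := R
      Rd := hR.1
      Rsq := fun z hz => by unfold SzPar.p; rw [hzp, hzm]; exact hR.2.1 z hz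
      Rinf := hR.2.2 }
  have e1 : (A + B + 2) / 2 * P.a = -(A / 2) := by rw [ha]; field_simp
  have e2 : (A + B + 2) / 2 * P.b = -(B / 2) := by rw [hb]; field_simp
  have hgd : ∀ z, Q.gd ((A + B + 2) / 2) z = gD A B R z := by
    intro z
    have c1 : (((A + B + 2) / 2 : ℝ) : ℂ) * (P.a : ℂ) = -((A:ℂ) / 2) := by
      rw [← Complex.ofReal_mul, e1]; push_cast; rfl
    have c2 : (((A + B + 2) / 2 : ℝ) : ℂ) * (P.b : ℂ) = -((B:ℂ) / 2) := by
      rw [← Complex.ofReal_mul, e2]; push_cast; rfl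
    have c3 : (((A + B + 2) / 2 : ℝ) : ℂ) = ((A : ℂ) + B + 2) / 2 := by push_cast; rfl
    classical
    unfold SzDat.gd gD
    change (if IsBounded (connectedComponentIn P.Gamᶜ z) then _ else _) +
      ((((A + B + 2) / 2 : ℝ) : ℂ) * (P.a : ℂ)) / (z - 1) +
      ((((A + B + 2) / 2 : ℝ) : ℂ) * (P.b : ℂ)) / (z + 1) = _
    rw [c1, c2, c3, hGam, neg_div, neg_div, ← sub_eq_add_neg, ← sub_eq_add_neg]
  refine ⟨{ toSzDat := Q, c0 := (A + B + 2) / 2, c0pos := by positivity, hc := ?_, G := G,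
            hG := ?_ }, hzm, hGam, rfl, rfl, rfl, rfl, rfl, rfl, ?_, ?_⟩
  · change (A + B + 2) / 2 * (1 + P.a + P.b) = 1
    linear_combination e1 + e2
  · intro z hz γ h1 h2 h3 h4
    simp only [hgd]
    change z ∉ P.Gam at hz
    change γ 0 = P.zm at h2
    change ∀ t ∈ Set.Ioc (0:ℝ) 1, γ t ∉ P.Gam at h4
    rw [hGam] at hz
    rw [hGam] at h4
    exact hG z hz γ h1 (h2.trans hzm) h3 h4
  · change A = -(2 * ((A + B + 2) / 2) * P.a)
    linear_combination 2 * e1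
  · change B = -(2 * ((A + B + 2) / 2) * P.b)
    linear_combination 2 * e2

/-- jump relations for the exterior Szegő-type function
`G(z) = exp(∫_{ζ₋}^z g′(t) dt)` (path of integration in `ℂ∖Γ` except for its initial
point).  Here `φ` is the single-valued analytic branch of
`((A+B+2)/2)∫_{ζ₋}^z R(t)/(t²−1) dt` on `ℂ∖(Γ_C∪γ_1⁺∪γ_{−1}⁺∪γ_∞⁺)` with `φ(ζ₋)=0`,
and the branch of the weight `w(z;A,B) = (1−z)^A(1+z)^B` on `Γ∖{ζ₊}`, positive at the
point `ξ_C = Γ_C ∩ (−1,1)`, is encoded by the continuous logarithms `LaX, LbX` of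
`1−z`, `1+z` along the three arcs, matching at `ζ₋`, so that
`w(γX(t);A,B) = exp(A·LaX t + B·LbX t)` and `w(ζ₋;A,B) = exp(A·LaC 1 + B·LbC 1)`.
Conclusions: (i) `G` is single-valued and analytic on `ℂ∖Γ` with `G(ζ₋)=1`;
(ii) `κ = lim_{z→∞} G(z)/z` exists and is nonzero; and on each arc of `Γ` (away from
`ζ_±`) the boundary values `G₊, G₋, φ₊` exist and satisfy
(iii) `G₊·G₋ = w(ζ₋;A,B)/w(z;A,B)` and (iv) `G₊/G₋ = exp(−2φ₊)`. -/
theorem szego_function_jump_relations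
    (A B : ℝ) (hA : -1 < A) (hA0 : A < 0) (hB : -1 < B) (hB0 : B < 0)
    (hAB : -2 < A + B) (hAB1 : A + B < -1)
    (γL γC γR : ℝ → ℂ) (harcs : ArcParam A B γL γC γR)
    (R : ℂ → ℂ) (hR : IsSqrtBranch A B γC R)
    -- φ, single-valued and analytic off Γ_C ∪ γ_1⁺ ∪ γ_{−1}⁺ ∪ γ_∞⁺, with φ(ζ₋) = 0
    (φ : ℂ → ℂ)
    (hφ : (∀ z ∉ γC '' Set.Icc 0 1 ∪ orthoUpper A B (γC '' Set.Icc 0 1) R ∪ {(1:ℂ), -1},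
        HasDerivAt φ ((((A : ℂ) + B + 2) / 2) * (R z / (z ^ 2 - 1))) z) ∧
      Tendsto φ (nhdsWithin (zetaM A B)
        (γC '' Set.Icc 0 1 ∪ orthoUpper A B (γC '' Set.Icc 0 1) R ∪ {(1:ℂ), -1})ᶜ)
        (nhds 0))
    -- the Szegő function G, defined by integrating g′ from ζ₋ along paths in ℂ∖Γ
    (G : ℂ → ℂ)
    (hG : ∀ z ∉ GammaSet A B, ∀ γ : ℝ → ℂ, ContDiff ℝ 1 γ → γ 0 = zetaM A B → γ 1 = z →
      (∀ t ∈ Set.Ioc (0:ℝ) 1, γ t ∉ GammaSet A B) →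
      G z = Complex.exp (∫ t in (0:ℝ)..1, gD A B R (γ t) * deriv γ t))
    -- the branch of the weight w(·;A,B) along Γ∖{ζ₊}
    (LaL LbL LaC LbC LaR LbR : ℝ → ℂ)
    (hwcont : ContinuousOn LaL (Set.Icc 0 1) ∧ ContinuousOn LbL (Set.Icc 0 1) ∧
      ContinuousOn LaC (Set.Icc 0 1) ∧ ContinuousOn LbC (Set.Icc 0 1) ∧
      ContinuousOn LaR (Set.Icc 0 1) ∧ ContinuousOn LbR (Set.Icc 0 1))
    (hwlog : ∀ t ∈ Set.Icc (0:ℝ) 1,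
      Complex.exp (LaL t) = 1 - γL t ∧ Complex.exp (LbL t) = 1 + γL t ∧
      Complex.exp (LaC t) = 1 - γC t ∧ Complex.exp (LbC t) = 1 + γC t ∧
      Complex.exp (LaR t) = 1 - γR t ∧ Complex.exp (LbR t) = 1 + γR t)
    -- the branch is continuous across ζ₋ (where the three arcs meet)
    (hwmatch : LaL 1 = LaC 1 ∧ LbL 1 = LbC 1 ∧ LaR 0 = LaC 1 ∧ LbR 0 = LbC 1)
    -- and positive at the real point ξ_C of Γ_C
    (hwpos : ∀ t ∈ Set.Icc (0:ℝ) 1, (γC t).im = 0 → (LaC t).im = 0 ∧ (LbC t).im = 0) :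
    -- (i) G is single-valued and analytic on ℂ∖Γ, with G(ζ₋) = 1
    (DifferentiableOn ℂ G (GammaSet A B)ᶜ ∧
      Tendsto G (nhdsWithin (zetaM A B) (GammaSet A B)ᶜ) (nhds 1)) ∧
    -- (ii) κ = lim_{z→∞} G(z)/z exists and is nonzero
    (∃ κ : ℂ, κ ≠ 0 ∧
      Tendsto (fun z => G z / z)
        (Bornology.cobounded ℂ ⊓ Filter.principal (GammaSet A B)ᶜ) (nhds κ)) ∧
    -- (iii) and (iv) on the arc Γ_L
    (∀ t ∈ Set.Ioo (0:ℝ) 1, ∃ Gp Gm φp : ℂ,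
      Tendsto (fun ε : ℝ => G (γL t + (ε : ℂ) * (Complex.I * deriv γL t)))
        (nhdsWithin 0 (Set.Ioi 0)) (nhds Gp) ∧
      Tendsto (fun ε : ℝ => G (γL t + (ε : ℂ) * (Complex.I * deriv γL t)))
        (nhdsWithin 0 (Set.Iio 0)) (nhds Gm) ∧
      Tendsto (fun ε : ℝ => φ (γL t + (ε : ℂ) * (Complex.I * deriv γL t)))
        (nhdsWithin 0 (Set.Ioi 0)) (nhds φp) ∧
      Gp * Gm = Complex.exp ((A : ℂ) * LaC 1 + (B : ℂ) * LbC 1) /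
          Complex.exp ((A : ℂ) * LaL t + (B : ℂ) * LbL t) ∧
      Gp / Gm = Complex.exp (-2 * φp)) ∧
    -- (iii) and (iv) on the arc Γ_C
    (∀ t ∈ Set.Ioo (0:ℝ) 1, ∃ Gp Gm φp : ℂ,
      Tendsto (fun ε : ℝ => G (γC t + (ε : ℂ) * (Complex.I * deriv γC t)))
        (nhdsWithin 0 (Set.Ioi 0)) (nhds Gp) ∧
      Tendsto (fun ε : ℝ => G (γC t + (ε : ℂ) * (Complex.I * deriv γC t)))
        (nhdsWithin 0 (Set.Iio 0)) (nhds Gm) ∧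
      Tendsto (fun ε : ℝ => φ (γC t + (ε : ℂ) * (Complex.I * deriv γC t)))
        (nhdsWithin 0 (Set.Ioi 0)) (nhds φp) ∧
      Gp * Gm = Complex.exp ((A : ℂ) * LaC 1 + (B : ℂ) * LbC 1) /
          Complex.exp ((A : ℂ) * LaC t + (B : ℂ) * LbC t) ∧
      Gp / Gm = Complex.exp (-2 * φp)) ∧
    -- (iii) and (iv) on the arc Γ_R
    (∀ t ∈ Set.Ioo (0:ℝ) 1, ∃ Gp Gm φp : ℂ,
      Tendsto (fun ε : ℝ => G (γR t + (ε : ℂ) * (Complex.I * deriv γR t)))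
        (nhdsWithin 0 (Set.Ioi 0)) (nhds Gp) ∧
      Tendsto (fun ε : ℝ => G (γR t + (ε : ℂ) * (Complex.I * deriv γR t)))
        (nhdsWithin 0 (Set.Iio 0)) (nhds Gm) ∧
      Tendsto (fun ε : ℝ => φ (γR t + (ε : ℂ) * (Complex.I * deriv γR t)))
        (nhdsWithin 0 (Set.Ioi 0)) (nhds φp) ∧
      Gp * Gm = Complex.exp ((A : ℂ) * LaC 1 + (B : ℂ) * LbC 1) /
          Complex.exp ((A : ℂ) * LaR t + (B : ℂ) * LbR t) ∧
      Gp / Gm = Complex.exp (-2 * φp)) := by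
  obtain ⟨T, hzm, hGam, hL, hC, hRr, hRR, hGG, hc0, hAe, hBe⟩ :=
    exists_SzG A B hA hA0 hB hB0 hAB1 γL γC γR harcs R hR G hG
  have hEx : T.Ex = γC '' Set.Icc 0 1 ∪ orthoUpper A B (γC '' Set.Icc 0 1) R ∪ {(1:ℂ), -1} := by
    unfold SzG.Ex orthoUpper SzDat.OL orthoLower SzDat.GC
    rw [hC, hzm, hRR]
  have hφ1 : ∀ z ∉ T.Ex, HasDerivAt φ (T.c0 * (T.R z / (z ^ 2 - 1))) z := by
    intro z hz
    rw [hEx] at hz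
    have := hφ.1 z hz
    rw [hRR, hc0]; push_cast; exact this
  have hφ2 : Tendsto φ (𝓝[T.Exᶜ] T.zm) (𝓝 0) := by
    rw [hEx, hzm]; exact hφ.2
  obtain ⟨cLa, cLb, cCa, cCb, cRa, cRb⟩ := hwcont
  obtain ⟨mLa, mLb, mRa, mRb⟩ := hwmatch
  have gaL := T.garc_L
  have gaC := T.garc_C
  have gaR := T.garc_R
  rw [hL] at gaL
  rw [hC] at gaC
  rw [hRr] at gaR
  refine ⟨⟨?_, ?_⟩, ?_, ?_, ?_, ?_⟩
  · rw [← hGam, ← hGG]; exact T.G_diff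
  · rw [← hGam, ← hGG, ← hzm]; exact T.near_zm.2
  · obtain ⟨κ, hκ, h⟩ := T.G_inf
    rw [hGG] at h
    exact ⟨κ, hκ, h.mono_left inf_le_left⟩
  · intro t ht
    have h := T.arc_jump gaL hφ1 hφ2 cLa cLb (fun t ht => (hwlog t ht).1)
      (fun t ht => (hwlog t ht).2.1) hAe hBe ht
    rw [mLa, mLb, hGG] at h
    simpa only [SzG.pt, Complex.ofReal_one, one_mul] using h
  · intro t ht
    have h := T.arc_jump gaC hφ1 hφ2 cCa cCb (fun t ht => (hwlog t ht).2.2.1)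
      (fun t ht => (hwlog t ht).2.2.2.1) hAe hBe ht
    rw [hGG] at h
    simpa only [SzG.pt, Complex.ofReal_one, one_mul] using h
  · intro t ht
    have ht' : 1 - t ∈ Ioo (0:ℝ) 1 := ⟨by linarith [ht.2], by linarith [ht.1]⟩
    have hcr : ∀ f : ℝ → ℂ, ContinuousOn f (Icc 0 1) →
        ContinuousOn (fun t => f (1 - t)) (Icc 0 1) := fun f hf =>
      hf.comp (by fun_prop) (fun t ht => rev_mem ht)
    have h := T.arc_jump gaR hφ1 hφ2 (hcr _ cRa) (hcr _ cRb)
      (fun t ht => (hwlog _ (rev_mem ht)).2.2.2.2.1)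
      (fun t ht => (hwlog _ (rev_mem ht)).2.2.2.2.2) hAe hBe ht'
    have hpt : ∀ ε : ℝ, SzG.pt (fun t => γR (1 - t)) (-1) (1 - t) ε =
        γR t + (ε : ℂ) * (Complex.I * deriv γR t) := by
      intro ε
      unfold SzG.pt
      rw [deriv_rev]
      simp
    simp only [hpt, sub_self, sub_sub_cancel, mRa, mRb, hGG] at h
    exact h

end
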